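/- Let (r_1,…,r_m), (s_1,…,s_m) ∈ ℤ^m with all entries > 1, and let f, g ∈ k[Z,T] be non-trivial lines. Then A(r_1,…,r_m,f) ≅ A(s_1,…,s_m,g) as k-algebras if and only if (r_1,…,r_m) equals (s_1,…,s_m) up to a permutation of {1,…,m} and there exist a k-algebra automorphism α of k[Z,T] and μ ∈ k* such that α(g) = μ·f. -/

import Mathlib

/-!
Common definitions: exponential maps, the Derksen and Makar-Limanov invariants,
𝔸ⁿ-fibrations, and the ring
`A = k[X_1,…,X_m,Y,Z,T]/(X_1^{r_1}⋯X_m^{r_m}·Y − F(X_1,…,X_m,Z,T))`.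
-/

noncomputable section
open MvPolynomial

/-- An exponential map on a `k`-algebra `D`: a `k`-algebra homomorphism `φ : D → D[U]`
such that evaluating `U` at `0` gives the identity of `D`, and such that
`φ_V ∘ φ_U = φ_{U+V}` in `D[U,V]` (where `φ_V : D[U] → D[U,V]` extends `φ` with
`φ_V(U) = U`).  Here `D[U,V]` is modelled as `Polynomial (Polynomial D)`, with inner
variable `U` and outer variable `V`. -/
structure ExpMap (k D : Type) [CommRing k] [CommRing D] [Algebra k D] where
  toAlgHom : D →ₐ[k] Polynomial D
  eval_zero : ∀ d, Polynomial.eval 0 (toAlgHom d) = d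
  comp_add : ∀ d,
    Polynomial.eval₂ ((Polynomial.mapRingHom (Polynomial.C (R := D))).comp toAlgHom.toRingHom)
      (Polynomial.C Polynomial.X) (toAlgHom d)
    = Polynomial.eval₂ ((Polynomial.C (R := Polynomial D)).comp (Polynomial.C (R := D)))
      (Polynomial.C Polynomial.X + Polynomial.X) (toAlgHom d)

namespace ExpMap
variable {k D : Type} [CommRing k] [CommRing D] [Algebra k D]

/-- The ring of invariants `D^φ = {d ∈ D | φ(d) = d}` of an exponential map. -/
def invariants (φ : ExpMap k D) : Subalgebra k D where
  carrier := {d | φ.toAlgHom d = Polynomial.C d}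
  mul_mem' := fun ha hb => by
    simp only [Set.mem_setOf_eq] at *
    rw [map_mul, ha, hb, ← map_mul]
  add_mem' := fun ha hb => by
    simp only [Set.mem_setOf_eq] at *
    rw [map_add, ha, hb, ← map_add]
  algebraMap_mem' := fun c => by
    simp only [Set.mem_setOf_eq, AlgHom.commutes, Polynomial.algebraMap_apply]

end ExpMap

/-- The Derksen invariant `DK(D)`: the `k`-subalgebra of `D` generated by the rings of
invariants of all non-trivial exponential maps on `D`. -/
def Derksen (k D : Type) [CommRing k] [CommRing D] [Algebra k D] : Subalgebra k D :=
  Algebra.adjoin k (⋃ φ ∈ {ψ : ExpMap k D | ψ.invariants ≠ ⊤}, (φ.invariants : Set D))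

/-- The Makar-Limanov invariant `ML(D)`: the intersection of the rings of invariants of
all exponential maps on `D`. -/
def MakarLimanov (k D : Type) [CommRing k] [CommRing D] [Algebra k D] : Subalgebra k D :=
  ⨅ φ : ExpMap k D, φ.invariants

/-- `D` is an `𝔸ⁿ`-fibration over `R`: a finitely generated flat `R`-algebra all of whose
fibres `D ⊗_R κ(p)` over primes `p` of `R` are polynomial rings `κ(p)^{[n]}`. -/
def IsAnFibration (R D : Type) [CommRing R] [CommRing D] [Algebra R D] (n : ℕ) : Prop :=
  Algebra.FiniteType R D ∧ Module.Flat R D ∧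
  ∀ p : PrimeSpectrum R,
    Nonempty ((TensorProduct R (IsLocalRing.ResidueField (Localization.AtPrime p.asIdeal)) D)
      ≃ₐ[IsLocalRing.ResidueField (Localization.AtPrime p.asIdeal)]
      MvPolynomial (Fin n) (IsLocalRing.ResidueField (Localization.AtPrime p.asIdeal)))

/-- The polynomial ring `k[X_1,…,X_m,Y,Z,T]`:
variables `Sum.inl i` are the `X i`; `Sum.inr 0 = Y`, `Sum.inr 1 = Z`, `Sum.inr 2 = T`. -/
abbrev BigP (k : Type) [CommRing k] (m : ℕ) := MvPolynomial (Fin m ⊕ Fin 3) k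

/-- The inclusion `k[X_1,…,X_m,Z,T] → k[X_1,…,X_m,Y,Z,T]` (in the source,
`Sum.inr 0 = Z` and `Sum.inr 1 = T`). -/
def incl (k : Type) [CommRing k] (m : ℕ) : MvPolynomial (Fin m ⊕ Fin 2) k →ₐ[k] BigP k m :=
  rename (Sum.map id Fin.succ)

/-- The polynomial `G = X_1^{r_1}⋯X_m^{r_m}·Y − F(X_1,…,X_m,Z,T)`. -/
def relG (k : Type) [CommRing k] (m : ℕ) (r : Fin m → ℕ) (F : MvPolynomial (Fin m ⊕ Fin 2) k) :
    BigP k m :=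
  (∏ i, X (Sum.inl i) ^ r i) * X (Sum.inr 0) - incl k m F

/-- The ring `A = k[X_1,…,X_m,Y,Z,T]/(X_1^{r_1}⋯X_m^{r_m}·Y − F(X_1,…,X_m,Z,T))`. -/
abbrev RingA (k : Type) [CommRing k] (m : ℕ) (r : Fin m → ℕ)
    (F : MvPolynomial (Fin m ⊕ Fin 2) k) :=
  BigP k m ⧸ Ideal.span {relG k m r F}

variable (k : Type) [CommRing k] (m : ℕ) (r : Fin m → ℕ) (F : MvPolynomial (Fin m ⊕ Fin 2) k)

/-- `x i`, the image of `X i` in `A`. -/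
def xA (i : Fin m) : RingA k m r F := Ideal.Quotient.mk _ (X (Sum.inl i))
/-- `y`, the image of `Y` in `A`. -/
def yA : RingA k m r F := Ideal.Quotient.mk _ (X (Sum.inr 0))
/-- `z`, the image of `Z` in `A`. -/
def zA : RingA k m r F := Ideal.Quotient.mk _ (X (Sum.inr 1))
/-- `t`, the image of `T` in `A`. -/
def tA : RingA k m r F := Ideal.Quotient.mk _ (X (Sum.inr 2))

/-- `f(Z,T) := F(0,…,0,Z,T) ∈ k[Z,T]`. -/
def fOf : MvPolynomial (Fin 2) k :=
  aeval (Sum.elim (fun _ => (0 : MvPolynomial (Fin 2) k)) X) F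

/-- The subalgebra `E = k[x_1,…,x_m]` of `A`. -/
def EA : Subalgebra k (RingA k m r F) := Algebra.adjoin k (Set.range (xA k m r F))

/-- The subalgebra `B = k[x_1,…,x_m,z,t]` of `A`. -/
def BA : Subalgebra k (RingA k m r F) :=
  Algebra.adjoin k (Set.range (xA k m r F) ∪ {zA k m r F, tA k m r F})

/-!
STATEMENT 17 (Theorem `isocl1`).  Let `(r_1,…,r_m), (s_1,…,s_m) ∈ ℤ^m` with all entries
`> 1`, and let `f, g ∈ k[Z,T]` be non-trivial lines.  Then
`A(r_1,…,r_m,f) ≅ A(s_1,…,s_m,g)` as `k`-algebras if and only if `(r_1,…,r_m)` equals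
`(s_1,…,s_m)` up to a permutation of `{1,…,m}` and there are a `k`-algebra automorphism
`α` of `k[Z,T]` and `μ ∈ k*` with `α(g) = μ·f`.

Here `A(r_1,…,r_m,f) = k[X_1,…,X_m,Y,Z,T]/(X_1^{r_1}⋯X_m^{r_m}Y − f(Z,T))` is
`RingA k m r (rename Sum.inr f)`.
-/

/-- `f ∈ k[Z,T]` is a non-trivial line: `k[Z,T]/(f) = k^{[1]}` but
`k[Z,T] ≠ k[f]^{[1]}`. -/
def IsNontrivialLine (k : Type) [Field k] (f : MvPolynomial (Fin 2) k) : Prop :=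
  Nonempty ((MvPolynomial (Fin 2) k ⧸ Ideal.span {f}) ≃ₐ[k] Polynomial k) ∧
  ¬ Nonempty (Polynomial ↥(Algebra.adjoin k {f})
      ≃ₐ[↥(Algebra.adjoin k {f})] MvPolynomial (Fin 2) k)

namespace ExpLines

open Finset in
/-- An algebraic (locally finite, iterative) higher derivation of a `k`-algebra. -/
structure IsHD (k : Type*) {A : Type*} [Field k] [CommRing A] [Algebra k A]
    (D : ℕ → A →ₗ[k] A) : Prop where
  zero : ∀ a, D 0 a = a
  one : ∀ n, 1 ≤ n → D n 1 = 0
  leib : ∀ n a b, D n (a * b) = ∑ p ∈ antidiagonal n, D p.1 a * D p.2 b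
  fin : ∀ a, ∃ N, ∀ n, N < n → D n a = 0
  iter : ∀ i j a, D i (D j a) = (i + j).choose i • D (i + j) a

namespace IsHD

section Basic

variable {k A : Type*} [Field k] [CommRing A] [Algebra k A] {D : ℕ → A →ₗ[k] A}

/-- The constants of a higher derivation. -/
def ker (h : IsHD k D) : Subalgebra k A where
  carrier := {a | ∀ n, 1 ≤ n → D n a = 0}
  mul_mem' := by
    intro a b ha hb n hn
    rw [h.leib]
    refine Finset.sum_eq_zero fun p hp => ?_
    rw [Finset.HasAntidiagonal.mem_antidiagonal] at hp
    rcases Nat.eq_zero_or_pos p.1 with h1 | h1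
    · rw [hb p.2 (by omega), mul_zero]
    · rw [ha p.1 h1, zero_mul]
  add_mem' := by
    intro a b ha hb n hn
    rw [map_add, ha n hn, hb n hn, add_zero]
  algebraMap_mem' := by
    intro c n hn
    rw [Algebra.algebraMap_eq_smul_one, map_smul, h.one n hn, smul_zero]

theorem mem_ker (h : IsHD k D) {a : A} : a ∈ h.ker ↔ ∀ n, 1 ≤ n → D n a = 0 := Iff.rfl

open Classical in
/-- The finite set of orders at which the higher derivation does not vanish on `a`. -/
def supp (h : IsHD k D) (a : A) : Finset ℕ :=
  (Finset.range ((h.fin a).choose + 1)).filter fun n => D n a ≠ 0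

theorem mem_supp (h : IsHD k D) {a : A} {n : ℕ} : n ∈ h.supp a ↔ D n a ≠ 0 := by
  classical
  rw [supp, Finset.mem_filter, Finset.mem_range, and_iff_right_iff_imp]
  intro hn
  by_contra hc
  exact hn ((h.fin a).choose_spec n (by omega))

/-- The polynomial `∑ D n a X ^ n`. -/
def poly (h : IsHD k D) (a : A) : Polynomial A :=
  ∑ n ∈ h.supp a, Polynomial.monomial n (D n a)

theorem coeff_poly (h : IsHD k D) (a : A) (n : ℕ) : (h.poly a).coeff n = D n a := by
  rw [poly, Polynomial.finsetSum_coeff]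
  simp only [Polynomial.coeff_monomial]
  rw [Finset.sum_ite_eq' (h.supp a) n]
  split_ifs with hn
  · rfl
  · rw [h.mem_supp, not_not] at hn
    exact hn.symm

/-- The exponential map attached to a higher derivation. -/
def polyHom (h : IsHD k D) : A →+* Polynomial A where
  toFun := h.poly
  map_one' := by
    ext n
    rw [coeff_poly, Polynomial.coeff_one]
    split_ifs with hn
    · rw [hn, h.zero]
    · exact h.one n (by omega)
  map_mul' a b := by
    ext n
    rw [coeff_poly, Polynomial.coeff_mul, h.leib]
    simp only [coeff_poly]
  map_zero' := by
    ext n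
    rw [coeff_poly, map_zero, Polynomial.coeff_zero]
  map_add' a b := by
    ext n
    simp only [coeff_poly, map_add, Polynomial.coeff_add]

theorem coeff_polyHom (h : IsHD k D) (a : A) (n : ℕ) : (h.polyHom a).coeff n = D n a :=
  h.coeff_poly a n

theorem polyHom_ne_zero (h : IsHD k D) {a : A} (ha : a ≠ 0) : h.polyHom a ≠ 0 := by
  intro hc
  apply ha
  rw [← h.zero a, ← coeff_polyHom h, hc, Polynomial.coeff_zero]

/-- The degree of an element with respect to a higher derivation. -/
def deg (h : IsHD k D) (a : A) : ℕ := (h.polyHom a).natDegree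

theorem eq_zero_of_deg_lt (h : IsHD k D) {a : A} {n : ℕ} (hn : h.deg a < n) : D n a = 0 := by
  rw [← coeff_polyHom h]
  exact Polynomial.coeff_eq_zero_of_natDegree_lt hn

theorem deg_le (h : IsHD k D) {a : A} {N : ℕ} (hN : ∀ n, N < n → D n a = 0) : h.deg a ≤ N := by
  refine Polynomial.natDegree_le_iff_coeff_eq_zero.2 fun n hn => ?_
  rw [coeff_polyHom, hN n hn]

theorem deg_ne_zero_of (h : IsHD k D) {a : A} (ha : a ≠ 0) : D (h.deg a) a ≠ 0 := by
  rw [← coeff_polyHom h]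
  exact Polynomial.leadingCoeff_ne_zero.2 (h.polyHom_ne_zero ha)

theorem le_deg (h : IsHD k D) {a : A} {n : ℕ} (hn : D n a ≠ 0) : n ≤ h.deg a := by
  by_contra hc
  exact hn (h.eq_zero_of_deg_lt (not_le.1 hc))

theorem mem_ker_iff_deg (h : IsHD k D) {a : A} : a ∈ h.ker ↔ h.deg a = 0 := by
  constructor
  · intro ha
    exact Nat.le_zero.1 (h.deg_le fun n hn => ha n hn)
  · intro ha n hn
    exact h.eq_zero_of_deg_lt (by omega)

theorem polyHom_of_mem_ker (h : IsHD k D) {a : A} (ha : a ∈ h.ker) :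
    h.polyHom a = Polynomial.C a := by
  ext n
  rw [coeff_polyHom, Polynomial.coeff_C]
  split_ifs with hn
  · rw [hn, h.zero]
  · exact ha n (by omega)

theorem map_mul_left (h : IsHD k D) {a : A} (ha : a ∈ h.ker) (n : ℕ) (b : A) :
    D n (a * b) = a * D n b := by
  rw [← coeff_polyHom h, map_mul, h.polyHom_of_mem_ker ha, Polynomial.coeff_C_mul, coeff_polyHom]

theorem top_mem_ker (h : IsHD k D) {a : A} {n : ℕ} (hn : h.deg a ≤ n) : D n a ∈ h.ker := by
  intro i hi
  rw [h.iter, h.eq_zero_of_deg_lt (by omega), smul_zero]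

theorem deg_mul [IsDomain A] (h : IsHD k D) {a b : A} (ha : a ≠ 0) (hb : b ≠ 0) :
    h.deg (a * b) = h.deg a + h.deg b := by
  rw [deg, map_mul, Polynomial.natDegree_mul (h.polyHom_ne_zero ha) (h.polyHom_ne_zero hb)]
  rfl

theorem left_mem_ker_of_mul [IsDomain A] (h : IsHD k D) {a b : A} (hab : a * b ∈ h.ker)
    (h0 : a * b ≠ 0) : a ∈ h.ker := by
  rw [mem_ker_iff_deg, h.deg_mul (left_ne_zero_of_mul h0) (right_ne_zero_of_mul h0)] at hab
  rw [mem_ker_iff_deg]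
  omega

theorem right_mem_ker_of_mul [IsDomain A] (h : IsHD k D) {a b : A} (hab : a * b ∈ h.ker)
    (h0 : a * b ≠ 0) : b ∈ h.ker :=
  h.left_mem_ker_of_mul (mul_comm a b ▸ hab) (mul_comm a b ▸ h0)

theorem ne_bot_iff (h : IsHD k D) : h.ker ≠ ⊤ ↔ ∃ n a, 1 ≤ n ∧ D n a ≠ 0 := by
  rw [Ne, Algebra.eq_top_iff]
  simp only [mem_ker]
  push Not
  constructor
  · rintro ⟨a, n, h1, h2⟩
    exact ⟨n, a, h1, h2⟩
  · rintro ⟨n, a, h1, h2⟩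
    exact ⟨a, n, h1, h2⟩

/-- Elements algebraic over the constants are constants. -/
theorem mem_ker_of_aeval_eq_zero [IsDomain A] (h : IsHD k D) {a : A} {p : Polynomial A}
    (hp : ∀ n, p.coeff n ∈ h.ker) (h0 : p ≠ 0) (ha : p.eval a = 0) : a ∈ h.ker := by
  by_contra hc
  have hd : 0 < (h.polyHom a).natDegree := Nat.pos_of_ne_zero fun h1 => hc (h.mem_ker_iff_deg.2 h1)
  have h1 : h.polyHom (p.eval a) = (p.comp (h.polyHom a)) := by
    rw [Polynomial.eval_eq_sum_range, map_sum, Polynomial.comp, Polynomial.eval₂_eq_sum_range]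
    refine Finset.sum_congr rfl fun i _ => ?_
    rw [map_mul, map_pow, h.polyHom_of_mem_ker (hp i)]
  rw [ha, map_zero] at h1
  have h2 := Polynomial.comp_eq_zero_iff.1 h1.symm
  rcases h2 with h2 | ⟨_, h2⟩
  · exact h0 h2
  · rw [h2, Polynomial.natDegree_C] at hd
    exact lt_irrefl _ hd

/-- Transport of a higher derivation along an isomorphism. -/
theorem conj {B : Type*} [CommRing B] [Algebra k B] (h : IsHD k D) (e : A ≃ₐ[k] B) :
    IsHD k (fun n => e.toLinearMap ∘ₗ D n ∘ₗ e.symm.toLinearMap) where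
  zero a := by simp [h.zero]
  one n hn := by simp [h.one n hn]
  leib n a b := by simp [h.leib, map_sum]
  fin a := by
    obtain ⟨N, hN⟩ := h.fin (e.symm a)
    exact ⟨N, fun n hn => by simp [hN n hn]⟩
  iter i j a := by simp [h.iter]

theorem conj_mem_ker {B : Type*} [CommRing B] [Algebra k B] (h : IsHD k D) (e : A ≃ₐ[k] B) {a : A} :
    e a ∈ (h.conj e).ker ↔ a ∈ h.ker := by
  simp [mem_ker]

end Basic

end IsHD
end ExpLines

namespace ExpLines

namespace IsHD

section Slice

variable {k A : Type*} [Field k] [CommRing A] [IsDomain A] [Algebra k A] {D : ℕ → A →ₗ[k] A}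

/-- If the intermediate binomial coefficients of `e` vanish in `R`, then
`(q * e + ρ).choose ρ = 1` in `R` for `ρ < e`. -/
theorem choose_eq_one {R : Type*} [CommRing R] {e : ℕ}
    (he : ∀ n, 0 < n → n < e → (e.choose n : R) = 0) (q ρ : ℕ) (hρ : ρ < e) :
    ((q * e + ρ).choose ρ : R) = 1 := by
  have h1 : ((1 : Polynomial R) + Polynomial.X) ^ e = 1 + Polynomial.X ^ e := by
    ext n
    rw [Polynomial.coeff_one_add_X_pow, Polynomial.coeff_add, Polynomial.coeff_one,
      Polynomial.coeff_X_pow]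
    rcases Nat.eq_zero_or_pos n with rfl | hn
    · simpa using fun hc : 0 = e => absurd hc (by omega)
    · rcases lt_trichotomy n e with h | h | h
      · simp [he n hn h, hn.ne', h.ne]
      · simpa [h] using fun hc : e = 0 => absurd hc (by omega)
      · simp [Nat.choose_eq_zero_of_lt h, hn.ne', h.ne']
  have h2 : ∀ q : ℕ, ∃ p : Polynomial R,
      ((1 : Polynomial R) + Polynomial.X ^ e) ^ q = 1 + Polynomial.X ^ e * p := by
    intro q
    induction q with
    | zero => exact ⟨0, by simp⟩
    | succ q ih =>
      obtain ⟨p, hp⟩ := ih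
      exact ⟨1 + p + Polynomial.X ^ e * p, by rw [pow_succ, hp]; ring⟩
  obtain ⟨p, hp⟩ := h2 q
  rw [← Polynomial.coeff_one_add_X_pow R, pow_add, mul_comm q e, pow_mul, h1, hp, add_mul, one_mul,
    mul_assoc, Polynomial.coeff_add, Polynomial.coeff_one_add_X_pow, Nat.choose_self,
    Polynomial.coeff_X_pow_mul', if_neg (by omega)]
  simp

variable (h : IsHD k D) (𝒢 : ℝ → Submodule k A) {ω₀ t : ℝ} {w : A}
  (hD : ∀ (s : ℝ) (a : A) (n : ℕ), a ∈ 𝒢 s → D n a ∈ 𝒢 (s - n * ω₀))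
  (hw : w ∈ 𝒢 t) (hwk : w ∉ h.ker)
  (hmin : ∀ s a, a ∈ 𝒢 s → a ∉ h.ker → h.deg w ≤ h.deg a)

include hD hw hwk hmin

theorem choose_deg_eq_zero (n : ℕ) (h0 : 0 < n) (hn : n < h.deg w) :
    ((h.deg w).choose n : A) = 0 := by
  have h1 : D (h.deg w - n) w ∈ h.ker := by
    by_contra hc
    have h2 := hmin _ _ (hD _ _ (h.deg w - n) hw) hc
    have h3 : h.deg (D (h.deg w - n) w) ≤ n := h.deg_le fun i hi => by
      rw [h.iter, h.eq_zero_of_deg_lt (by omega), smul_zero]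
    omega
  have h2 := h1 n h0
  have hw0 : w ≠ 0 := by
    rintro rfl
    exact hwk h.ker.zero_mem
  rw [h.iter, Nat.add_sub_cancel' hn.le, nsmul_eq_mul] at h2
  exact (mul_eq_zero.1 h2).resolve_right (h.deg_ne_zero_of hw0)

theorem deg_dvd {s : ℝ} {a : A} (ha : a ∈ 𝒢 s) : h.deg w ∣ h.deg a := by
  have he : 0 < h.deg w := Nat.pos_of_ne_zero fun hc => hwk (h.mem_ker_iff_deg.2 hc)
  rw [Nat.dvd_iff_mod_eq_zero]
  by_contra hc
  have ha0 : a ≠ 0 := by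
    rintro rfl
    apply hc
    rw [h.mem_ker_iff_deg.1 h.ker.zero_mem, Nat.zero_mod]
  set ρ := h.deg a % h.deg w with hρ
  set q := h.deg a / h.deg w with hq
  have h1 : q * h.deg w + ρ = h.deg a := Nat.div_add_mod' _ _
  have hlt : ρ < h.deg w := Nat.mod_lt _ he
  have h2 : D ρ (D (q * h.deg w) a) ≠ 0 := by
    rw [h.iter, add_comm, nsmul_eq_mul,
      choose_eq_one (h.choose_deg_eq_zero 𝒢 hD hw hwk hmin) q ρ hlt, one_mul, h1]
    exact h.deg_ne_zero_of ha0
  have h3 := hmin _ _ (hD _ _ (q * h.deg w) ha) fun hk => h2 (hk ρ (Nat.pos_of_ne_zero hc))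
  have h4 : h.deg (D (q * h.deg w) a) ≤ ρ := h.deg_le fun i hi => by
    rw [h.iter, h.eq_zero_of_deg_lt (by omega), smul_zero]
  omega

variable (h1 : (1 : A) ∈ 𝒢 0) (hmul : ∀ s t a b, a ∈ 𝒢 s → b ∈ 𝒢 t → a * b ∈ 𝒢 (s + t))

include h1 hmul in
/-- The slice lemma: up to a power of a constant, a homogeneous element is a polynomial in a
local slice `w`, with homogeneous constant coefficients. -/
theorem slice {s : ℝ} {a : A} (ha : a ∈ 𝒢 s) : ∃ (N M : ℕ) (α : ℕ → A),
    (∀ i, α i ∈ h.ker ∧ α i ∈ 𝒢 (s + N * (t - h.deg w * ω₀) - i * t)) ∧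
    (D (h.deg w) w) ^ N * a = ∑ i ∈ Finset.range M, α i * w ^ i := by
  have hpow : ∀ (b : A) (u : ℝ) (n : ℕ), b ∈ 𝒢 u → b ^ n ∈ 𝒢 (n * u) := by
    intro b u n hb
    induction n with
    | zero => simpa using h1
    | succ n ih =>
      have := hmul _ _ _ _ ih hb
      rw [pow_succ]
      convert this using 2
      push_cast
      ring
  have he : 0 < h.deg w := Nat.pos_of_ne_zero fun hc => hwk (h.mem_ker_iff_deg.2 hc)
  induction hd : h.deg a using Nat.strong_induction_on generalizing s a with
  | _ d ih =>
    rcases Nat.eq_zero_or_pos d with h0 | h0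
    · refine ⟨0, 1, fun i => if i = 0 then a else 0, fun i => ?_, by simp⟩
      dsimp only
      split_ifs with hi
      · exact ⟨h.mem_ker_iff_deg.2 (hd.trans h0), by simpa [hi] using ha⟩
      · exact ⟨h.ker.zero_mem, Submodule.zero_mem _⟩
    · obtain ⟨q, hq⟩ := h.deg_dvd 𝒢 hD hw hwk hmin ha
      set c := D (h.deg w) w with hc
      have hck : c ∈ h.ker := h.top_mem_ker le_rfl
      have hcG : c ∈ 𝒢 (t - h.deg w * ω₀) := hD _ _ _ hw
      have htk : D d a ∈ h.ker := h.top_mem_ker hd.le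
      set b := c ^ q * a - D d a * w ^ q with hb
      have hbdeg : h.deg b < d := by
        have h2 : (h.polyHom (w ^ q)).natDegree ≤ q * h.deg w := by
          rw [map_pow]
          exact Polynomial.natDegree_pow_le
        have hle : h.deg b ≤ d := by
          refine h.deg_le fun n hn => ?_
          rw [hb, map_sub, h.map_mul_left (pow_mem hck q), h.map_mul_left htk,
            h.eq_zero_of_deg_lt (by omega), ← h.coeff_polyHom (w ^ q),
            Polynomial.coeff_eq_zero_of_natDegree_lt, mul_zero, mul_zero, sub_zero]
          rw [mul_comm, ← hq, hd] at h2
          omega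
        refine lt_of_le_of_ne hle fun heq => ?_
        have hz : D d b = 0 := by
          rw [hb, map_sub, h.map_mul_left (pow_mem hck q), h.map_mul_left htk,
            ← h.coeff_polyHom (w ^ q), map_pow, ← hd, hq, mul_comm (h.deg w) q,
            Polynomial.coeff_pow_of_natDegree_le (le_refl (h.deg w)), h.coeff_polyHom, ← hc,
            mul_comm, sub_self]
        have hb0 : b = 0 := by
          by_contra hne
          exact h.deg_ne_zero_of hne (heq ▸ hz)
        rw [hb0, h.mem_ker_iff_deg.1 h.ker.zero_mem] at heq
        omega
      have hbG : b ∈ 𝒢 (s + q * (t - h.deg w * ω₀)) := by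
        refine Submodule.sub_mem _ ?_ ?_
        · rw [add_comm]
          exact hmul _ _ _ _ (hpow _ _ _ hcG) ha
        · have := hmul _ _ _ _ (hD _ _ d ha) (hpow _ _ q hw)
          convert this using 2
          rw [← hd, hq]
          push_cast
          ring
      obtain ⟨N, M, β, hβ, hsum⟩ := ih _ hbdeg hbG rfl
      refine ⟨N + q, max M (q + 1), fun i => (if i < M then β i else 0) +
        (if i = q then c ^ N * D d a else 0), fun i => ⟨?_, ?_⟩, ?_⟩
      · refine add_mem ?_ ?_
        · split_ifs
          exacts [(hβ i).1, zero_mem _]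
        · split_ifs
          exacts [mul_mem (pow_mem hck N) htk, zero_mem _]
      · refine add_mem ?_ ?_
        · split_ifs
          · convert (hβ i).2 using 2
            push_cast
            ring
          · exact zero_mem _
        · split_ifs with hi
          · have := hmul _ _ _ _ (hpow _ _ N hcG) (hD _ _ d ha)
            convert this using 2
            rw [← hd, hq, hi]
            push_cast
            ring
          · exact zero_mem _
      · have e1 : c ^ (N + q) * a = c ^ N * b + c ^ N * D d a * w ^ q := by
          rw [hb]
          ring
        rw [e1, hsum]
        simp only [add_mul, Finset.sum_add_distrib, ite_mul, zero_mul]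
        congr 1
        · rw [← Finset.sum_filter]
          refine Finset.sum_congr ?_ fun _ _ => rfl
          ext i
          simp only [Finset.mem_filter, Finset.mem_range]
          omega
        · rw [Finset.sum_ite_eq', if_pos]
          simp
end Slice

/-- The slice lemma without gradings. -/
theorem slice_trivial {k A : Type*} [Field k] [CommRing A] [IsDomain A] [Algebra k A]
    {D : ℕ → A →ₗ[k] A} (h : IsHD k D) {w : A} (hwk : w ∉ h.ker)
    (hmin : ∀ a, a ∉ h.ker → h.deg w ≤ h.deg a) (a : A) : ∃ (N M : ℕ) (α : ℕ → A),
    (∀ i, α i ∈ h.ker) ∧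
    (D (h.deg w) w) ^ N * a = ∑ i ∈ Finset.range M, α i * w ^ i := by
  obtain ⟨N, M, α, h1, h2⟩ := h.slice (fun _ => ⊤) (ω₀ := 0) (t := 0) (w := w) (a := a) (s := 0)
    (fun _ _ _ _ => trivial) trivial hwk (fun _ a _ ha => hmin a ha) trivial
    (fun _ _ _ _ _ _ => trivial) trivial
  exact ⟨N, M, α, fun i => (h1 i).1, h2⟩

end IsHD
end ExpLines

namespace ExpLines

/-- The family of projections of an `ℝ`-grading of a `k`-algebra. -/
structure IsGrad (k : Type*) {A : Type*} [Field k] [CommRing A] [Algebra k A]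
    (π : ℝ → A →ₗ[k] A) : Prop where
  idem : ∀ s a, π s (π s a) = π s a
  orth : ∀ s t a, s ≠ t → π s (π t a) = 0
  fin : ∀ a, {s | π s a ≠ 0}.Finite
  sum : ∀ a, ∑ᶠ s, π s a = a
  one : π 0 1 = 1
  mul : ∀ s t a b, π s a = a → π t b = b → π (s + t) (a * b) = a * b

namespace IsGrad

variable {k A : Type*} [Field k] [CommRing A] [Algebra k A] {π : ℝ → A →ₗ[k] A}

theorem eq_sum (h : IsGrad k π) (a : A) : a = ∑ s ∈ (h.fin a).toFinset, π s a := by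
  conv_lhs => rw [← h.sum a]
  exact finsum_eq_sum_of_support_subset _ (by intro s hs; simpa using hs)

theorem induction (h : IsGrad k π) {p : A → Prop} (h0 : p 0) (hadd : ∀ a b, p a → p b → p (a + b))
    (hhom : ∀ s a, π s a = a → p a) (a : A) : p a := by
  rw [h.eq_sum a]
  exact Finset.sum_induction _ p hadd h0 fun s _ => hhom s _ (h.idem s a)

theorem proj_of_ne (h : IsGrad k π) {s t : ℝ} {a : A} (ha : π s a = a) (hst : t ≠ s) :
    π t a = 0 := by
  rw [← ha, h.orth t s a hst]

/-- The elements all of whose components have degree at most `t`. -/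
def le (π : ℝ → A →ₗ[k] A) (t : ℝ) : Submodule k A where
  carrier := {a | ∀ s, t < s → π s a = 0}
  add_mem' ha hb s hs := by rw [map_add, ha s hs, hb s hs, add_zero]
  zero_mem' s _ := map_zero _
  smul_mem' c a ha s hs := by rw [map_smul, ha s hs, smul_zero]

/-- The elements all of whose components have degree less than `t`. -/
def lt (π : ℝ → A →ₗ[k] A) (t : ℝ) : Submodule k A where
  carrier := {a | ∀ s, t ≤ s → π s a = 0}
  add_mem' ha hb s hs := by rw [map_add, ha s hs, hb s hs, add_zero]
  zero_mem' s _ := map_zero _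
  smul_mem' c a ha s hs := by rw [map_smul, ha s hs, smul_zero]

theorem le_mono {s t : ℝ} (hst : s ≤ t) : le π s ≤ le π t :=
  fun _ ha u hu => ha u (hst.trans_lt hu)

theorem le_le_lt {s t : ℝ} (hst : s < t) : le π s ≤ lt π t :=
  fun _ ha u hu => ha u (hst.trans_le hu)

theorem mem_le_of_hom (h : IsGrad k π) {s : ℝ} {a : A} (ha : π s a = a) : a ∈ le π s :=
  fun _ hu => h.proj_of_ne ha hu.ne'

theorem sub_mem_lt (h : IsGrad k π) {t : ℝ} {a : A} (ha : a ∈ le π t) : a - π t a ∈ lt π t := by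
  intro s hs
  rw [map_sub]
  rcases hs.eq_or_lt with rfl | hs
  · rw [h.idem, sub_self]
  · rw [ha s hs, h.orth s t a hs.ne', sub_self]

theorem mul_proj_eq_zero (h : IsGrad k π) {u : ℝ} {a b : A}
    (hab : ∀ s t, π s a ≠ 0 → π t b ≠ 0 → u ≠ s + t) : π u (a * b) = 0 := by
  rw [h.eq_sum a, h.eq_sum b, Finset.sum_mul_sum, map_sum]
  refine Finset.sum_eq_zero fun s hs => ?_
  rw [map_sum]
  refine Finset.sum_eq_zero fun t ht => ?_
  refine h.proj_of_ne (h.mul s t _ _ (h.idem s a) (h.idem t b)) (hab s t ?_ ?_)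
  · simpa using hs
  · simpa using ht

theorem mul_mem_le (h : IsGrad k π) {p q : ℝ} {a b : A} (ha : a ∈ le π p) (hb : b ∈ le π q) :
    a * b ∈ le π (p + q) := by
  intro u hu
  refine h.mul_proj_eq_zero fun s t hs ht => ?_
  have h1 := not_lt.1 fun hc => hs (ha s hc)
  have h2 := not_lt.1 fun hc => ht (hb t hc)
  linarith

theorem mul_mem_lt (h : IsGrad k π) {p q : ℝ} {a b : A} (ha : a ∈ le π p) (hb : b ∈ lt π q) :
    a * b ∈ lt π (p + q) := by
  intro u hu
  refine h.mul_proj_eq_zero fun s t hs ht => ?_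
  have h1 := not_lt.1 fun hc => hs (ha s hc)
  have h2 := not_le.1 fun hc => ht (hb t hc)
  linarith

theorem proj_mul (h : IsGrad k π) {p q : ℝ} {a b : A} (ha : a ∈ le π p) (hb : b ∈ le π q) :
    π (p + q) (a * b) = π p a * π q b := by
  have h1 : a * b = π p a * π q b + π p a * (b - π q b) + b * (a - π p a) := by ring
  rw [h1, map_add, map_add, h.mul p q _ _ (h.idem _ _) (h.idem _ _),
    h.mul_mem_lt (h.mem_le_of_hom (h.idem p a)) (h.sub_mem_lt hb) _ le_rfl, add_comm p q,
    h.mul_mem_lt hb (h.sub_mem_lt ha) _ le_rfl, add_zero, add_zero]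

section Homogenize

variable {D : ℕ → A →ₗ[k] A}

/-- The leading part of a filtered linear map of weight `-w`. -/
def leading (h : IsGrad k π) (D : A →ₗ[k] A) (w : ℝ) : A →ₗ[k] A where
  toFun a := ∑ᶠ s, π (s - w) (D (π s a))
  map_add' a b := by
    rw [← finsum_add_distrib]
    · simp only [map_add]
    · refine (h.fin a).subset fun s hs hc => hs ?_
      simp [hc]
    · refine (h.fin b).subset fun s hs hc => hs ?_
      simp [hc]
  map_smul' c a := by
    rw [RingHom.id_apply, smul_finsum]
    simp only [map_smul]

theorem leading_of_hom (h : IsGrad k π) (D : A →ₗ[k] A) (w : ℝ) {s : ℝ} {a : A} (ha : π s a = a) :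
    h.leading D w a = π (s - w) (D a) := by
  change ∑ᶠ s, π (s - w) (D (π s a)) = _
  rw [finsum_eq_single _ s, ha]
  intro t ht
  rw [h.proj_of_ne ha ht, map_zero, map_zero]

theorem leading_isHD (h : IsGrad k π) (hD : IsHD k D) (w : ℝ)
    (hle : ∀ s a (n : ℕ), a ∈ le π s → D n a ∈ le π (s - n * w)) :
    IsHD k (fun n => h.leading (D n) (n * w)) := by
  have hlt : ∀ s a (n : ℕ), a ∈ lt π s → D n a ∈ lt π (s - n * w) := by
    intro s a n ha
    rw [h.eq_sum a, map_sum]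
    refine Submodule.sum_mem _ fun t ht => ?_
    have ht' : t < s := by
      by_contra hc
      have : π t a ≠ 0 := by simpa using ht
      exact this (ha t (not_lt.1 hc))
    refine le_le_lt ?_ (hle t _ n (h.mem_le_of_hom (h.idem t a)))
    linarith
  refine ⟨fun a => ?_, fun n hn => ?_, fun n a b => ?_, fun a => ?_, fun i j a => ?_⟩
  · refine h.induction (p := fun a => h.leading (D 0) ((0 : ℕ) * w) a = a) (map_zero _)
      (fun a b ha hb => by rw [map_add, ha, hb]) (fun s a ha => ?_) a
    rw [h.leading_of_hom _ _ ha, hD.zero]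
    simpa using ha
  · rw [h.leading_of_hom _ _ h.one, hD.one n hn, map_zero]
  · refine h.induction (p := fun a => h.leading (D n) (n * w) (a * b) =
      ∑ p ∈ Finset.HasAntidiagonal.antidiagonal n, h.leading (D p.1) (p.1 * w) a * h.leading (D p.2) (p.2 * w) b)
      (by simp) (fun a a' ha ha' => ?_) (fun s a ha => ?_) a
    · rw [add_mul, map_add, ha, ha', ← Finset.sum_add_distrib]
      simp only [map_add, add_mul]
    · refine h.induction (p := fun b => h.leading (D n) (n * w) (a * b) =
        ∑ p ∈ Finset.HasAntidiagonal.antidiagonal n, h.leading (D p.1) (p.1 * w) a *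
          h.leading (D p.2) (p.2 * w) b)
        (by simp) (fun b b' hb hb' => ?_) (fun t b hb => ?_) b
      · rw [mul_add, map_add, hb, hb', ← Finset.sum_add_distrib]
        simp only [map_add, mul_add]
      · rw [h.leading_of_hom _ _ (h.mul s t a b ha hb), hD.leib, map_sum]
        refine Finset.sum_congr rfl fun p hp => ?_
        rw [Finset.HasAntidiagonal.mem_antidiagonal] at hp
        rw [h.leading_of_hom _ _ ha, h.leading_of_hom _ _ hb,
          ← h.proj_mul (hle s a p.1 (h.mem_le_of_hom ha)) (hle t b p.2 (h.mem_le_of_hom hb)), ← hp]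
        congr 2
        push_cast
        ring
  · refine h.induction (p := fun a => ∃ N, ∀ n, N < n → h.leading (D n) (n * w) a = 0)
      ⟨0, fun n _ => map_zero _⟩ ?_ ?_ a
    · rintro a b ⟨N, hN⟩ ⟨M, hM⟩
      refine ⟨max N M, fun n hn => ?_⟩
      rw [map_add, hN n (by omega), hM n (by omega), add_zero]
    · intro s a ha
      obtain ⟨N, hN⟩ := hD.fin a
      exact ⟨N, fun n hn => by rw [h.leading_of_hom _ _ ha, hN n hn, map_zero]⟩
  · refine h.induction (p := fun a => h.leading (D i) (i * w) (h.leading (D j) (j * w) a) =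
      (i + j).choose i • h.leading (D (i + j)) ((i + j : ℕ) * w) a) (by simp) ?_ ?_ a
    · intro a b ha hb
      rw [map_add, map_add, ha, hb, map_add, smul_add]
    · intro s a ha
      rw [h.leading_of_hom _ _ ha, h.leading_of_hom _ _ ha, h.leading_of_hom _ _ (h.idem _ _),
        ← map_nsmul, ← hD.iter]
      have h1 := h.sub_mem_lt (hle s a j (h.mem_le_of_hom ha))
      have h2 := hlt _ _ i h1
      have h3 := h2 _ le_rfl
      rw [map_sub, map_sub, sub_eq_zero] at h3
      rw [← h3]
      congr 2
      push_cast
      ring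

/-- Homogenization of a nontrivial higher derivation with respect to a grading of a finitely
generated algebra. -/
theorem homogenize (h : IsGrad k π) (hD : IsHD k D) (hnt : hD.ker ≠ ⊤) (S : Finset A) (δ : A → ℝ)
    (hS : Algebra.adjoin k (S : Set A) = ⊤) (hδ : ∀ g ∈ S, π (δ g) g = g) :
    ∃ (w : ℝ) (D' : ℕ → A →ₗ[k] A) (hD' : IsHD k D'), hD'.ker ≠ ⊤ ∧
      (∀ s a (n : ℕ), π s a = a → π (s - n * w) (D' n a) = D' n a) ∧
      (∀ a M, a ∈ hD.ker → a ∈ le π M → π M a ∈ hD'.ker) := by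
  obtain ⟨w, hw1, g, hg, n, hn, hw2⟩ : ∃ w : ℝ, (∀ g ∈ S, ∀ (n : ℕ) e, π e (D n g) ≠ 0 →
      e ≤ δ g - n * w) ∧ ∃ g ∈ S, ∃ n : ℕ, 1 ≤ n ∧ π (δ g - n * w) (D n g) ≠ 0 := by
    let I : Finset (Σ _ : A, Σ _ : ℕ, ℝ) := S.sigma fun g =>
      ((hD.supp g).filter (fun n => 1 ≤ n)).sigma fun n => (h.fin (D n g)).toFinset
    have hI : ∀ x : Σ _ : A, Σ _ : ℕ, ℝ, x ∈ I ↔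
        x.1 ∈ S ∧ 1 ≤ x.2.1 ∧ π x.2.2 (D x.2.1 x.1) ≠ 0 := by
      intro x
      simp only [I, Finset.mem_sigma, Finset.mem_filter, hD.mem_supp, Set.Finite.mem_toFinset,
        Set.mem_ofPred_eq]
      constructor
      · tauto
      · rintro ⟨h1, h2, h3⟩
        refine ⟨h1, ⟨fun hc => h3 ?_, h2⟩, h3⟩
        rw [hc, map_zero]
    have hne : I.Nonempty := by
      by_contra hc
      rw [Finset.not_nonempty_iff_eq_empty] at hc
      apply hnt
      rw [eq_top_iff, ← hS, Algebra.adjoin_le_iff]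
      intro g hg n hn
      rw [h.eq_sum (D n g)]
      refine Finset.sum_eq_zero fun e _ => ?_
      by_contra hne
      have := (hI ⟨g, n, e⟩).2 ⟨hg, hn, hne⟩
      rw [hc] at this
      simp at this
    obtain ⟨x, hx, hmin⟩ := Finset.exists_min_image I (fun x => (δ x.1 - x.2.2) / x.2.1) hne
    rw [hI] at hx
    refine ⟨(δ x.1 - x.2.2) / x.2.1, fun g hg n e he => ?_, x.1, hx.1, x.2.1, hx.2.1, ?_⟩
    · rcases Nat.eq_zero_or_pos n with rfl | hn
      · rw [hD.zero] at he
        have : e = δ g := by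
          by_contra hc
          exact he (h.proj_of_ne (hδ g hg) hc)
        simp [this]
      · have := hmin ⟨g, n, e⟩ ((hI _).2 ⟨hg, hn, he⟩)
        dsimp only at this
        have hn' : (0 : ℝ) < n := by exact_mod_cast hn
        rw [le_div_iff₀ hn'] at this
        linarith
    · have hn' : (x.2.1 : ℝ) ≠ 0 := by
        have := hx.2.1
        positivity
      rw [mul_div_cancel₀ _ hn', sub_sub_cancel]
      exact hx.2.2
  have hgood : ∀ a s (n : ℕ), D n (π s a) ∈ le π (s - n * w) := by
    intro a
    have ha : a ∈ Algebra.adjoin k (S : Set A) := hS ▸ Algebra.mem_top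
    induction ha using Algebra.adjoin_induction with
    | mem g hg =>
      intro s n
      by_cases hs : s = δ g
      · rw [hs, hδ g hg]
        intro e he
        by_contra hc
        exact absurd (hw1 g hg n e hc) (not_le.2 he)
      · rw [h.proj_of_ne (hδ g hg) hs, map_zero]
        exact zero_mem _
    | algebraMap c =>
      intro s n
      rw [Algebra.algebraMap_eq_smul_one, map_smul, map_smul]
      refine Submodule.smul_mem _ _ ?_
      by_cases hs : s = 0
      · rw [hs, h.one]
        rcases Nat.eq_zero_or_pos n with rfl | hn
        · rw [hD.zero]
          exact h.mem_le_of_hom (by simpa using h.one)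
        · rw [hD.one n hn]
          exact zero_mem _
      · rw [h.proj_of_ne h.one hs, map_zero]
        exact zero_mem _
    | add a b _ _ ha hb =>
      intro s n
      rw [map_add, map_add]
      exact add_mem (ha s n) (hb s n)
    | mul a b _ _ ha hb =>
      intro s n
      rw [h.eq_sum a, h.eq_sum b, Finset.sum_mul_sum, map_sum, map_sum]
      refine Submodule.sum_mem _ fun p _ => ?_
      rw [map_sum, map_sum]
      refine Submodule.sum_mem _ fun q _ => ?_
      have h1 := h.mul p q _ _ (h.idem p a) (h.idem q b)
      by_cases hs : s = p + q
      · rw [hs, h1, hD.leib]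
        refine Submodule.sum_mem _ fun i hi => ?_
        rw [Finset.HasAntidiagonal.mem_antidiagonal] at hi
        have := h.mul_mem_le (ha p i.1) (hb q i.2)
        convert this using 2
        rw [← hi]
        push_cast
        ring
      · rw [h.proj_of_ne h1 hs, map_zero]
        exact zero_mem _
  have hle : ∀ s a (n : ℕ), a ∈ le π s → D n a ∈ le π (s - n * w) := by
    intro s a n ha
    rw [h.eq_sum a, map_sum]
    refine Submodule.sum_mem _ fun t ht => ?_
    have ht' : t ≤ s := by
      by_contra hc
      have : π t a ≠ 0 := by simpa using ht
      exact this (ha t (not_le.1 hc))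
    refine le_mono ?_ (hgood a t n)
    linarith
  refine ⟨w, _, h.leading_isHD hD w hle, ?_, ?_, ?_⟩
  · rw [IsHD.ne_bot_iff]
    refine ⟨n, g, hn, ?_⟩
    rw [h.leading_of_hom _ _ (hδ g hg)]
    exact hw2
  · intro s a n ha
    rw [h.leading_of_hom _ _ ha, h.idem]
  · intro a M ha haM n hn
    rw [h.leading_of_hom _ _ (h.idem M a)]
    have h1 : D n (a - π M a) ∈ lt π (M - n * w) := by
      have h1 := h.sub_mem_lt haM
      rw [h.eq_sum (a - π M a), map_sum]
      refine Submodule.sum_mem _ fun t ht => ?_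
      have ht' : t < M := by
        by_contra hc
        have : π t (a - π M a) ≠ 0 := by simpa using ht
        exact this (h1 t (not_lt.1 hc))
      refine le_le_lt ?_ (hgood _ t n)
      linarith
    have h2 := h1 _ le_rfl
    rw [map_sub, ha n hn, zero_sub, map_neg, neg_eq_zero] at h2
    exact h2

end Homogenize

end IsGrad
end ExpLines

namespace ExpLines

/-- `τ` presents `k[W]` as the quotient of `k[Z,T]` by `f`. -/
structure IsLineMap {k : Type} [Field k] (f : MvPolynomial (Fin 2) k)
    (τ : MvPolynomial (Fin 2) k →ₐ[k] Polynomial k) : Prop where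
  surj : Function.Surjective τ
  eq_zero_iff : ∀ p, τ p = 0 ↔ f ∣ p

theorem exists_isLineMap {k : Type} [Field k] {f : MvPolynomial (Fin 2) k}
    (h : Nonempty ((MvPolynomial (Fin 2) k ⧸ Ideal.span {f}) ≃ₐ[k] Polynomial k)) :
    ∃ τ, IsLineMap f τ := by
  obtain ⟨e⟩ := h
  refine ⟨(e : _ →ₐ[k] Polynomial k).comp (Ideal.Quotient.mkₐ k (Ideal.span {f})), ?_, fun p => ?_⟩
  · exact e.surjective.comp (Ideal.Quotient.mkₐ_surjective k _)
  · rw [← Ideal.mem_span_singleton]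
    simp [Ideal.Quotient.eq_zero_iff_mem]

namespace IsLineMap

variable {k : Type} [Field k] {f : MvPolynomial (Fin 2) k}
  {τ : MvPolynomial (Fin 2) k →ₐ[k] Polynomial k}

theorem map_self (h : IsLineMap f τ) : τ f = 0 := (h.eq_zero_iff f).2 dvd_rfl

theorem ne_zero (h : IsLineMap f τ) : f ≠ 0 := by
  intro hf
  have hinj : Function.Injective τ := by
    rw [injective_iff_map_eq_zero]
    intro p hp
    rwa [h.eq_zero_iff, hf, zero_dvd_iff] at hp
  have := (AlgEquiv.ofBijective τ ⟨hinj, h.surj⟩).trdeg_eq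
  rw [MvPolynomial.trdeg_of_isDomain, Polynomial.trdeg_of_isDomain] at this
  simp at this

theorem prime (h : IsLineMap f τ) : Prime f := by
  refine ⟨h.ne_zero, fun hu => ?_, fun a b hab => ?_⟩
  · have := (h.eq_zero_iff 1).2 (hu.dvd)
    rw [map_one] at this
    exact one_ne_zero this
  · rw [← h.eq_zero_iff, map_mul, mul_eq_zero] at hab
    rwa [← h.eq_zero_iff, ← h.eq_zero_iff]

/-- A factorially closed subalgebra of `k[Z,T]` which does not contain the line `f`, and together
with `f` generates `k[Z,T]` up to denominators, contains a coordinate complementary to `f`. -/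
theorem exists_generator_of_factorial (h : IsLineMap f τ)
    (S : Subalgebra k (MvPolynomial (Fin 2) k))
    (hfac : ∀ a b, a * b ∈ S → a * b ≠ 0 → a ∈ S) (hfS : f ∉ S)
    (hex : ∀ b, ∃ s ∈ S, s ≠ 0 ∧ ∃ (M : ℕ) (σ : ℕ → MvPolynomial (Fin 2) k), (∀ i, σ i ∈ S) ∧
      s * b = ∑ i ∈ Finset.range M, σ i * f ^ i) :
    ∃ q, Algebra.adjoin k {f, q} = ⊤ := by
  have hinj : ∀ s ∈ S, τ s = 0 → s = 0 := by
    intro s hs h0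
    by_contra hne
    obtain ⟨c, rfl⟩ := (h.eq_zero_iff s).1 h0
    exact hfS (hfac _ _ hs hne)
  obtain ⟨s, s₀, hs, hs₀, hs1, hs2⟩ : ∃ s s₀, s ∈ S ∧ s₀ ∈ S ∧ s ≠ 0 ∧
      τ s₀ = τ s * Polynomial.X := by
    obtain ⟨b, hb⟩ := h.surj Polynomial.X
    obtain ⟨s, hs, hs0, M, σ, hσ, hsum⟩ := hex b
    have h1 := congrArg τ hsum
    rw [map_mul, hb, map_sum] at h1
    cases M with
    | zero =>
      rw [Finset.sum_range_zero] at h1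
      exact absurd (hinj s hs ((mul_eq_zero.1 h1).resolve_right Polynomial.X_ne_zero)) hs0
    | succ M =>
      refine ⟨s, σ 0, hs, hσ 0, hs0, ?_⟩
      rw [h1, Finset.sum_range_succ', Finset.sum_eq_zero]
      · simp
      · intro i _
        simp [h.map_self]
  have hτs : τ s ≠ 0 := fun hc => hs1 (hinj s hs hc)
  set p := τ s₀ with hp
  have hp0 : p ≠ 0 := by
    rw [hs2]
    exact mul_ne_zero hτs Polynomial.X_ne_zero
  have hs₀0 : s₀ ≠ 0 := by
    rintro rfl
    exact hp0 (map_zero τ)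
  have hdeg : 0 < p.natDegree := by
    rw [hs2, Polynomial.natDegree_mul_X hτs]
    omega
  obtain ⟨N, hN⟩ : ∃ N, p.natDegree = N := ⟨_, rfl⟩
  have hpsum : p = ∑ i ∈ Finset.range (N + 1), Polynomial.C (p.coeff i) * Polynomial.X ^ i := by
    rw [← hN]
    exact p.as_sum_range_C_mul_X_pow
  have hid : ∑ i ∈ Finset.range (N + 1),
      C (p.coeff i) * (s₀ ^ i * s ^ (N - i)) = s₀ * s ^ N := by
    rw [← sub_eq_zero]
    refine hinj _ (sub_mem (sum_mem fun i _ => mul_mem (S.algebraMap_mem _)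
      (mul_mem (pow_mem hs₀ _) (pow_mem hs _))) (mul_mem hs₀ (pow_mem hs _))) ?_
    rw [map_sub, sub_eq_zero, map_sum, map_mul, map_pow, ← hp]
    conv_rhs => rw [hpsum, Finset.sum_mul]
    refine Finset.sum_congr rfl fun i hi => ?_
    have hi' : i ≤ N := Nat.lt_succ_iff.1 (Finset.mem_range.1 hi)
    have hC : τ (C (p.coeff i)) = Polynomial.C (p.coeff i) := τ.commutes _
    obtain ⟨j, rfl⟩ := Nat.exists_eq_add_of_le hi'
    rw [map_mul, map_mul, map_pow, map_pow, hC, ← hp, Nat.add_sub_cancel_left]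
    generalize p.coeff i = c
    rw [hs2, mul_pow]
    ring
  have hdvd : ∀ (K : Type) [Field K] [Algebra (MvPolynomial (Fin 2) k) K]
      [IsFractionRing (MvPolynomial (Fin 2) k) K], s ∣ s₀ := by
    intro K _ _ _
    let ι := algebraMap (MvPolynomial (Fin 2) k) K
    have hιs : ι s ≠ 0 := by simpa [ι] using hs1
    have hsint : IsIntegral (MvPolynomial (Fin 2) k) (ι s₀ / ι s) := by
      have hlc : p.leadingCoeff ≠ 0 := Polynomial.leadingCoeff_ne_zero.2 hp0
      have hmon : (Polynomial.C p.leadingCoeff⁻¹ * p).Monic := by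
        rw [mul_comm]
        exact Polynomial.monic_mul_leadingCoeff_inv hp0
      have hmon2 : ((Polynomial.C p.leadingCoeff⁻¹ * p).map
          (algebraMap k (MvPolynomial (Fin 2) k)) - Polynomial.C (C p.leadingCoeff⁻¹ * s₀)).Monic := by
        refine (hmon.map _).sub_of_left (lt_of_le_of_lt Polynomial.degree_C_le ?_)
        rw [Polynomial.degree_map, Polynomial.degree_C_mul (inv_ne_zero hlc)]
        exact Polynomial.natDegree_pos_iff_degree_pos.1 hdeg
      refine ⟨_, hmon2, ?_⟩
      have h3 : Polynomial.eval₂ (ι.comp (algebraMap k (MvPolynomial (Fin 2) k)))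
          (ι s₀ / ι s) p = ι s₀ := by
        rw [Polynomial.eval₂_eq_sum_range, hN]
        have h4 := congrArg ι hid
        rw [map_sum, map_mul, map_pow] at h4
        have h5 : ι s ^ N ≠ 0 := pow_ne_zero _ hιs
        rw [← mul_left_inj' h5, ← h4, Finset.sum_mul]
        refine Finset.sum_congr rfl fun i hi => ?_
        have hi' : i ≤ N := Nat.lt_succ_iff.1 (Finset.mem_range.1 hi)
        obtain ⟨j, hj⟩ := Nat.exists_eq_add_of_le hi'
        rw [map_mul, map_mul, map_pow, map_pow, hj, Nat.add_sub_cancel_left, div_pow, pow_add,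
          RingHom.comp_apply]
        have hCa : ι (C (p.coeff i)) = ι (algebraMap k _ (p.coeff i)) := rfl
        rw [hCa]
        field_simp
      change Polynomial.eval₂ ι _ _ = 0
      rw [Polynomial.eval₂_sub, Polynomial.eval₂_map, Polynomial.eval₂_C, Polynomial.eval₂_mul, h3,
        Polynomial.eval₂_C, map_mul, sub_eq_zero]
      rfl
    obtain ⟨y, hy⟩ := IsIntegrallyClosed.isIntegral_iff.1 hsint
    refine ⟨y, IsFractionRing.injective (MvPolynomial (Fin 2) k) K ?_⟩
    rw [map_mul, hy]
    exact (mul_div_cancel₀ _ hιs).symm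
  obtain ⟨q, hq⟩ := hdvd (FractionRing (MvPolynomial (Fin 2) k))
  have hqS : q ∈ S := by
    refine hfac q s ?_ ?_
    · rwa [mul_comm, ← hq]
    · rwa [mul_comm, ← hq]
  have hτq : τ q = Polynomial.X := by
    rw [← mul_right_inj' hτs, ← map_mul, ← hq, ← hp, hs2]
  have hlift : ∀ b, ∃ b₁, b = Polynomial.aeval q (τ b) + f * b₁ := by
    intro b
    have h1 : f ∣ b - Polynomial.aeval q (τ b) := by
      rw [← h.eq_zero_iff, map_sub, ← Polynomial.aeval_algHom_apply, hτq,
        Polynomial.aeval_X_left_apply, sub_self]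
    obtain ⟨b₁, hb₁⟩ := h1
    exact ⟨b₁, by rw [← hb₁]; ring⟩
  have haq : ∀ p : Polynomial k, Polynomial.aeval q p ∈ S := fun p => by
    have := (Polynomial.aeval (⟨q, hqS⟩ : S) p).2
    rwa [← Subalgebra.coe_val, ← Polynomial.aeval_algHom_apply] at this
  have haq' : ∀ p : Polynomial k, Polynomial.aeval q p ∈ Algebra.adjoin k {f, q} := fun p => by
    have h1 : Algebra.adjoin k {q} ≤ Algebra.adjoin k {f, q} := Algebra.adjoin_mono (by simp)
    exact h1 (Polynomial.aeval_mem_adjoin_singleton k q)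
  have key : ∀ (M : ℕ) (b s : MvPolynomial (Fin 2) k) (σ : ℕ → MvPolynomial (Fin 2) k), s ∈ S →
      s ≠ 0 → (∀ i, σ i ∈ S) → s * b = ∑ i ∈ Finset.range M, σ i * f ^ i →
      b ∈ Algebra.adjoin k {f, q} := by
    intro M
    induction M with
    | zero =>
      intro b s σ _ hs0 _ hb
      rw [Finset.sum_range_zero] at hb
      rw [(mul_eq_zero.1 hb).resolve_left hs0]
      exact zero_mem _
    | succ M ih =>
      intro b s σ hs hs0 hσ hb
      obtain ⟨b₁, hb₁⟩ := hlift b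
      rw [hb₁]
      refine add_mem (haq' _) (mul_mem (Algebra.subset_adjoin (by simp)) ?_)
      refine ih b₁ s (fun i => σ (i + 1)) hs hs0 (fun i => hσ _) ?_
      rw [Finset.sum_range_succ', hb₁] at hb
      have h1 : σ 0 - s * Polynomial.aeval q (τ b) =
          f * (s * b₁ - ∑ i ∈ Finset.range M, σ (i + 1) * f ^ i) := by
        have h2 : ∑ i ∈ Finset.range M, σ (i + 1) * f ^ (i + 1) =
            f * ∑ i ∈ Finset.range M, σ (i + 1) * f ^ i := by
          rw [Finset.mul_sum]
          exact Finset.sum_congr rfl fun i _ => by ring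
        rw [h2] at hb
        linear_combination -hb
      have h3 := hinj _ (sub_mem (hσ 0) (mul_mem hs (haq (τ b))))
        ((h.eq_zero_iff _).2 ⟨_, h1⟩)
      rw [h3] at h1
      exact sub_eq_zero.1 ((mul_eq_zero.1 h1.symm).resolve_left h.ne_zero)
  refine ⟨q, Algebra.eq_top_iff.2 fun b => ?_⟩
  obtain ⟨s, hs, hs0, M, σ, hσ, hsum⟩ := hex b
  exact key M b s σ hs hs0 hσ hsum

end IsLineMap
end ExpLines

namespace ExpLines

namespace IsLineMap

variable {k : Type} [Field k] {f : MvPolynomial (Fin 2) k}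
  {τ : MvPolynomial (Fin 2) k →ₐ[k] Polynomial k}

theorem aeval_injective (h : IsLineMap f τ) {p : Polynomial k}
    (hp : Polynomial.aeval f p = 0) : p = 0 := by
  induction hn : p.natDegree using Nat.strong_induction_on generalizing p with
  | _ n ih =>
    have h0 : p.coeff 0 = 0 := by
      have h1 := congrArg τ hp
      rw [← Polynomial.aeval_algHom_apply, h.map_self, map_zero,
        Polynomial.aeval_def, Polynomial.eval₂_at_zero] at h1
      simpa using h1
    have h1 : p = Polynomial.X * p.divX := by
      conv_lhs => rw [← Polynomial.X_mul_divX_add p, h0, map_zero, add_zero]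
    rcases Nat.eq_zero_or_pos n with rfl | hpos
    · rw [Polynomial.eq_C_of_natDegree_eq_zero hn, h0, map_zero]
    · rw [h1, map_mul, Polynomial.aeval_X] at hp
      have h2 := ih p.divX.natDegree (by rw [Polynomial.natDegree_divX_eq_natDegree_tsub_one]; omega)
        ((mul_eq_zero.1 hp).resolve_left h.ne_zero) rfl
      rw [h1, h2, mul_zero]

theorem totalDegree_pos (h : IsLineMap f τ) : 0 < f.totalDegree := by
  rw [Nat.pos_iff_ne_zero]
  intro hc
  rw [MvPolynomial.totalDegree_eq_zero_iff_eq_C] at hc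
  have h1 := h.map_self
  have h2 : f.coeff 0 ≠ 0 := fun h0 => h.ne_zero (by rw [hc, h0, C_0])
  rw [hc] at h1
  have h3 : τ (C (f.coeff 0)) = Polynomial.C (f.coeff 0) := τ.commutes _
  rw [h3, Polynomial.C_eq_zero] at h1
  exact h2 h1

section Ker

variable {D : ℕ → MvPolynomial (Fin 2) k →ₗ[k] MvPolynomial (Fin 2) k} (hD : IsHD k D)

/-- If `s` and the line `f` are algebraically dependent, then `s` is constant modulo `f`. -/
theorem exists_eq_C_of_dependent (h : IsLineMap f τ) {s : MvPolynomial (Fin 2) k}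
    (hs : ¬ AlgebraicIndependent k ![f, s]) : ∃ c, τ s = Polynomial.C c := by
  have key : ∀ (n : ℕ) (G : Polynomial (MvPolynomial (Fin 1) k)), G.natDegree = n → G ≠ 0 →
      Polynomial.eval₂ (aeval fun _ : Fin 1 => s : MvPolynomial (Fin 1) k →ₐ[k] _).toRingHom f G
        = 0 → ∃ g : MvPolynomial (Fin 1) k, g ≠ 0 ∧ aeval (fun _ => τ s) g = 0 := by
    intro n
    induction n using Nat.strong_induction_on with
    | _ n ih =>
      intro G hn hG hev
      have h1 := Polynomial.X_mul_divX_add G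
      by_cases h0 : G.coeff 0 = 0
      · rw [h0, map_zero, add_zero] at h1
        rcases Nat.eq_zero_or_pos n with rfl | hpos
        · exact absurd (by rw [Polynomial.eq_C_of_natDegree_eq_zero hn, h0, map_zero]) hG
        · refine ih G.divX.natDegree (by rw [Polynomial.natDegree_divX_eq_natDegree_tsub_one]; omega)
            G.divX rfl ?_ ?_
          · intro hc
            rw [← h1, hc, mul_zero] at hG
            exact hG rfl
          · rw [← h1, Polynomial.eval₂_mul, Polynomial.eval₂_X] at hev
            exact (mul_eq_zero.1 hev).resolve_left h.ne_zero
      · refine ⟨G.coeff 0, h0, ?_⟩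
        rw [← h1, Polynomial.eval₂_add, Polynomial.eval₂_mul, Polynomial.eval₂_X,
          Polynomial.eval₂_C] at hev
        have h2 := congrArg τ hev
        rw [map_add, map_mul, h.map_self, zero_mul, zero_add, map_zero] at h2
        rw [← h2]
        exact (MvPolynomial.comp_aeval_apply _ τ _).symm
  rw [algebraicIndependent_iff] at hs
  push Not at hs
  obtain ⟨F, hF, hF0⟩ := hs
  obtain ⟨g, hg0, hg⟩ := key _ (finSuccEquiv k 1 F) rfl (by simpa using hF0) (by
    rw [← hF]
    have : ∀ F : MvPolynomial (Fin 2) k, Polynomial.eval₂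
        (aeval fun _ : Fin 1 => s : MvPolynomial (Fin 1) k →ₐ[k] _).toRingHom f
        (finSuccEquiv k 1 F) = aeval ![f, s] F := by
      intro F
      induction F using MvPolynomial.induction_on with
      | C a => simp [finSuccEquiv_apply]
      | add p q hp hq => rw [map_add, Polynomial.eval₂_add, hp, hq, map_add]
      | mul_X p i hp =>
        rw [map_mul, Polynomial.eval₂_mul, hp, map_mul]
        congr 1
        refine Fin.cases ?_ (fun j => ?_) i
        · rw [finSuccEquiv_X_zero, Polynomial.eval₂_X]
          simp
        · rw [finSuccEquiv_X_succ]
          simp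
    exact this F)
  by_contra hc
  push Not at hc
  have htr : Transcendental k (τ s) := by
    have h0 : (τ s).natDegree ≠ 0 := fun h0 => hc _ (Polynomial.eq_C_of_natDegree_eq_zero h0)
    refine Polynomial.transcendental _ h0 (mem_nonZeroDivisors_of_ne_zero ?_)
    rw [Ne, Polynomial.leadingCoeff_eq_zero]
    rintro h1
    simp [h1] at h0
  have := (algebraicIndependent_unique_type_iff (x := fun _ : Fin 1 => τ s)).2 htr
  rw [algebraicIndependent_iff] at this
  exact hg0 (this g hg)

include hD in
/-- The constants of a nontrivial higher derivation of `k[Z,T]` killing a line `f` are `k[f]`. -/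
theorem mem_ker_iff (h : IsLineMap f τ) (hnt : hD.ker ≠ ⊤) (hf : f ∈ hD.ker)
    (s : MvPolynomial (Fin 2) k) : s ∈ hD.ker ↔ ∃ p : Polynomial k, s = Polynomial.aeval f p := by
  constructor
  · intro hs
    induction hn : s.totalDegree using Nat.strong_induction_on generalizing s with
    | _ n ih =>
      have hdep : ¬ AlgebraicIndependent k ![f, s] := by
        intro hi
        apply hnt
        have hb := hi.isTranscendenceBasis_of_trdeg_le_of_finite (by
          rw [MvPolynomial.trdeg_of_isDomain]
          simp)
        have hle : Algebra.adjoin k (Set.range ![f, s]) ≤ hD.ker := by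
          rw [Algebra.adjoin_le_iff]
          rintro _ ⟨i, rfl⟩
          fin_cases i
          exacts [hf, hs]
        have halg := hb.isAlgebraic
        rw [Algebra.eq_top_iff]
        intro b
        obtain ⟨p, hp0, hp⟩ := halg.isAlgebraic b
        refine hD.mem_ker_of_aeval_eq_zero (p := p.map (algebraMap _ _)) (fun n => ?_) ?_ ?_
        · rw [Polynomial.coeff_map]
          exact hle (p.coeff n).2
        · rwa [Ne, Polynomial.map_eq_zero_iff]
          exact Subtype.val_injective
        · rw [Polynomial.eval_map_algebraMap, hp]
      obtain ⟨c, hc⟩ := h.exists_eq_C_of_dependent hdep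
      obtain ⟨b, hb⟩ : f ∣ s - C c := by
        rw [← h.eq_zero_iff, map_sub, hc, sub_eq_zero]
        exact (τ.commutes c).symm
      have hs' : s = C c + f * b := by rw [← hb]; ring
      by_cases hb0 : b = 0
      · refine ⟨Polynomial.C c, ?_⟩
        rw [hs', hb0, mul_zero, add_zero, Polynomial.aeval_C]
        rfl
      · have hbk : b ∈ hD.ker := by
          refine hD.right_mem_ker_of_mul (a := f) ?_ (mul_ne_zero h.ne_zero hb0)
          rw [← hb]
          exact sub_mem hs (hD.ker.algebraMap_mem c)
        have hdeg : b.totalDegree < n := by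
          have h1 := MvPolynomial.totalDegree_mul_of_isDomain h.ne_zero hb0
          have h2 := h.totalDegree_pos
          have h3 : (s - C c).totalDegree ≤ s.totalDegree := by
            refine (MvPolynomial.totalDegree_sub _ _).trans ?_
            simp
          rw [hb] at h3
          omega
        obtain ⟨p, hp⟩ := ih _ hdeg b hbk rfl
        refine ⟨Polynomial.C c + Polynomial.X * p, ?_⟩
        rw [hs', hp, map_add, map_mul, Polynomial.aeval_X, Polynomial.aeval_C]
        rfl
  · rintro ⟨p, rfl⟩
    have : Algebra.adjoin k {f} ≤ hD.ker := by
      rw [Algebra.adjoin_le_iff]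
      simpa using hf
    exact this (Polynomial.aeval_mem_adjoin_singleton k f)

end Ker

end IsLineMap
end ExpLines

namespace ExpLines

open TensorProduct

section Coord

variable {k K A : Type} [Field k] [Field K] [Algebra k K] [CommRing A] [Algebra k A]

/-- Extension of a functional on the scalars to the base change. -/
def coordMap (A : Type) [CommRing A] [Algebra k A] (π : K →ₗ[k] k) : K ⊗[k] A →ₗ[k] A :=
  (TensorProduct.lid k A).toLinearMap ∘ₗ π.rTensor A

@[simp]
theorem coordMap_tmul (π : K →ₗ[k] k) (c : K) (a : A) : coordMap A π (c ⊗ₜ a) = π c • a := by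
  simp [coordMap]

theorem coordMap_baseChange (π : K →ₗ[k] k) (D : A →ₗ[k] A) (x : K ⊗[k] A) :
    coordMap A π (D.baseChange K x) = D (coordMap A π x) := by
  induction x with
  | zero => simp
  | add x y hx hy => simp only [map_add, hx, hy]
  | tmul c b => simp

theorem exists_sum_of_coordMap (N : Submodule k A) (x : K ⊗[k] A)
    (hx : ∀ π : K →ₗ[k] k, coordMap A π x ∈ N) :
    ∃ (ι : Type) (s : Finset ι) (b : ι → K) (c : ι → A), (∀ i, c i ∈ N) ∧
      x = ∑ i ∈ s, b i ⊗ₜ c i := by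
  obtain ⟨c, rfl⟩ := TensorProduct.eq_repr_basis_left (Module.Free.chooseBasis k K) x
  refine ⟨_, c.support, Module.Free.chooseBasis k K, c, fun i => ?_, rfl⟩
  have := hx ((Module.Free.chooseBasis k K).coord i)
  rw [Finsupp.sum, map_sum] at this
  classical
  simp only [coordMap_tmul, Module.Basis.coord_apply, Module.Basis.repr_self,
    Finsupp.single_apply, ite_smul, one_smul, zero_smul] at this
  rw [Finset.sum_ite_eq'] at this
  split_ifs at this with h
  · exact this
  · rw [Finsupp.notMem_support_iff.1 h]
    exact N.zero_mem

/-- The coefficientwise functional on polynomials. -/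
theorem coordMap_aeval (π : K →ₗ[k] k) (f : A) (p : Polynomial K) :
    coordMap A π (Polynomial.aeval ((1 : K) ⊗ₜ[k] f) p) =
      ∑ i ∈ Finset.range (p.natDegree + 1), π (p.coeff i) • f ^ i := by
  rw [Polynomial.aeval_eq_sum_range, map_sum]
  refine Finset.sum_congr rfl fun i _ => ?_
  rw [Algebra.TensorProduct.tmul_pow, one_pow, TensorProduct.smul_tmul', smul_eq_mul, mul_one,
    coordMap_tmul]

theorem aeval_tmul_injective {f : A} (hf : ∀ p : Polynomial k, Polynomial.aeval f p = 0 → p = 0)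
    {p : Polynomial K} (hp : Polynomial.aeval ((1 : K) ⊗ₜ[k] f) p = 0) : p = 0 := by
  ext n
  rw [Polynomial.coeff_zero]
  by_contra hn
  obtain ⟨π, hπ⟩ : ∃ π : K →ₗ[k] k, π (p.coeff n) ≠ 0 := by
    by_contra! hc
    exact hn ((Module.forall_dual_apply_eq_zero_iff k _).1 hc)
  have h1 := coordMap_aeval π f p
  rw [hp, map_zero] at h1
  have h2 := hf (∑ i ∈ Finset.range (p.natDegree + 1), Polynomial.monomial i (π (p.coeff i))) (by
    rw [map_sum, h1]
    refine Finset.sum_congr rfl fun i _ => ?_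
    rw [Polynomial.aeval_monomial, Algebra.smul_def])
  have h3 := congrArg (fun q => Polynomial.coeff q n) h2
  simp only [Polynomial.finsetSum_coeff, Polynomial.coeff_monomial, Polynomial.coeff_zero] at h3
  rw [Finset.sum_ite_eq', if_pos] at h3
  · exact hπ h3
  · rw [Finset.mem_range]
    have := Polynomial.le_natDegree_of_ne_zero hn
    omega

end Coord

namespace IsHD

variable {k K A : Type} [Field k] [Field K] [Algebra k K] [CommRing A] [Algebra k A]
  {D : ℕ → A →ₗ[k] A}

theorem baseChange (h : IsHD k D) (K : Type) [Field K] [Algebra k K] :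
    IsHD K (fun n => (D n).baseChange K) where
  zero x := by
    induction x with
    | zero => simp
    | add x y hx hy => simp only [map_add, hx, hy]
    | tmul c b => simp [h.zero]
  one n hn := by
    rw [Algebra.TensorProduct.one_def]
    simp [h.one n hn]
  leib n x y := by
    induction x with
    | zero => simp
    | add x x' hx hx' => simp only [map_add, add_mul, hx, hx', Finset.sum_add_distrib]
    | tmul c b =>
      induction y with
      | zero => simp
      | add x x' hx hx' => simp only [map_add, mul_add, hx, hx', Finset.sum_add_distrib]
      | tmul c' b' =>
        simp [h.leib, TensorProduct.tmul_sum]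
  fin x := by
    induction x with
    | zero => exact ⟨0, by simp⟩
    | add x y hx hy =>
      obtain ⟨N, hN⟩ := hx
      obtain ⟨M, hM⟩ := hy
      refine ⟨max N M, fun n hn => ?_⟩
      rw [map_add, hN n (by omega), hM n (by omega), add_zero]
    | tmul c b =>
      obtain ⟨N, hN⟩ := h.fin b
      exact ⟨N, fun n hn => by simp [hN n hn]⟩
  iter i j x := by
    induction x with
    | zero => simp
    | add x y hx hy => simp only [map_add, smul_add, hx, hy]
    | tmul c b =>
      simp only [LinearMap.baseChange_tmul, h.iter]
      rw [← TensorProduct.tmul_smul]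

theorem tmul_mem_ker (h : IsHD k D) {a : A} (ha : a ∈ h.ker) (c : K) :
    c ⊗ₜ a ∈ (h.baseChange K).ker := by
  intro n hn
  simp [ha n hn]

theorem coordMap_mem_ker (h : IsHD k D) {x : K ⊗[k] A} (hx : x ∈ (h.baseChange K).ker)
    (π : K →ₗ[k] k) : coordMap A π x ∈ h.ker := by
  intro n hn
  rw [← coordMap_baseChange, hx n hn, map_zero]

end IsHD

/-- Peeling off denominators in `φ` when the fibres of `φ` are integral and `ω` is non-constant
on each of them. -/
theorem mem_adjoin_of_aeval_mul {K R : Type} [Field K] [IsAlgClosed K] [CommRing R] [IsDomain R]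
    [Algebra K R] {φ ω : R} (hprime : ∀ c, Prime (φ - algebraMap K R c))
    (hndvd : ∀ c d, ¬ φ - algebraMap K R c ∣ ω - algebraMap K R d) {s : Polynomial K} (hs : s ≠ 0)
    {b : R} (hb : Polynomial.aeval φ s * b ∈ Algebra.adjoin K {φ, ω}) :
    b ∈ Algebra.adjoin K {φ, ω} := by
  have hφ : φ ∈ Algebra.adjoin K {φ, ω} := Algebra.subset_adjoin (by simp)
  have hω : ω ∈ Algebra.adjoin K {φ, ω} := Algebra.subset_adjoin (by simp)
  have hsub : ∀ c, φ - algebraMap K R c ∈ Algebra.adjoin K {φ, ω} := fun c =>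
    sub_mem hφ (Subalgebra.algebraMap_mem _ c)
  have hdec : ∀ c, ∀ x ∈ Algebra.adjoin K {φ, ω}, ∃ (G : Polynomial K), ∃ y ∈
      Algebra.adjoin K {φ, ω}, x = Polynomial.aeval ω G + (φ - algebraMap K R c) * y := by
    intro c x hx
    induction hx using Algebra.adjoin_induction with
    | mem x hx =>
      rcases hx with rfl | rfl
      · refine ⟨Polynomial.C c, 1, one_mem _, ?_⟩
        rw [Polynomial.aeval_C]
        ring
      · exact ⟨Polynomial.X, 0, zero_mem _, by simp⟩
    | algebraMap a => exact ⟨Polynomial.C a, 0, zero_mem _, by simp⟩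
    | add x y hx hy ihx ihy =>
      obtain ⟨G, u, hu, rfl⟩ := ihx
      obtain ⟨H, v, hv, rfl⟩ := ihy
      refine ⟨G + H, u + v, add_mem hu hv, ?_⟩
      rw [map_add]
      ring
    | mul x y hx hy ihx ihy =>
      obtain ⟨G, u, hu, rfl⟩ := ihx
      obtain ⟨H, v, hv, rfl⟩ := ihy
      refine ⟨G * H, u * Polynomial.aeval ω H + Polynomial.aeval ω G * v +
        (φ - algebraMap K R c) * (u * v), ?_, ?_⟩
      · have hle : ∀ G : Polynomial K, Polynomial.aeval ω G ∈ Algebra.adjoin K {φ, ω} := fun G =>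
          Algebra.adjoin_mono (by simp) (Polynomial.aeval_mem_adjoin_singleton K ω)
        exact add_mem (add_mem (mul_mem hu (hle _)) (mul_mem (hle _) hv))
          (mul_mem (hsub c) (mul_mem hu hv))
      · rw [map_mul]
        ring
  have hG : ∀ c (G : Polynomial K), φ - algebraMap K R c ∣ Polynomial.aeval ω G → G = 0 := by
    intro c G hd
    by_contra hne
    obtain ⟨n, hn⟩ : ∃ n, G.natDegree = n := ⟨_, rfl⟩
    induction n using Nat.strong_induction_on generalizing G with
    | _ n ih =>
    by_cases hdeg : G.degree = 0
    · rw [Polynomial.eq_C_of_degree_eq_zero hdeg, Polynomial.aeval_C] at hd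
      have hc0 : G.coeff 0 ≠ 0 := Polynomial.coeff_ne_zero_of_eq_degree hdeg
      exact (hprime c).not_isUnit (isUnit_of_dvd_unit hd ((Ne.isUnit hc0).map (algebraMap K R)))
    · obtain ⟨μ, hμ⟩ := IsAlgClosed.exists_root G hdeg
      obtain ⟨H, rfl⟩ := Polynomial.dvd_iff_isRoot.2 hμ
      have hH : H ≠ 0 := right_ne_zero_of_mul hne
      rw [map_mul, map_sub, Polynomial.aeval_X, Polynomial.aeval_C] at hd
      rcases (hprime c).dvd_or_dvd hd with h1 | h1
      · exact hndvd c μ h1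
      · refine ih H.natDegree ?_ H h1 hH rfl
        rw [← hn, Polynomial.natDegree_mul (Polynomial.X_sub_C_ne_zero μ) hH,
          Polynomial.natDegree_X_sub_C]
        omega
  have hstep : ∀ c y, (φ - algebraMap K R c) * y ∈ Algebra.adjoin K {φ, ω} →
      y ∈ Algebra.adjoin K {φ, ω} := by
    intro c y hy
    obtain ⟨G, v, hv, h1⟩ := hdec c _ hy
    have : G = 0 := hG c G ⟨y - v, by rw [mul_sub, h1]; ring⟩
    rw [this, map_zero, zero_add] at h1
    rwa [mul_left_cancel₀ (hprime c).ne_zero h1]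
  obtain ⟨n, hn⟩ : ∃ n, s.natDegree = n := ⟨_, rfl⟩
  induction n using Nat.strong_induction_on generalizing s b with
  | _ n ih =>
  by_cases hdeg : s.degree = 0
  · rw [Polynomial.eq_C_of_degree_eq_zero hdeg, Polynomial.aeval_C] at hb
    have hc0 : s.coeff 0 ≠ 0 := Polynomial.coeff_ne_zero_of_eq_degree hdeg
    have := Subalgebra.smul_mem _ hb (s.coeff 0)⁻¹
    rwa [← Algebra.smul_def, smul_smul, inv_mul_cancel₀ hc0, one_smul] at this
  · obtain ⟨c, hc⟩ := IsAlgClosed.exists_root s hdeg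
    obtain ⟨t, rfl⟩ := Polynomial.dvd_iff_isRoot.2 hc
    have ht : t ≠ 0 := right_ne_zero_of_mul hs
    refine ih t.natDegree ?_ ht (hstep c _ ?_) rfl
    · rw [← hn, Polynomial.natDegree_mul (Polynomial.X_sub_C_ne_zero c) ht,
        Polynomial.natDegree_X_sub_C]
      omega
    · rwa [map_mul, map_sub, Polynomial.aeval_X, Polynomial.aeval_C, mul_assoc] at hb

end ExpLines

namespace ExpLines

open TensorProduct

theorem coordMap_smul {k K A : Type} [Field k] [Field K] [Algebra k K] [CommRing A] [Algebra k A]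
    (π : K →ₗ[k] k) (c : K) (x : K ⊗[k] A) :
    coordMap A π (c • x) = coordMap A (π ∘ₗ LinearMap.mulLeft k c) x := by
  induction x with
  | zero => simp
  | add x y hx hy => rw [smul_add, map_add, hx, hy, map_add]
  | tmul c b => simp [TensorProduct.smul_tmul']

namespace IsLineMap

variable {k : Type} [Field k] {f : MvPolynomial (Fin 2) k}
  {τ : MvPolynomial (Fin 2) k →ₐ[k] Polynomial k}
  {D : ℕ → MvPolynomial (Fin 2) k →ₗ[k] MvPolynomial (Fin 2) k}

/-- A non-constant element of minimal order whose leading constant divides all others of that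
order. -/
theorem exists_minimal (h : IsLineMap f τ) (hD : IsHD k D) (hnt : hD.ker ≠ ⊤) (hf : f ∈ hD.ker) :
    ∃ (w : MvPolynomial (Fin 2) k) (L : Polynomial k), w ∉ hD.ker ∧
      (∀ b, b ∉ hD.ker → hD.deg w ≤ hD.deg b) ∧ D (hD.deg w) w = Polynomial.aeval f L ∧ L ≠ 0 ∧
      ∀ b, (∀ n, hD.deg w < n → D n b = 0) →
        ∃ Q, D (hD.deg w) b = Polynomial.aeval f (L * Q) := by
  classical
  have hex : ∃ e, ∃ w, w ∉ hD.ker ∧ hD.deg w = e := by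
    by_contra! hc
    refine hnt (Algebra.eq_top_iff.2 fun b => ?_)
    by_contra hb
    exact hc _ b hb rfl
  obtain ⟨w₀, hw₀, hwe₀⟩ := Nat.find_spec hex
  set e := Nat.find hex with he
  have hmin : ∀ b, b ∉ hD.ker → e ≤ hD.deg b := fun b hb => Nat.find_min' hex ⟨b, hb, rfl⟩
  have htop : ∀ b, (∀ n, e < n → D n b = 0) →
      ∃ M : Polynomial k, D e b = Polynomial.aeval f M := by
    intro b hb
    exact (h.mem_ker_iff hD hnt hf _).1 (hD.top_mem_ker (hD.deg_le hb))
  have hex2 : ∃ l : ℕ, ∃ (w : MvPolynomial (Fin 2) k) (L : Polynomial k), w ∉ hD.ker ∧ hD.deg w = e ∧ D e w = Polynomial.aeval f L ∧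
      L.natDegree = l := by
    obtain ⟨L, hL⟩ := htop w₀ fun n hn => hD.eq_zero_of_deg_lt (hwe₀ ▸ hn)
    exact ⟨_, w₀, L, hw₀, hwe₀, hL, rfl⟩
  obtain ⟨w, L, hw, hwe, hwL, hl⟩ := Nat.find_spec hex2
  have hlmin : ∀ (w' : MvPolynomial (Fin 2) k) (L' : Polynomial k), w' ∉ hD.ker → hD.deg w' = e → D e w' = Polynomial.aeval f L' →
      L.natDegree ≤ L'.natDegree := by
    intro w' L' h1 h2 h3
    rw [hl]
    exact Nat.find_min' hex2 ⟨w', L', h1, h2, h3, rfl⟩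
  have he1 : e ≠ 0 := by
    rw [← hwe]
    exact fun h0 => hw (hD.mem_ker_iff_deg.2 h0)
  have hL0 : L ≠ 0 := by
    rintro rfl
    rw [map_zero, ← hwe] at hwL
    refine hD.deg_ne_zero_of ?_ hwL
    rintro rfl
    exact hw (zero_mem _)
  refine ⟨w, L, hw, fun b hb => hwe ▸ hmin b hb, hwe.symm ▸ hwL, hL0, ?_⟩
  rw [hwe]
  intro b hb
  obtain ⟨M, hM⟩ := htop b hb
  refine ⟨M / L, ?_⟩
  have hdiv := EuclideanDomain.div_add_mod M L
  suffices hmod : M % L = 0 by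
    rw [hM]
    congr 1
    rw [hmod, add_zero] at hdiv
    exact hdiv.symm
  by_contra hne
  set b' := b - Polynomial.aeval f (M / L) * w with hb'
  have hk : Polynomial.aeval f (M / L) ∈ hD.ker := (h.mem_ker_iff hD hnt hf _).2 ⟨_, rfl⟩
  have hDb' : D e b' = Polynomial.aeval f (M % L) := by
    rw [hb', map_sub, hD.map_mul_left hk, hM, hwL, ← map_mul, ← map_sub]
    congr 1
    rw [sub_eq_iff_eq_add]
    nth_rewrite 1 [← hdiv]
    ring
  have hDe : D e b' ≠ 0 := by
    rw [hDb']
    exact fun h0 => hne (h.aeval_injective h0)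
  have h1 : b' ∉ hD.ker := fun hc => hDe (hc e (by omega))
  have h2 : hD.deg b' = e := by
    refine le_antisymm (hD.deg_le fun n hn => ?_) (hD.le_deg hDe)
    rw [hb', map_sub, hD.map_mul_left hk, hb n hn, hD.eq_zero_of_deg_lt (hwe.symm ▸ hn), mul_zero,
      sub_zero]
  have h3 := hlmin b' _ h1 h2 hDb'
  have h4 := EuclideanDomain.mod_lt M hL0
  have h5 := Polynomial.natDegree_lt_natDegree hne h4
  omega

variable (K : Type) [Field K] [Algebra k K]

/-- The kernel of the extended higher derivation. -/
theorem mem_ker_baseChange (h : IsLineMap f τ) (hD : IsHD k D) (hnt : hD.ker ≠ ⊤)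
    (hf : f ∈ hD.ker) {x : K ⊗[k] MvPolynomial (Fin 2) k} (hx : x ∈ (hD.baseChange K).ker) :
    ∃ p : Polynomial K, x = Polynomial.aeval ((1 : K) ⊗ₜ[k] f) p := by
  obtain ⟨ι, s, b, c, hc, rfl⟩ := exists_sum_of_coordMap (Subalgebra.toSubmodule hD.ker) x
    fun π => hD.coordMap_mem_ker hx π
  choose p hp using fun i => (h.mem_ker_iff hD hnt hf _).1 (hc i)
  refine ⟨∑ i ∈ s, Polynomial.C (b i) * (p i).map (algebraMap k K), ?_⟩
  rw [map_sum]
  refine Finset.sum_congr rfl fun i _ => ?_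
  rw [map_mul, Polynomial.aeval_C, Polynomial.aeval_map_algebraMap, hp i]
  have : Polynomial.aeval ((1 : K) ⊗ₜ[k] f) (p i) = (1 : K) ⊗ₜ Polynomial.aeval f (p i) :=
    (Polynomial.aeval_algHom_apply (Algebra.TensorProduct.includeRight :
      MvPolynomial (Fin 2) k →ₐ[k] K ⊗[k] MvPolynomial (Fin 2) k) f (p i))
  rw [this, Algebra.TensorProduct.algebraMap_apply, Algebra.TensorProduct.tmul_mul_tmul]
  simp

/-- A line which is a constant of a nontrivial higher derivation of `k[Z,T]` is a coordinate. -/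
theorem exists_generator_of_const (h : IsLineMap f τ) (hD : IsHD k D) (hnt : hD.ker ≠ ⊤)
    (hf : f ∈ hD.ker) : ∃ q, Algebra.adjoin k {f, q} = ⊤ := by
  obtain ⟨w, L, hw, hmin, hwL, hL0, hdiv⟩ := h.exists_minimal hD hnt hf
  refine ⟨w, ?_⟩
  let K := AlgebraicClosure k
  let R := K ⊗[k] MvPolynomial (Fin 2) k
  let eR : R ≃ₐ[K] MvPolynomial (Fin 2) K := MvPolynomial.algebraTensorAlgEquiv k K
  have : IsDomain R := eR.toMulEquiv.isDomain _
  have : UniqueFactorizationMonoid R :=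
    eR.symm.toMulEquiv.uniqueFactorizationMonoid inferInstance
  set φ : R := (1 : K) ⊗ₜ f with hφ
  set ω : R := (1 : K) ⊗ₜ w with hω
  have hDK := hD.baseChange K
  have hφk : φ ∈ hDK.ker := hD.tmul_mem_ker hf 1
  have hinj : ∀ {p q : Polynomial K}, Polynomial.aeval φ p = Polynomial.aeval φ q → p = q := by
    intro p q hpq
    rw [← sub_eq_zero, ← map_sub] at hpq
    exact sub_eq_zero.1 (aeval_tmul_injective (fun _ hp => h.aeval_injective hp) hpq)
  have hkerK : ∀ {x : R}, x ∈ hDK.ker → ∃ p : Polynomial K, x = Polynomial.aeval φ p := fun hx =>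
    h.mem_ker_baseChange K hD hnt hf hx
  have hlin : ∀ c : K, φ - algebraMap K R c = Polynomial.aeval φ (Polynomial.X - Polynomial.C c) := by
    intro c
    rw [map_sub, Polynomial.aeval_X, Polynomial.aeval_C]
  have hlin0 : ∀ c : K, φ - algebraMap K R c ≠ 0 := by
    intro c hc
    rw [hlin, ← map_zero (Polynomial.aeval (R := K) φ)] at hc
    exact Polynomial.X_sub_C_ne_zero c (hinj hc)
  have hlink : ∀ c : K, φ - algebraMap K R c ∈ hDK.ker := fun c =>
    sub_mem hφk (Subalgebra.algebraMap_mem _ c)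
  have hprime : ∀ c : K, Prime (φ - algebraMap K R c) := by
    intro c
    refine UniqueFactorizationMonoid.irreducible_iff_prime.1 ⟨fun hu => ?_, fun {a b} hab => ?_⟩
    · obtain ⟨v, hv⟩ := hu.exists_right_inv
      obtain ⟨p, hp⟩ := hkerK (hDK.right_mem_ker_of_mul (hv ▸ one_mem _) (hv ▸ one_ne_zero))
      rw [hlin, hp, ← map_mul, ← map_one (Polynomial.aeval (R := K) φ)] at hv
      exact Polynomial.not_isUnit_X_sub_C c (IsUnit.of_mul_eq_one _ (hinj hv))
    · have hab' : a * b ∈ hDK.ker := hab ▸ hlink c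
      have hab0 : a * b ≠ 0 := hab ▸ hlin0 c
      obtain ⟨p, rfl⟩ := hkerK (hDK.left_mem_ker_of_mul hab' hab0)
      obtain ⟨q, rfl⟩ := hkerK (hDK.right_mem_ker_of_mul hab' hab0)
      rw [hlin, ← map_mul] at hab
      exact ((Polynomial.irreducible_X_sub_C c).isUnit_or_isUnit (hinj hab)).imp
        (fun hu => hu.map _) (fun hu => hu.map _)
  set e := hD.deg w with he
  have he1 : e ≠ 0 := fun h0 => hw (hD.mem_ker_iff_deg.2 h0)
  have haevalL : ∀ p : Polynomial k,
      (1 : K) ⊗ₜ Polynomial.aeval f p = Polynomial.aeval φ (p.map (algebraMap k K)) := by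
    intro p
    rw [Polynomial.aeval_map_algebraMap]
    exact (Polynomial.aeval_algHom_apply (Algebra.TensorProduct.includeRight :
      MvPolynomial (Fin 2) k →ₐ[k] K ⊗[k] MvPolynomial (Fin 2) k) f p).symm
  have hndvd : ∀ c d : K, ¬ φ - algebraMap K R c ∣ ω - algebraMap K R d := by
    rintro c d ⟨v, hv⟩
    have hval : ∀ n, 1 ≤ n → (1 : K) ⊗ₜ D n w = (φ - algebraMap K R c) * (D n).baseChange K v := by
      intro n hn
      rw [← hDK.map_mul_left (hlink c) n v, ← hv, map_sub,
        (Subalgebra.algebraMap_mem hDK.ker d) n hn, sub_zero, hω, LinearMap.baseChange_tmul]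
    have hv0 : ∀ n, e < n → (D n).baseChange K v = 0 := by
      intro n hn
      have h1 := hval n (by omega)
      rw [hD.eq_zero_of_deg_lt hn, TensorProduct.tmul_zero, eq_comm, mul_eq_zero] at h1
      exact h1.resolve_left (hlin0 c)
    let N : Submodule k (MvPolynomial (Fin 2) k) := ⨅ n : {n // e < n}, LinearMap.ker (D n)
    obtain ⟨ι, s, b, u, hu, rfl⟩ := exists_sum_of_coordMap N v fun π => by
      rw [Submodule.mem_iInf]
      rintro ⟨n, hn⟩
      rw [LinearMap.mem_ker, ← coordMap_baseChange, hv0 n hn, map_zero]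
    choose Q hQ using fun i => hdiv (u i) fun n hn => by
      have := (Submodule.mem_iInf _).1 (hu i) ⟨n, hn⟩
      exact this
    have h1 := hval e (by omega)
    have h2 : (D e).baseChange K (∑ i ∈ s, b i ⊗ₜ u i) = Polynomial.aeval φ
        (L.map (algebraMap k K) * ∑ i ∈ s, Polynomial.C (b i) * (Q i).map (algebraMap k K)) := by
      rw [map_sum, Finset.mul_sum, map_sum]
      refine Finset.sum_congr rfl fun i _ => ?_
      rw [LinearMap.baseChange_tmul, hQ, mul_left_comm, ← Polynomial.map_mul, map_mul (Polynomial.aeval φ),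
        ← haevalL, Polynomial.aeval_C, Algebra.TensorProduct.algebraMap_apply,
        Algebra.TensorProduct.tmul_mul_tmul]
      simp
    rw [h2, hwL, haevalL, hlin, ← map_mul] at h1
    have h3 := hinj h1
    set Q' := ∑ i ∈ s, Polynomial.C (b i) * (Q i).map (algebraMap k K)
    have hLK : L.map (algebraMap k K) ≠ 0 := by
      rwa [Ne, Polynomial.map_eq_zero]
    have h4 : (Polynomial.X - Polynomial.C c) * Q' = 1 := by
      refine mul_left_cancel₀ hLK ?_
      rw [mul_one]
      nth_rewrite 2 [h3]
      ring
    exact Polynomial.not_isUnit_X_sub_C c (IsUnit.of_mul_eq_one _ h4)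
  rw [Algebra.eq_top_iff]
  intro b
  obtain ⟨N, M, α, hα, hsum⟩ := hD.slice_trivial hw hmin b
  choose p hp using fun i => (h.mem_ker_iff hD hnt hf _).1 (hα i)
  have hmemb : (1 : K) ⊗ₜ[k] b ∈ Algebra.adjoin K {φ, ω} := by
    refine mem_adjoin_of_aeval_mul hprime hndvd (s := (L ^ N).map (algebraMap k K)) ?_ ?_
    · rw [Ne, Polynomial.map_eq_zero]
      exact pow_ne_zero _ hL0
    · rw [← haevalL, Algebra.TensorProduct.tmul_mul_tmul, one_mul, map_pow, ← hwL, hsum,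
        TensorProduct.tmul_sum]
      refine sum_mem fun i _ => ?_
      have : (1 : K) ⊗ₜ[k] (α i * w ^ i) =
          Polynomial.aeval φ ((p i).map (algebraMap k K)) * ω ^ i := by
        rw [← haevalL, hω, Algebra.TensorProduct.tmul_pow, Algebra.TensorProduct.tmul_mul_tmul,
          one_mul, one_pow, hp i]
      rw [this]
      refine mul_mem ?_ (pow_mem (Algebra.subset_adjoin (by simp)) _)
      exact Algebra.adjoin_mono (by simp) (Polynomial.aeval_mem_adjoin_singleton K φ)
  obtain ⟨π, hπ⟩ : ∃ π : K →ₗ[k] k, π 1 ≠ 0 := by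
    by_contra! hc
    exact one_ne_zero ((Module.forall_dual_apply_eq_zero_iff k (1 : K)).1 hc)
  have hcoord : ∀ x ∈ Algebra.adjoin K {φ, ω}, ∀ π, coordMap _ π x ∈ Algebra.adjoin k {f, w} := by
    intro x hx
    rw [← Subalgebra.mem_toSubmodule, Algebra.adjoin_eq_span] at hx
    induction hx using Submodule.span_induction with
    | mem x hx =>
      have : ∃ a ∈ Algebra.adjoin k {f, w}, x = (1 : K) ⊗ₜ[k] a := by
        induction hx using Submonoid.closure_induction with
        | mem x hx =>
          rcases hx with rfl | rfl
          · exact ⟨f, Algebra.subset_adjoin (by simp), rfl⟩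
          · exact ⟨w, Algebra.subset_adjoin (by simp), rfl⟩
        | one => exact ⟨1, one_mem _, Algebra.TensorProduct.one_def⟩
        | mul x y _ _ hx hy =>
          obtain ⟨a, ha, rfl⟩ := hx
          obtain ⟨a', ha', rfl⟩ := hy
          exact ⟨a * a', mul_mem ha ha', by rw [Algebra.TensorProduct.tmul_mul_tmul, one_mul]⟩
      obtain ⟨a, ha, rfl⟩ := this
      intro π
      rw [coordMap_tmul]
      exact Subalgebra.smul_mem _ ha _
    | zero => simp
    | add x y _ _ hx hy =>
      intro π
      rw [map_add]
      exact add_mem (hx π) (hy π)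
    | smul c x _ hx =>
      intro π
      rw [coordMap_smul]
      exact hx _
  have := hcoord _ hmemb π
  rw [coordMap_tmul] at this
  have h1 := Subalgebra.smul_mem _ this (π 1)⁻¹
  rwa [smul_smul, inv_mul_cancel₀ hπ, one_smul] at h1

end IsLineMap
end ExpLines

namespace ExpLines

/-- If `f, q` generate `k[Z,T]`, then `k[Z,T]` is a polynomial ring over `k[f]`. -/
theorem nonempty_equiv_of_adjoin_eq_top {k : Type} [Field k] {f q : MvPolynomial (Fin 2) k}
    (h : Algebra.adjoin k {f, q} = ⊤) :
    Nonempty (Polynomial ↥(Algebra.adjoin k {f})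
      ≃ₐ[↥(Algebra.adjoin k {f})] MvPolynomial (Fin 2) k) := by
  have hr : Set.range ![f, q] = {f, q} := by
    ext x
    simp [eq_comm, or_comm]
  have htop : Algebra.adjoin k (Set.range ![f, q]) = ⊤ := hr ▸ h
  have hsurj : Function.Surjective
      (algebraMap (Algebra.adjoin k (Set.range ![f, q])) (MvPolynomial (Fin 2) k)) := fun b =>
    ⟨⟨b, htop ▸ Algebra.mem_top⟩, rfl⟩
  have : Algebra.IsAlgebraic (Algebra.adjoin k (Set.range ![f, q])) (MvPolynomial (Fin 2) k) :=
    ⟨fun b => by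
      obtain ⟨a, rfl⟩ := hsurj b
      exact isAlgebraic_algebraMap a⟩
  have hb := Algebra.IsAlgebraic.isTranscendenceBasis_of_le_trdeg_of_finite k ![f, q] (by
    rw [MvPolynomial.trdeg_of_isDomain]
    simp)
  have ht := hb.1.transcendental_adjoin (s := {0}) (i := 1) (by simp)
  have himg : ![f, q] '' {0} = {f} := by simp
  rw [himg] at ht
  refine ⟨AlgEquiv.ofBijective (Polynomial.aeval q) ⟨transcendental_iff_injective.1 ht, ?_⟩⟩
  have hle : (⊤ : Subalgebra k (MvPolynomial (Fin 2) k)) ≤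
      (Polynomial.aeval (R := Algebra.adjoin k {f}) q).range.restrictScalars k := by
    rw [← h, Algebra.adjoin_le_iff]
    rintro x (rfl | rfl)
    · exact ⟨Polynomial.C ⟨x, Algebra.subset_adjoin rfl⟩, Polynomial.aeval_C _ _⟩
    · exact ⟨Polynomial.X, Polynomial.aeval_X _⟩
  intro b
  exact hle (Algebra.mem_top : b ∈ ⊤)

end ExpLines

namespace ExpLines

/-- The ring of Laurent polynomials in `m` variables over `k[Z,T]`. -/
abbrev Lau (k : Type) [Field k] (m : ℕ) : Type :=
  AddMonoidAlgebra (MvPolynomial (Fin 2) k) (Fin m → ℤ)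

variable {k : Type} [Field k] {m : ℕ}

/-- The polynomials which may occur as the coefficient of `x ^ d` in an element of the
subalgebra generated by `k[x,Z,T]` and `y = x ^ (-r) * f`. -/
def layer (r : Fin m → ℕ) (f : MvPolynomial (Fin 2) k) (d : Fin m → ℤ) :
    Ideal (MvPolynomial (Fin 2) k) where
  carrier := {a | a = 0 ∨ ∃ j : ℕ, f ^ j ∣ a ∧ ∀ i, 0 ≤ d i + j * r i}
  zero_mem' := Or.inl rfl
  add_mem' := by
    rintro a b (rfl | ⟨i, hi, hid⟩) (rfl | ⟨j, hj, hjd⟩)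
    · simp
    · right; exact ⟨j, by simpa using hj, hjd⟩
    · right; exact ⟨i, by simpa using hi, hid⟩
    · right
      rcases le_total i j with h | h
      · exact ⟨i, dvd_add hi ((pow_dvd_pow f h).trans hj), hid⟩
      · exact ⟨j, dvd_add ((pow_dvd_pow f h).trans hi) hj, hjd⟩
  smul_mem' := by
    rintro c a (rfl | ⟨i, hi, hid⟩)
    · simp
    · right; exact ⟨i, hi.mul_left c, hid⟩

theorem mul_mem_layer {r : Fin m → ℕ} {f : MvPolynomial (Fin 2) k} {d e : Fin m → ℤ}
    {a b : MvPolynomial (Fin 2) k} (ha : a ∈ layer r f d) (hb : b ∈ layer r f e) :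
    a * b ∈ layer r f (d + e) := by
  rcases ha with rfl | ⟨i, hi, hid⟩
  · simp
  rcases hb with rfl | ⟨j, hj, hjd⟩
  · simp
  refine Or.inr ⟨i + j, by rw [pow_add]; exact mul_dvd_mul hi hj, fun l => ?_⟩
  have h1 := hid l
  have h2 := hjd l
  push_cast
  rw [Pi.add_apply]
  linarith

theorem mem_layer_of_nonneg {r : Fin m → ℕ} {f : MvPolynomial (Fin 2) k} {d : Fin m → ℤ}
    (hd : 0 ≤ d) (a : MvPolynomial (Fin 2) k) : a ∈ layer r f d :=
  Or.inr ⟨0, by simp, fun i => by simpa using hd i⟩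

/-- The subalgebra of Laurent polynomials generated by `k[x,Z,T]` and `y = x ^ (-r) * f`. -/
def lauRing (r : Fin m → ℕ) (f : MvPolynomial (Fin 2) k) : Subalgebra k (Lau k m) where
  carrier := {p | ∀ d, p.coeff d ∈ layer r f d}
  add_mem' ha hb d := by
    rw [AddMonoidAlgebra.coeff_add, Finsupp.add_apply]; exact add_mem (ha d) (hb d)
  mul_mem' {a b} ha hb d := by
    rw [AddMonoidAlgebra.coeff_mul]
    refine sum_mem fun d₁ _ => sum_mem fun d₂ _ => ?_
    dsimp only
    split_ifs with h
    · rw [← h]; exact mul_mem_layer (ha d₁) (hb d₂)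
    · exact zero_mem _
  algebraMap_mem' c d := by
    classical
    change (AddMonoidAlgebra.single 0 (algebraMap k _ c)).coeff d ∈ _
    rw [AddMonoidAlgebra.coeff_single, Finsupp.single_apply]
    split_ifs with h
    · exact h ▸ mem_layer_of_nonneg le_rfl _
    · exact zero_mem _

variable {r : Fin m → ℕ} {f : MvPolynomial (Fin 2) k}

theorem single_mem_lauRing {d : Fin m → ℤ} {b : MvPolynomial (Fin 2) k} (hb : b ∈ layer r f d) :
    AddMonoidAlgebra.single d b ∈ lauRing r f := fun e => by
  classical
  rw [AddMonoidAlgebra.coeff_single, Finsupp.single_apply]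
  split_ifs with h
  · rwa [← h]
  · exact zero_mem _

variable (r f)

/-- The inclusion of `k[Z,T]`. -/
def inclLau : MvPolynomial (Fin 2) k →ₐ[k] lauRing r f :=
  (AddMonoidAlgebra.singleZeroAlgHom (R := k) (M := Fin m → ℤ)).codRestrict _ fun a =>
    single_mem_lauRing (mem_layer_of_nonneg le_rfl a)

/-- The variables `x i`. -/
def xLau (i : Fin m) : lauRing r f :=
  ⟨AddMonoidAlgebra.single (Pi.single i 1) 1, single_mem_lauRing
    (mem_layer_of_nonneg (Pi.single_nonneg.2 zero_le_one) 1)⟩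

/-- The element `y = x ^ (-r) * f`. -/
def yLau : lauRing r f :=
  ⟨AddMonoidAlgebra.single (fun i => -(r i : ℤ)) f, single_mem_lauRing
    (Or.inr ⟨1, by simp, fun i => by simp⟩)⟩

variable {r f}

@[simp] theorem coe_inclLau (a : MvPolynomial (Fin 2) k) :
    (inclLau r f a : Lau k m) = AddMonoidAlgebra.single 0 a := rfl

@[simp] theorem coe_xLau (i : Fin m) :
    (xLau r f i : Lau k m) = AddMonoidAlgebra.single (Pi.single i 1) 1 := rfl

@[simp] theorem coe_yLau :
    (yLau r f : Lau k m) = AddMonoidAlgebra.single (fun i => -(r i : ℤ)) f := rfl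

theorem coe_monomial (b : MvPolynomial (Fin 2) k) (j : ℕ) (n : Fin m → ℕ) :
    ((inclLau r f b * yLau r f ^ j * ∏ i, xLau r f i ^ n i : lauRing r f) : Lau k m) =
      AddMonoidAlgebra.single (fun i => (n i : ℤ) - j * r i) (b * f ^ j) := by
  have h : ((∏ i, xLau r f i ^ n i : lauRing r f) : Lau k m) =
      AddMonoidAlgebra.single (fun i => (n i : ℤ)) 1 := by
    rw [SubmonoidClass.coe_finsetProd]
    simp only [SubmonoidClass.coe_pow, coe_xLau, AddMonoidAlgebra.single_pow, one_pow]
    rw [AddMonoidAlgebra.prod_single]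
    simp only [Finset.prod_const_one]
    congr 1
    ext i
    simp [Finset.sum_apply, Pi.single_apply]
  rw [Subalgebra.coe_mul, h, Subalgebra.coe_mul, Subalgebra.coe_pow, coe_inclLau, coe_yLau,
    AddMonoidAlgebra.single_pow, AddMonoidAlgebra.single_mul_single,
    AddMonoidAlgebra.single_mul_single, mul_one]
  congr 1
  ext i
  simp
  ring

/-- Homogeneous elements are monomials in `x`, `y` with coefficient in `k[Z,T]`. -/
theorem exists_eq_monomial {p : lauRing r f} {d : Fin m → ℤ} {b : MvPolynomial (Fin 2) k}
    (hp : (p : Lau k m) = AddMonoidAlgebra.single d b) (hb : b ≠ 0) :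
    ∃ (j : ℕ) (b' : MvPolynomial (Fin 2) k) (n : Fin m → ℕ), b = b' * f ^ j ∧
      (∀ i, (n i : ℤ) = d i + j * r i) ∧
      p = inclLau r f b' * yLau r f ^ j * ∏ i, xLau r f i ^ n i := by
  have h := p.2 d
  rw [hp, AddMonoidAlgebra.coeff_single, Finsupp.single_eq_same] at h
  obtain ⟨j, ⟨b', hb'⟩, hd⟩ := h.resolve_left hb
  choose n hn using fun i => Int.eq_ofNat_of_zero_le (hd i)
  refine ⟨j, b', n, by rw [hb', mul_comm], fun i => (hn i).symm, Subtype.ext ?_⟩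
  rw [hp, coe_monomial, hb', mul_comm b']
  congr 1
  ext i
  have := hn i
  linarith

theorem lauRing_induction {P : lauRing r f → Prop} (h0 : P 0)
    (hadd : ∀ a b, P a → P b → P (a + b))
    (hhom : ∀ (p : lauRing r f) (d : Fin m → ℤ) (b : MvPolynomial (Fin 2) k), b ≠ 0 →
      (p : Lau k m) = AddMonoidAlgebra.single d b → P p) (p : lauRing r f) : P p := by
  have hp : p = ∑ d ∈ (p : Lau k m).coeff.support,
      ⟨AddMonoidAlgebra.single d ((p : Lau k m).coeff d), single_mem_lauRing (p.2 d)⟩ := by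
    apply Subtype.ext
    rw [AddSubmonoidClass.coe_finsetSum]
    exact (AddMonoidAlgebra.sum_coeff_single (p : Lau k m)).symm
  rw [hp]
  exact Finset.sum_induction _ P hadd h0 fun d hd => hhom _ d _ (Finsupp.mem_support_iff.1 hd) rfl

theorem adjoin_eq_top_of_generators {S : Subalgebra k (lauRing r f)}
    (hx : ∀ i, xLau r f i ∈ S) (hy : yLau r f ∈ S) (h0 : inclLau r f (X 0) ∈ S)
    (h1 : inclLau r f (X 1) ∈ S) : S = ⊤ := by
  have hι : ∀ b, inclLau r f b ∈ S := by
    intro b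
    induction b using MvPolynomial.induction_on with
    | C a => rw [← MvPolynomial.algebraMap_eq, AlgHom.commutes]; exact S.algebraMap_mem a
    | add p q hp hq => rw [map_add]; exact add_mem hp hq
    | mul_X p i hp =>
      rw [map_mul]
      refine mul_mem hp ?_
      fin_cases i
      · exact h0
      · exact h1
  refine eq_top_iff.2 fun p _ => ?_
  refine lauRing_induction (P := fun p => p ∈ S) (zero_mem _) (fun _ _ => add_mem) ?_ p
  intro p d b hb hp
  obtain ⟨j, b', n, -, -, rfl⟩ := exists_eq_monomial hp hb
  exact mul_mem (mul_mem (hι b') (pow_mem hy j)) (prod_mem fun i _ => pow_mem (hx i) _)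

theorem prod_xLau_mul_yLau : (∏ i, xLau r f i ^ r i) * yLau r f = inclLau r f f := by
  have h := coe_monomial (r := r) (f := f) 1 1 r
  apply Subtype.ext
  rw [coe_inclLau, mul_comm]
  rw [map_one, one_mul, pow_one] at h
  rw [h]
  congr 1
  · ext i; simp
  · simp

end ExpLines

namespace ExpLines

variable {k : Type} [Field k] {m : ℕ} {r : Fin m → ℕ} {f : MvPolynomial (Fin 2) k}

variable (r f) in
/-- The projection of `lauRing r f` to the component of degree `s` for the weights `ω`. -/
def proj (ω : (Fin m → ℤ) →+ ℝ) (s : ℝ) : lauRing r f →ₗ[k] lauRing r f where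
  toFun p := ⟨.ofCoeff ((p : Lau k m).coeff.filter fun d => ω d = s), fun d => by
    classical
    rw [AddMonoidAlgebra.coeff_ofCoeff, Finsupp.filter_apply]
    split_ifs
    · exact p.2 d
    · exact zero_mem _⟩
  map_add' p q := Subtype.ext (congrArg AddMonoidAlgebra.ofCoeff Finsupp.filter_add)
  map_smul' c p := Subtype.ext (congrArg AddMonoidAlgebra.ofCoeff Finsupp.filter_smul)

theorem coeff_proj (ω : (Fin m → ℤ) →+ ℝ) (s : ℝ) (p : lauRing r f) (d : Fin m → ℤ) :
    (proj r f ω s p : Lau k m).coeff d = if ω d = s then (p : Lau k m).coeff d else 0 := by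
  classical
  exact Finsupp.filter_apply _ _ _

theorem lauRing_ext {p q : lauRing r f}
    (h : ∀ d, (p : Lau k m).coeff d = (q : Lau k m).coeff d) : p = q :=
  Subtype.ext (AddMonoidAlgebra.coeff_injective (Finsupp.ext h))

theorem proj_eq_self_iff {ω : (Fin m → ℤ) →+ ℝ} {s : ℝ} {p : lauRing r f} :
    proj r f ω s p = p ↔ ∀ d, (p : Lau k m).coeff d ≠ 0 → ω d = s := by
  constructor
  · intro h d hd
    rw [← h, coeff_proj] at hd
    by_contra hne
    exact hd (if_neg hne)
  · intro h
    refine lauRing_ext fun d => ?_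
    rw [coeff_proj]
    split_ifs with hd
    · rfl
    · by_contra hne
      exact hd (h d (Ne.symm hne))

theorem exists_coeff_ne_zero_of_mul {p q : lauRing r f} {d : Fin m → ℤ}
    (h : ((p * q : lauRing r f) : Lau k m).coeff d ≠ 0) :
    ∃ d₁ d₂, (p : Lau k m).coeff d₁ ≠ 0 ∧ (q : Lau k m).coeff d₂ ≠ 0 ∧ d₁ + d₂ = d := by
  classical
  rw [Subalgebra.coe_mul, AddMonoidAlgebra.coeff_mul] at h
  obtain ⟨d₁, h₁, h⟩ := Finset.exists_ne_zero_of_sum_ne_zero h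
  obtain ⟨d₂, h₂, h⟩ := Finset.exists_ne_zero_of_sum_ne_zero h
  refine ⟨d₁, d₂, Finsupp.mem_support_iff.1 h₁, Finsupp.mem_support_iff.1 h₂, ?_⟩
  by_contra hne
  exact h (if_neg hne)

theorem isGrad_proj (ω : (Fin m → ℤ) →+ ℝ) : IsGrad (A := lauRing r f) k (proj r f ω) where
  idem s a := proj_eq_self_iff.2 fun d hd => by
    rw [coeff_proj] at hd
    by_contra hne
    exact hd (if_neg hne)
  orth s t a hst := lauRing_ext fun d => by
    rw [coeff_proj, coeff_proj]
    split_ifs with h1 h2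
    · exact absurd (h1.symm.trans h2) hst
    · rfl
    · rfl
  fin a := by
    classical
    refine ((a : Lau k m).coeff.support.image ω).finite_toSet.subset fun s hs => ?_
    rw [Finset.mem_coe, Finset.mem_image]
    by_contra! hne
    refine hs (lauRing_ext fun d => ?_)
    rw [coeff_proj]
    split_ifs with h
    · by_contra h0
      exact hne d (Finsupp.mem_support_iff.2 h0) h
    · rfl
  sum a := by
    classical
    rw [finsum_eq_sum_of_support_subset (s := (a : Lau k m).coeff.support.image ω)]
    · refine lauRing_ext fun d => ?_
      rw [AddSubmonoidClass.coe_finsetSum, AddMonoidAlgebra.coeff_sum, Finsupp.finsetSum_apply]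
      simp only [coeff_proj]
      rw [Finset.sum_ite_eq]
      split_ifs with h
      · rfl
      · by_contra h0
        exact h (Finset.mem_image_of_mem _ (Finsupp.mem_support_iff.2 (Ne.symm h0)))
    · intro s hs
      rw [Finset.mem_coe, Finset.mem_image]
      by_contra! hne
      refine hs (lauRing_ext fun d => ?_)
      rw [coeff_proj]
      split_ifs with h
      · by_contra h0
        exact hne d (Finsupp.mem_support_iff.2 h0) h
      · rfl
  one := proj_eq_self_iff.2 fun d hd => by
    have h : (0 : Fin m → ℤ) = d := by
      by_contra hne
      apply hd
      change (AddMonoidAlgebra.single 0 1 : Lau k m).coeff d = 0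
      rw [AddMonoidAlgebra.coeff_single, Finsupp.single_eq_of_ne (Ne.symm hne)]
    rw [← h, map_zero]
  mul s t a b ha hb := proj_eq_self_iff.2 fun d hd => by
    obtain ⟨d₁, d₂, h₁, h₂, rfl⟩ := exists_coeff_ne_zero_of_mul hd
    rw [map_add, proj_eq_self_iff.1 ha d₁ h₁, proj_eq_self_iff.1 hb d₂ h₂]

theorem proj_single (ω : (Fin m → ℤ) →+ ℝ) {p : lauRing r f} {d : Fin m → ℤ}
    {b : MvPolynomial (Fin 2) k} (hp : (p : Lau k m) = AddMonoidAlgebra.single d b) :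
    proj r f ω (ω d) p = p := proj_eq_self_iff.2 fun e he => by
  rw [hp, AddMonoidAlgebra.coeff_single] at he
  by_contra hne
  exact he (Finsupp.single_eq_of_ne fun h => hne (by rw [h]))

/-- Homogenization of a nontrivial family with respect to a weight. -/
theorem homogenize_lauRing (ω : (Fin m → ℤ) →+ ℝ) {D : ℕ → lauRing r f →ₗ[k] lauRing r f}
    (hD : IsHD k D) (hnt : hD.ker ≠ ⊤) :
    ∃ (w : ℝ) (D' : ℕ → lauRing r f →ₗ[k] lauRing r f) (hD' : IsHD k D'), hD'.ker ≠ ⊤ ∧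
      (∀ s a (n : ℕ), proj r f ω s a = a → proj r f ω (s - n * w) (D' n a) = D' n a) ∧
      (∀ a M, a ∈ hD.ker → a ∈ IsGrad.le (proj r f ω) M → proj r f ω M a ∈ hD'.ker) := by
  classical
  let S : Finset (lauRing r f) := Finset.univ.image (xLau r f) ∪
    {yLau r f, inclLau r f (X 0), inclLau r f (X 1)}
  have hS : ∀ g, ∃ s, g ∈ S → proj r f ω s g = g := by
    intro g
    by_cases hg : g ∈ S
    · simp only [S, Finset.mem_union, Finset.mem_image, Finset.mem_univ, true_and,
        Finset.mem_insert, Finset.mem_singleton] at hg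
      rcases hg with ⟨i, rfl⟩ | rfl | rfl | rfl
      · exact ⟨_, fun _ => proj_single ω (coe_xLau i)⟩
      · exact ⟨_, fun _ => proj_single ω coe_yLau⟩
      · exact ⟨_, fun _ => proj_single ω (coe_inclLau _)⟩
      · exact ⟨_, fun _ => proj_single ω (coe_inclLau _)⟩
    · exact ⟨0, fun h => absurd h hg⟩
  choose δ hδ using hS
  refine (isGrad_proj ω).homogenize hD hnt S δ ?_ hδ
  refine adjoin_eq_top_of_generators (fun i => ?_) ?_ ?_ ?_ <;>
    refine Algebra.subset_adjoin ?_ <;> simp [S]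

/-- The weights given by the powers of a transcendental number separate the degrees. -/
theorem exists_injective_weight (m : ℕ) : ∃ ω : (Fin m → ℤ) →+ ℝ, Function.Injective ω := by
  let L : ℝ := liouvilleNumber 2
  have hL : Transcendental ℤ L := transcendental_liouvilleNumber le_rfl
  let ω : (Fin m → ℤ) →+ ℝ :=
    { toFun := fun d => ∑ i, (d i : ℝ) * L ^ (i : ℕ)
      map_zero' := by simp
      map_add' := fun d e => by simp [add_mul, Finset.sum_add_distrib] }
  refine ⟨ω, (injective_iff_map_eq_zero _).2 fun d hd => ?_⟩
  let q : Polynomial ℤ := ∑ i : Fin m, Polynomial.monomial (i : ℕ) (d i)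
  have hq : Polynomial.aeval L q = 0 := by
    rw [map_sum]
    simp only [Polynomial.aeval_monomial]
    change ∑ i, (d i : ℝ) * L ^ (i : ℕ) = 0 at hd
    simpa using hd
  have hq0 : q = 0 := by
    by_contra h0
    exact hL ⟨q, h0, hq⟩
  ext i
  have := congrArg (fun p => Polynomial.coeff p (i : ℕ)) hq0
  simp only [q, Polynomial.finsetSum_coeff, Polynomial.coeff_monomial, Polynomial.coeff_zero] at this
  simpa [Fin.val_inj] using this

end ExpLines

namespace ExpLines

variable {k : Type} [Field k] {m : ℕ} {r : Fin m → ℕ} {f : MvPolynomial (Fin 2) k}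
  {ω : (Fin m → ℤ) →+ ℝ}

theorem exists_single_of_proj (hω : Function.Injective ω) {s : ℝ} {a : lauRing r f}
    (ha : proj r f ω s a = a) (h0 : a ≠ 0) :
    ∃ d b, b ≠ 0 ∧ (a : Lau k m) = AddMonoidAlgebra.single d b ∧ ω d = s := by
  obtain ⟨d, hd⟩ : ∃ d, (a : Lau k m).coeff d ≠ 0 := by
    by_contra! hc
    exact h0 (lauRing_ext hc)
  refine ⟨d, _, hd, ?_, proj_eq_self_iff.1 ha d hd⟩
  apply AddMonoidAlgebra.coeff_injective
  ext1 e
  rw [AddMonoidAlgebra.coeff_single]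
  by_cases he : e = d
  · rw [he, Finsupp.single_eq_same]
  · rw [Finsupp.single_eq_of_ne he]
    by_contra hne
    exact he (hω ((proj_eq_self_iff.1 ha e hne).trans (proj_eq_self_iff.1 ha d hd).symm))

/-- The substitution `x = 1`. -/
def sumHom (r : Fin m → ℕ) (f : MvPolynomial (Fin 2) k) :
    lauRing r f →ₐ[k] MvPolynomial (Fin 2) k :=
  ((AddMonoidAlgebra.lift (MvPolynomial (Fin 2) k) (MvPolynomial (Fin 2) k)
    (Fin m → ℤ) 1).restrictScalars k).comp (lauRing r f).val

theorem sumHom_of_single {p : lauRing r f} {d : Fin m → ℤ} {b : MvPolynomial (Fin 2) k}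
    (hp : (p : Lau k m) = AddMonoidAlgebra.single d b) : sumHom r f p = b := by
  change AddMonoidAlgebra.lift (MvPolynomial (Fin 2) k) (MvPolynomial (Fin 2) k)
    (Fin m → ℤ) 1 (p : Lau k m) = b
  rw [hp, AddMonoidAlgebra.lift_single]
  simp

@[simp] theorem sumHom_inclLau (b : MvPolynomial (Fin 2) k) : sumHom r f (inclLau r f b) = b :=
  sumHom_of_single (coe_inclLau b)

@[simp] theorem sumHom_xLau (i : Fin m) : sumHom r f (xLau r f i) = 1 :=
  sumHom_of_single (coe_xLau i)

@[simp] theorem sumHom_yLau : sumHom r f (yLau r f) = f :=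
  sumHom_of_single coe_yLau

theorem ne_zero_of_single {p : lauRing r f} {d : Fin m → ℤ} {b : MvPolynomial (Fin 2) k}
    (hp : (p : Lau k m) = AddMonoidAlgebra.single d b) (hb : b ≠ 0) : p ≠ 0 := by
  rintro rfl
  exact hb (AddMonoidAlgebra.single_eq_zero.1 hp.symm)

theorem inclLau_ne_zero {b : MvPolynomial (Fin 2) k} (hb : b ≠ 0) : inclLau r f b ≠ 0 :=
  ne_zero_of_single (coe_inclLau b) hb

variable {D : ℕ → lauRing r f →ₗ[k] lauRing r f}

/-- Homogeneous constants, if the variable `x i` is not constant. -/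
theorem IsHD.single_mem_ker (hD : IsHD k D) {p : lauRing r f} {d : Fin m → ℤ}
    {b : MvPolynomial (Fin 2) k} (hp : (p : Lau k m) = AddMonoidAlgebra.single d b) (hb : b ≠ 0)
    (hpk : p ∈ hD.ker) {i : Fin m} (hi : xLau r f i ∉ hD.ker) :
    ∃ (j : ℕ) (b' : MvPolynomial (Fin 2) k), b = b' * f ^ j ∧ d i = -(j * r i : ℤ) ∧
      inclLau r f b' ∈ hD.ker := by
  obtain ⟨j, b', n, hb', hn, hpe⟩ := exists_eq_monomial hp hb
  have hp0 : p ≠ 0 := ne_zero_of_single hp hb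
  rw [hpe] at hpk hp0
  have h1 := hD.left_mem_ker_of_mul hpk hp0
  have h2 := hD.left_mem_ker_of_mul h1 (left_ne_zero_of_mul hp0)
  have h3 := hD.right_mem_ker_of_mul hpk hp0
  have h4 := right_ne_zero_of_mul hp0
  refine ⟨j, b', hb', ?_, h2⟩
  have hni : n i = 0 := by
    by_contra hne
    rw [← Finset.mul_prod_erase _ _ (Finset.mem_univ i), ← Nat.succ_pred_eq_of_ne_zero hne,
      pow_succ', mul_assoc] at h3 h4
    exact hi (hD.left_mem_ker_of_mul h3 h4)
  have := hn i
  rw [hni] at this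
  push_cast at this
  linarith

/-- The slice lemma for higher derivations which are homogeneous for a separating weight. -/
theorem IsHD.slice_single (hω : Function.Injective ω) (hD : IsHD k D) {ω₀ : ℝ}
    (hhom : ∀ s a (n : ℕ), proj r f ω s a = a → proj r f ω (s - n * ω₀) (D n a) = D n a)
    {w : lauRing r f} {dw : Fin m → ℤ} {bw : MvPolynomial (Fin 2) k}
    (hw : (w : Lau k m) = AddMonoidAlgebra.single dw bw) (hwk : w ∉ hD.ker)
    (hmin : ∀ s a, proj r f ω s a = a → a ∉ hD.ker → hD.deg w ≤ hD.deg a) :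
    ∃ (c : lauRing r f) (dc : Fin m → ℤ) (bc : MvPolynomial (Fin 2) k),
      c ∈ hD.ker ∧ (c : Lau k m) = AddMonoidAlgebra.single dc bc ∧ bc ≠ 0 ∧
      ∀ (a : lauRing r f) (da : Fin m → ℤ) (ba : MvPolynomial (Fin 2) k),
        (a : Lau k m) = AddMonoidAlgebra.single da ba →
        ∃ (N M : ℕ) (α : ℕ → lauRing r f), c ^ N * a = ∑ j ∈ Finset.range M, α j * w ^ j ∧
          ∀ j, α j ∈ hD.ker ∧ (α j ≠ 0 → ∃ b, b ≠ 0 ∧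
            (α j : Lau k m) = AddMonoidAlgebra.single (da + N • dc - j • dw) b) := by
  have hw0 : w ≠ 0 := fun h => hwk (h ▸ zero_mem _)
  have hc := hhom _ _ (hD.deg w) (proj_single ω hw)
  have hc0 := hD.deg_ne_zero_of hw0
  obtain ⟨dc, bc, hbc, hcs, hdc⟩ := exists_single_of_proj hω hc hc0
  refine ⟨D (hD.deg w) w, dc, bc, hD.top_mem_ker le_rfl, hcs, hbc, fun a da ba ha => ?_⟩
  let 𝒢 : ℝ → Submodule k (lauRing r f) := fun s => LinearMap.eqLocus (proj r f ω s) LinearMap.id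
  have hG := isGrad_proj (r := r) (f := f) ω
  obtain ⟨N, M, α, h1, h2⟩ := hD.slice 𝒢 (ω₀ := ω₀) (t := ω dw) (w := w) (a := a) (s := ω da)
    hhom (proj_single ω hw) hwk hmin hG.one (fun s t a b ha hb => hG.mul s t a b ha hb)
    (proj_single ω ha)
  refine ⟨N, M, α, h2, fun j => ⟨(h1 j).1, fun h0 => ?_⟩⟩
  obtain ⟨d, b, hb, hs, hd⟩ := exists_single_of_proj hω (h1 j).2 h0
  refine ⟨b, hb, ?_⟩
  rw [hs]
  congr 1
  apply hω
  rw [hd, map_sub, map_add, map_nsmul, map_nsmul, hdc]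
  simp

end ExpLines

namespace ExpLines

variable {k : Type} [Field k] {m : ℕ} {r : Fin m → ℕ} {f : MvPolynomial (Fin 2) k}
  {ω : (Fin m → ℤ) →+ ℝ} {D : ℕ → lauRing r f →ₗ[k] lauRing r f}

/-- A variable which is not constant has the least possible positive degree. -/
theorem IsHD.deg_xLau_le (hr : ∀ i, 1 < r i) (hω : Function.Injective ω) (hD : IsHD k D) {ω₀ : ℝ}
    (hhom : ∀ s a (n : ℕ), proj r f ω s a = a → proj r f ω (s - n * ω₀) (D n a) = D n a)
    {i : Fin m} (hi : xLau r f i ∉ hD.ker) :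
    ∀ s a, proj r f ω s a = a → a ∉ hD.ker → hD.deg (xLau r f i) ≤ hD.deg a := by
  classical
  let T : Set ℕ := {n | ∃ s a, proj r f ω s a = a ∧ a ∉ hD.ker ∧ hD.deg a = n}
  have hT : T.Nonempty := ⟨_, _, _, proj_single ω (coe_xLau i), hi, rfl⟩
  obtain ⟨n, ⟨s, w, hws, hwk, rfl⟩, hmin⟩ := wellFounded_lt.has_min T hT
  have hmin' : ∀ s a, proj r f ω s a = a → a ∉ hD.ker → hD.deg w ≤ hD.deg a :=
    fun s a ha hak => not_lt.1 (hmin _ ⟨s, a, ha, hak, rfl⟩)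
  have hw0 : w ≠ 0 := fun h => hwk (h ▸ zero_mem _)
  obtain ⟨dw, bw, hbw, hw, -⟩ := exists_single_of_proj hω hws hw0
  obtain ⟨c, dc, bc, hck, hcs, hbc, hc⟩ := hD.slice_single hω hhom hw hwk hmin'
  obtain ⟨N, M, α, hα, hα'⟩ := hc _ _ _ (coe_xLau i)
  have hx0 : xLau r f i ≠ 0 := ne_zero_of_single (coe_xLau i) one_ne_zero
  have hc0 : c ^ N * xLau r f i ≠ 0 := mul_ne_zero (pow_ne_zero _ (ne_zero_of_single hcs hbc)) hx0
  rw [hα] at hc0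
  obtain ⟨j, -, hj⟩ := Finset.exists_ne_zero_of_sum_ne_zero hc0
  obtain ⟨b, hb, hs⟩ := (hα' j).2 (left_ne_zero_of_mul hj)
  obtain ⟨a₁, -, -, h1, -⟩ := hD.single_mem_ker hs hb (hα' j).1 hi
  obtain ⟨a₂, -, -, h2, -⟩ := hD.single_mem_ker hcs hbc hck hi
  obtain ⟨a₃, b', n, -, hn, hwe⟩ := exists_eq_monomial hw hbw
  have hni : n i ≠ 0 := by
    intro h0
    have h3 := hn i
    rw [h0] at h3
    simp only [Pi.sub_apply, Pi.add_apply, Pi.smul_apply, Pi.single_eq_same, h2] at h1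
    have hdw : dw i = -(a₃ * r i : ℤ) := by push_cast at h3; linarith
    rw [hdw] at h1
    have hdvd : (r i : ℤ) ∣ 1 := ⟨-a₁ + N * a₂ - j * a₃, by
      simp only [nsmul_eq_mul] at h1
      linear_combination h1⟩
    have := Int.eq_one_of_dvd_one (by positivity) hdvd
    have := hr i
    omega
  intro s a ha hak
  refine le_trans ?_ (hmin' s a ha hak)
  obtain ⟨q, hq⟩ : xLau r f i ∣ w := hwe ▸
    ((dvd_pow_self _ hni).trans (Finset.dvd_prod_of_mem
      (fun i => xLau r f i ^ n i) (Finset.mem_univ i))).mul_left _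
  rw [hq] at hw0 ⊢
  rw [hD.deg_mul (left_ne_zero_of_mul hw0) (right_ne_zero_of_mul hw0)]
  omega

theorem exists_generator_of_xLau_notMem {τ : MvPolynomial (Fin 2) k →ₐ[k] Polynomial k}
    (h : IsLineMap f τ) (hr : ∀ i, 1 < r i) (hω : Function.Injective ω) (hD : IsHD k D) {ω₀ : ℝ}
    (hhom : ∀ s a (n : ℕ), proj r f ω s a = a → proj r f ω (s - n * ω₀) (D n a) = D n a)
    {i : Fin m} (hi : xLau r f i ∉ hD.ker) : ∃ q, Algebra.adjoin k {f, q} = ⊤ := by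
  classical
  have hf0 := h.ne_zero
  have hri : 0 < r i := (zero_lt_one.trans (hr i))
  obtain ⟨c, dc, bc, hck, hcs, hbc, hc⟩ := hD.slice_single hω hhom (coe_xLau i) hi
    (hD.deg_xLau_le hr hω hhom hi)
  obtain ⟨a₂, c', hbc', hdc, hck'⟩ := hD.single_mem_ker hcs hbc hck hi
  let S : Subalgebra k (MvPolynomial (Fin 2) k) := hD.ker.comap (inclLau r f)
  refine h.exists_generator_of_factorial S ?_ ?_ ?_
  · intro a b hab h0
    refine hD.left_mem_ker_of_mul (a := inclLau r f a) (b := inclLau r f b) ?_ ?_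
    · rw [← map_mul]; exact hab
    · rw [← map_mul]; exact inclLau_ne_zero h0
  · intro hfS
    have h1 : inclLau r f f ∈ hD.ker := hfS
    have h2 : inclLau r f f ≠ 0 := inclLau_ne_zero hf0
    rw [← prod_xLau_mul_yLau] at h1 h2
    have h3 := hD.left_mem_ker_of_mul h1 h2
    have h4 := left_ne_zero_of_mul h2
    rw [← Finset.mul_prod_erase _ _ (Finset.mem_univ i), ← Nat.succ_pred_eq_of_pos hri,
      pow_succ', mul_assoc] at h3 h4
    exact hi (hD.left_mem_ker_of_mul h3 h4)
  · intro b
    obtain ⟨N, M, α, hα, hα'⟩ := hc _ _ _ (coe_inclLau b)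
    have hkey : ∀ j, ∃ p : Polynomial S,
        sumHom r f (α j) = f ^ (a₂ * N) * Polynomial.aeval f p := by
      intro j
      by_cases h0 : α j = 0
      · exact ⟨0, by simp [h0]⟩
      obtain ⟨b₁, hb₁, hs⟩ := (hα' j).2 h0
      obtain ⟨a₁, b', hb', hd, hbk⟩ := hD.single_mem_ker hs hb₁ (hα' j).1 hi
      simp only [Pi.sub_apply, Pi.add_apply, Pi.smul_apply, Pi.single_eq_same, hdc,
        Pi.zero_apply] at hd
      simp only [nsmul_eq_mul] at hd
      have hle : a₂ * N ≤ a₁ := by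
        have h1 : (r i : ℤ) * (a₂ * N) ≤ r i * a₁ := by
          have : (0 : ℤ) ≤ j := by positivity
          linarith
        exact_mod_cast le_of_mul_le_mul_left h1 (by exact_mod_cast hri)
      refine ⟨Polynomial.monomial (a₁ - a₂ * N) ⟨b', hbk⟩, ?_⟩
      rw [sumHom_of_single hs, hb', Polynomial.aeval_monomial]
      rw [← Nat.add_sub_cancel' hle, pow_add, Nat.add_sub_cancel' hle]
      change _ = _ * (b' * _)
      ring
    choose p hp using hkey
    have h1 := congrArg (sumHom r f) hα
    rw [map_mul, map_pow, map_sum, sumHom_of_single hcs, sumHom_inclLau, hbc'] at h1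
    simp only [map_mul, map_pow, sumHom_xLau, one_pow, mul_one, hp] at h1
    rw [← Finset.mul_sum, ← map_sum, mul_pow, ← pow_mul, mul_comm (c' ^ N), mul_assoc] at h1
    have h2 := mul_left_cancel₀ (pow_ne_zero _ hf0) h1
    refine ⟨c' ^ N, pow_mem (S := S) hck' N, pow_ne_zero _ ?_, ?_⟩
    · rintro rfl
      exact hbc (by rw [hbc', zero_mul])
    · rw [h2, Polynomial.aeval_eq_sum_range]
      exact ⟨_, fun i => ((∑ j ∈ Finset.range M, p j).coeff i : S), fun i => Subtype.prop _, rfl⟩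

end ExpLines

namespace ExpLines

variable {k : Type} [Field k] {m : ℕ} {r : Fin m → ℕ} {f : MvPolynomial (Fin 2) k}
  {ω : (Fin m → ℤ) →+ ℝ} {D : ℕ → lauRing r f →ₗ[k] lauRing r f}

theorem sumHom_map_inclLau_sumHom (hD : IsHD k D) (hx : ∀ i, xLau r f i ∈ hD.ker)
    (hy : yLau r f ∈ hD.ker) (n : ℕ) (p : lauRing r f) :
    sumHom r f (D n (inclLau r f (sumHom r f p))) = sumHom r f (D n p) := by
  refine lauRing_induction (P := fun p => sumHom r f (D n (inclLau r f (sumHom r f p))) =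
    sumHom r f (D n p)) (by simp) (fun a b ha hb => by simp only [map_add, ha, hb]) ?_ p
  intro p d b hb hp
  obtain ⟨j, b', e, hb', -, rfl⟩ := exists_eq_monomial hp hb
  rw [sumHom_of_single hp, hb', map_mul, map_pow, ← prod_xLau_mul_yLau, mul_comm (inclLau r f b'),
    hD.map_mul_left (pow_mem (mul_mem (prod_mem fun i _ => pow_mem (hx i) _) hy) j),
    mul_assoc (inclLau r f b'), mul_comm (inclLau r f b'),
    hD.map_mul_left (mul_mem (pow_mem hy j) (prod_mem fun i _ => pow_mem (hx i) _))]
  simp [map_mul, map_pow, map_prod]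

theorem exists_generator_of_xLau_mem {τ : MvPolynomial (Fin 2) k →ₐ[k] Polynomial k}
    (h : IsLineMap f τ) (hω : Function.Injective ω) (hD : IsHD k D)
    (hnt : hD.ker ≠ ⊤) {ω₀ : ℝ}
    (hhom : ∀ s a (n : ℕ), proj r f ω s a = a → proj r f ω (s - n * ω₀) (D n a) = D n a)
    (hx : ∀ i, xLau r f i ∈ hD.ker) (hy : yLau r f ∈ hD.ker) :
    ∃ q, Algebra.adjoin k {f, q} = ⊤ := by
  let ψ : ℕ → MvPolynomial (Fin 2) k →ₗ[k] MvPolynomial (Fin 2) k := fun n =>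
    (sumHom r f).toLinearMap ∘ₗ D n ∘ₗ (inclLau r f).toLinearMap
  have hψ' : ∀ n b, ψ n b = sumHom r f (D n (inclLau r f b)) := fun _ _ => rfl
  have hψ : IsHD k ψ :=
    { zero := fun a => by rw [hψ', hD.zero, sumHom_inclLau]
      one := fun n hn => by rw [hψ', map_one, hD.one n hn, map_zero]
      leib := fun n a b => by simp only [hψ', map_mul, hD.leib, map_sum]
      fin := fun a => by
        obtain ⟨N, hN⟩ := hD.fin (inclLau r f a)
        exact ⟨N, fun n hn => by rw [hψ', hN n hn, map_zero]⟩
      iter := fun i j a => by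
        simp only [hψ']
        rw [sumHom_map_inclLau_sumHom hD hx hy, hD.iter, map_nsmul] }
  refine h.exists_generator_of_const hψ ?_ ?_
  · intro htop
    apply hnt
    have hι : ∀ b, inclLau r f b ∈ hD.ker := by
      intro b n hn
      have h1 : b ∈ hψ.ker := htop ▸ Algebra.mem_top
      have h2 : sumHom r f (D n (inclLau r f b)) = 0 := h1 n hn
      by_contra h0
      obtain ⟨d, b', hb', hs, -⟩ := exists_single_of_proj hω
        (hhom _ _ n (proj_single ω (coe_inclLau b))) h0
      rw [sumHom_of_single hs] at h2
      exact hb' h2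
    exact adjoin_eq_top_of_generators hx hy (hι _) (hι _)
  · intro n hn
    rw [hψ', ← prod_xLau_mul_yLau,
      (mul_mem (prod_mem fun i _ => pow_mem (hx i) _) hy : _ ∈ hD.ker) n hn, map_zero]

theorem exists_leading (ω : (Fin m → ℤ) →+ ℝ) {a : lauRing r f} {d : Fin m → ℤ}
    (hd : (a : Lau k m).coeff d ≠ 0) :
    ∃ M, ω d ≤ M ∧ a ∈ IsGrad.le (proj r f ω) M ∧ proj r f ω M a ≠ 0 := by
  obtain ⟨e, he, hmax⟩ := Finset.exists_max_image (a : Lau k m).coeff.support ω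
    ⟨d, Finsupp.mem_support_iff.2 hd⟩
  refine ⟨ω e, hmax d (Finsupp.mem_support_iff.2 hd), ?_, ?_⟩
  · intro s hs
    refine lauRing_ext fun c => ?_
    rw [coeff_proj]
    split_ifs with hc
    · by_contra hne
      have := hmax c (Finsupp.mem_support_iff.2 hne)
      linarith
    · rfl
  · intro h0
    have := coeff_proj ω (ω e) a e
    rw [h0, if_pos rfl] at this
    exact Finsupp.mem_support_iff.1 he this.symm

/-- The constants of a nontrivial higher derivation only involve nonnegative powers of `x`. -/
theorem nonneg_of_mem_ker {τ : MvPolynomial (Fin 2) k →ₐ[k] Polynomial k}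
    (h : IsLineMap f τ) (hq : ¬ ∃ q, Algebra.adjoin k {f, q} = ⊤) (hr : ∀ i, 1 < r i)
    (hD : IsHD k D) (hnt : hD.ker ≠ ⊤) {a : lauRing r f} (ha : a ∈ hD.ker)
    {d : Fin m → ℤ} (hd : (a : Lau k m).coeff d ≠ 0) : 0 ≤ d := by
  intro i
  by_contra! hi
  let ω₁ : (Fin m → ℤ) →+ ℝ :=
    { toFun := fun d => -(d i : ℝ), map_zero' := by simp, map_add' := fun d e => by simp; ring }
  obtain ⟨M, hM, haM, ha0⟩ := exists_leading ω₁ hd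
  obtain ⟨-, D₁, hD₁, hnt₁, -, hk₁⟩ := homogenize_lauRing ω₁ hD hnt
  have hM0 : 0 < M := lt_of_lt_of_le
    (show (0 : ℝ) < -(d i : ℝ) from neg_pos.2 (by exact_mod_cast hi)) hM
  obtain ⟨d₁, hd₁⟩ : ∃ d₁, (proj r f ω₁ M a : Lau k m).coeff d₁ ≠ 0 := by
    by_contra! hc
    exact ha0 (lauRing_ext hc)
  obtain ⟨ω, hω⟩ := exists_injective_weight m
  obtain ⟨M₂, -, haM₂, ha₂⟩ := exists_leading ω hd₁
  obtain ⟨w, D₂, hD₂, hnt₂, hhom, hk₂⟩ := homogenize_lauRing ω hD₁ hnt₁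
  have hk := hk₂ _ _ (hk₁ _ _ ha haM) haM₂
  obtain ⟨e, b, hb, hs, -⟩ := exists_single_of_proj hω ((isGrad_proj ω).idem _ _) ha₂
  have he : (proj r f ω₁ M a : Lau k m).coeff e ≠ 0 := by
    intro h0
    have := coeff_proj ω M₂ (proj r f ω₁ M a) e
    rw [h0, ite_self, hs, AddMonoidAlgebra.coeff_single, Finsupp.single_eq_same] at this
    exact hb this
  have hei : -(e i : ℝ) = M := proj_eq_self_iff.1 ((isGrad_proj ω₁).idem M a) e he
  have hei' : e i < 0 := by
    have : (e i : ℝ) < 0 := by linarith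
    exact_mod_cast this
  obtain ⟨j, b', n, -, hn, hpe⟩ := exists_eq_monomial hs hb
  have hj : j ≠ 0 := by
    rintro rfl
    have := hn i
    push_cast at this
    omega
  obtain ⟨p, hp⟩ : yLau r f ∣ proj r f ω M₂ (proj r f ω₁ M a) := hpe ▸
    (((dvd_pow_self _ hj).mul_left _).mul_right _)
  have hy : yLau r f ∈ hD₂.ker := by
    rw [hp] at hk ha₂
    exact hD₂.left_mem_ker_of_mul hk ha₂
  by_cases hx : ∀ i, xLau r f i ∈ hD₂.ker
  · exact hq (exists_generator_of_xLau_mem h hω hD₂ hnt₂ hhom hx hy)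
  · push Not at hx
    obtain ⟨l, hl⟩ := hx
    exact hq (exists_generator_of_xLau_notMem h hr hω hD₂ hhom hl)

end ExpLines

namespace ExpLines

variable {k : Type} [Field k] {m : ℕ} {r : Fin m → ℕ} {f : MvPolynomial (Fin 2) k}

theorem isHD_hasseDeriv (k : Type*) {R : Type*} [Field k] [CommRing R] [Algebra k R] :
    IsHD k (fun n => (Polynomial.hasseDeriv (R := R) n).restrictScalars k) where
  zero a := by simp
  one n hn := by
    rw [LinearMap.restrictScalars_apply, ← Polynomial.C_1, Polynomial.hasseDeriv_C _ _ hn]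
  leib n a b := by simp [Polynomial.hasseDeriv_mul]
  fin a := ⟨a.natDegree, fun n hn => Polynomial.hasseDeriv_eq_zero_of_lt_natDegree a n hn⟩
  iter i j a := by
    have := congrArg (fun L => L a) (Polynomial.hasseDeriv_comp (R := R) i j)
    simpa using this

theorem exists_isHD_mvPolynomial (k : Type) [Field k] (c : Fin 2) :
    ∃ (D : ℕ → MvPolynomial (Fin 2) k →ₗ[k] MvPolynomial (Fin 2) k) (hD : IsHD k D),
      hD.ker ≠ ⊤ ∧ X c ∈ hD.ker := by
  let e₁ := (finSuccEquiv k 1).symm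
  let e₂ : MvPolynomial (Fin 2) k ≃ₐ[k] MvPolynomial (Fin 2) k :=
    renameEquiv k (Equiv.swap 1 c)
  have h := isHD_hasseDeriv k (R := MvPolynomial (Fin 1) k)
  have hX : e₂ (e₁ (Polynomial.C (X 0))) = X c := by
    have : e₁ (Polynomial.C (X 0)) = X 1 := by
      rw [AlgEquiv.symm_apply_eq]
      exact (finSuccEquiv_X_succ (R := k) (n := 1) (j := 0)).symm
    rw [this]
    simp [e₂]
  refine ⟨_, (h.conj e₁).conj e₂, ?_, ?_⟩
  · intro htop
    have h1 : e₂ (e₁ Polynomial.X) ∈ ((h.conj e₁).conj e₂).ker := htop ▸ Algebra.mem_top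
    rw [(h.conj e₁).conj_mem_ker e₂, h.conj_mem_ker e₁] at h1
    have h2 := h1 1 le_rfl
    simp at h2
  · rw [← hX, (h.conj e₁).conj_mem_ker e₂, h.conj_mem_ker e₁]
    intro n hn
    rw [LinearMap.restrictScalars_apply, Polynomial.hasseDeriv_C _ _ hn]

theorem IsHD.restrict {A : Type*} [CommRing A] [Algebra k A] {D : ℕ → A →ₗ[k] A} (hD : IsHD k D)
    (S : Subalgebra k A) (hS : ∀ n, ∀ a ∈ S, D n a ∈ S) :
    IsHD (A := S) k (fun n => (D n).restrict (p := Subalgebra.toSubmodule S)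
      (q := Subalgebra.toSubmodule S) (hS n)) where
  zero a := Subtype.ext (hD.zero a)
  one n hn := Subtype.ext (hD.one n hn)
  leib n a b := by
    apply Subtype.ext
    rw [AddSubmonoidClass.coe_finsetSum]
    exact hD.leib n a b
  fin a := by
    obtain ⟨N, hN⟩ := hD.fin a
    exact ⟨N, fun n hn => Subtype.ext (hN n hn)⟩
  iter i j a := Subtype.ext (hD.iter i j a)

theorem IsHD.pow_dvd {A : Type*} [CommRing A] [Algebra k A] {D : ℕ → A →ₗ[k] A} (hD : IsHD k D)
    (a c : A) (n j : ℕ) : a ^ (j - n) ∣ D n (a ^ j * c) := by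
  induction j generalizing n with
  | zero => simp
  | succ j ih =>
    rw [pow_succ', mul_assoc, hD.leib]
    refine Finset.dvd_sum fun p hp => ?_
    rw [Finset.HasAntidiagonal.mem_antidiagonal] at hp
    rcases Nat.eq_zero_or_pos p.1 with h0 | h0
    · rw [h0, hD.zero]
      refine (pow_dvd_pow a (show j + 1 - n ≤ (j - p.2) + 1 by omega)).trans ?_
      rw [pow_succ']
      exact mul_dvd_mul_left _ (ih _)
    · exact ((pow_dvd_pow a (by omega)).trans (ih p.2)).mul_left _

/-- The extension of a higher derivation of `k[Z,T]` to Laurent polynomials, twisted by `x ^ r`. -/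
def twist (r : Fin m → ℕ) (D : ℕ → MvPolynomial (Fin 2) k →ₗ[k] MvPolynomial (Fin 2) k) (n : ℕ) :
    Lau k m →ₗ[k] Lau k m where
  toFun p := AddMonoidAlgebra.single (fun i => (n * r i : ℤ)) 1 *
    .ofCoeff (p.coeff.mapRange (D n) (map_zero _))
  map_add' p q := by
    rw [← mul_add, AddMonoidAlgebra.coeff_add, Finsupp.mapRange_add (map_add _),
      AddMonoidAlgebra.ofCoeff_add]
  map_smul' c p := by
    rw [RingHom.id_apply, AddMonoidAlgebra.coeff_smul,
      Finsupp.mapRange_smul _ _ (fun x => (D n).map_smul c x), AddMonoidAlgebra.ofCoeff_smul,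
      mul_smul_comm]

theorem twist_single (D : ℕ → MvPolynomial (Fin 2) k →ₗ[k] MvPolynomial (Fin 2) k) (n : ℕ)
    (d : Fin m → ℤ) (b : MvPolynomial (Fin 2) k) :
    twist r D n (AddMonoidAlgebra.single d b) =
      AddMonoidAlgebra.single (fun i => (n * r i : ℤ) + d i) (D n b) := by
  change AddMonoidAlgebra.single (fun i => (n * r i : ℤ)) 1 *
    .ofCoeff (Finsupp.mapRange (D n) (map_zero _) (Finsupp.single d b)) = _
  rw [Finsupp.mapRange_single, AddMonoidAlgebra.ofCoeff_single,
    AddMonoidAlgebra.single_mul_single, one_mul]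
  rfl

theorem isHD_twist (r : Fin m → ℕ) {D : ℕ → MvPolynomial (Fin 2) k →ₗ[k] MvPolynomial (Fin 2) k}
    (hD : IsHD k D) : IsHD k (twist r D) where
  zero a := by
    induction a using AddMonoidAlgebra.induction_linear with
    | zero => simp
    | add a b ha hb => rw [map_add, ha, hb]
    | single d b => rw [twist_single, hD.zero]; simp
  one n hn := by
    rw [AddMonoidAlgebra.one_def, twist_single, hD.one n hn, AddMonoidAlgebra.single_zero]
  leib n a b := by
    induction a using AddMonoidAlgebra.induction_linear with
    | zero => simp
    | add a a' ha ha' => simp only [add_mul, map_add, ha, ha', Finset.sum_add_distrib]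
    | single d c =>
      induction b using AddMonoidAlgebra.induction_linear with
      | zero => simp
      | add a a' ha ha' => simp only [mul_add, map_add, ha, ha', Finset.sum_add_distrib]
      | single e c' =>
        rw [AddMonoidAlgebra.single_mul_single, twist_single, hD.leib,
          ← AddMonoidAlgebra.singleAddHom_apply, map_sum]
        refine Finset.sum_congr rfl fun p hp => ?_
        rw [Finset.HasAntidiagonal.mem_antidiagonal] at hp
        rw [AddMonoidAlgebra.singleAddHom_apply, twist_single, twist_single,
          AddMonoidAlgebra.single_mul_single, ← hp]
        congr 1
        ext i
        simp
        ring
  fin a := by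
    induction a using AddMonoidAlgebra.induction_linear with
    | zero => exact ⟨0, fun n _ => map_zero _⟩
    | add a b ha hb =>
      obtain ⟨N, hN⟩ := ha
      obtain ⟨M, hM⟩ := hb
      exact ⟨max N M, fun n hn => by
        rw [map_add, hN n (by omega), hM n (by omega), add_zero]⟩
    | single d b =>
      obtain ⟨N, hN⟩ := hD.fin b
      exact ⟨N, fun n hn => by rw [twist_single, hN n hn, AddMonoidAlgebra.single_zero]⟩
  iter i j a := by
    induction a using AddMonoidAlgebra.induction_linear with
    | zero => simp
    | add a b ha hb => simp only [map_add, ha, hb, smul_add]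
    | single d b =>
      rw [twist_single, twist_single, twist_single, hD.iter, AddMonoidAlgebra.smul_single]
      congr 1
      ext l
      push_cast
      ring

theorem twist_mem_lauRing {D : ℕ → MvPolynomial (Fin 2) k →ₗ[k] MvPolynomial (Fin 2) k}
    (hD : IsHD k D) (n : ℕ) (a : Lau k m) (ha : a ∈ lauRing r f) :
    twist r D n a ∈ lauRing r f := by
  suffices h : ∀ p : lauRing r f, twist r D n (p : Lau k m) ∈ lauRing r f from h ⟨a, ha⟩
  refine lauRing_induction ?_ ?_ ?_
  · rw [ZeroMemClass.coe_zero, map_zero]; exact zero_mem _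
  · intro a b ha hb
    rw [AddMemClass.coe_add, map_add]
    exact add_mem ha hb
  · intro p d b hb hp
    have h := p.2 d
    rw [hp, AddMonoidAlgebra.coeff_single, Finsupp.single_eq_same] at h
    obtain ⟨j, ⟨c, rfl⟩, hj⟩ := h.resolve_left hb
    rw [hp, twist_single]
    refine single_mem_lauRing (Or.inr ⟨j - n, hD.pow_dvd f c n j, fun i => ?_⟩)
    have h1 := hj i
    have h2 : (j : ℤ) ≤ (n : ℤ) + ((j - n : ℕ) : ℤ) := by omega
    have h3 := mul_le_mul_of_nonneg_right h2 (Int.natCast_nonneg (r i))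
    linarith

theorem exists_isHD_lauRing (r : Fin m → ℕ) (f : MvPolynomial (Fin 2) k) (c : Fin 2) :
    ∃ (D : ℕ → lauRing r f →ₗ[k] lauRing r f) (hD : IsHD k D),
      hD.ker ≠ ⊤ ∧ (∀ i, xLau r f i ∈ hD.ker) ∧ inclLau r f (X c) ∈ hD.ker := by
  obtain ⟨D, hD, hnt, hc⟩ := exists_isHD_mvPolynomial k c
  refine ⟨_, (isHD_twist r hD).restrict (lauRing r f) (twist_mem_lauRing hD), ?_, ?_, ?_⟩
  · obtain ⟨n, a, hn, ha⟩ := hD.ne_bot_iff.1 hnt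
    refine (IsHD.ne_bot_iff _).2 ⟨n, inclLau r f a, hn, fun h0 => ?_⟩
    have h1 : twist r D n (AddMonoidAlgebra.single 0 a) = 0 := congrArg Subtype.val h0
    rw [twist_single, AddMonoidAlgebra.single_eq_zero] at h1
    exact ha h1
  · intro i n hn
    apply Subtype.ext
    change twist r D n (AddMonoidAlgebra.single _ 1) = 0
    rw [twist_single, hD.one n hn, AddMonoidAlgebra.single_zero]
  · intro n hn
    apply Subtype.ext
    change twist r D n (AddMonoidAlgebra.single _ (X c)) = 0
    rw [twist_single, hc n hn, AddMonoidAlgebra.single_zero]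

end ExpLines

namespace ExpLines

variable {k : Type} [Field k] {m : ℕ} {r s : Fin m → ℕ} {f g : MvPolynomial (Fin 2) k}

variable (k m) in
/-- The ring `k[Z,T][x]`. -/
abbrev PolyX : Type := MvPolynomial (Fin m) (MvPolynomial (Fin 2) k)

/-- The inclusion of exponents of polynomials into exponents of Laurent polynomials. -/
def castExp (m : ℕ) : (Fin m →₀ ℕ) →+ (Fin m → ℤ) where
  toFun n i := n i
  map_zero' := by ext; simp
  map_add' a b := by ext; simp

theorem castExp_apply (n : Fin m →₀ ℕ) (i : Fin m) : castExp m n i = n i := rfl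

theorem castExp_injective : Function.Injective (castExp m) := fun a b h => by
  ext i
  have := congrFun h i
  rwa [castExp_apply, castExp_apply, Nat.cast_inj] at this

variable (k m) in
/-- The inclusion of polynomials into Laurent polynomials. -/
def polyToLau : PolyX k m →ₐ[k] Lau k m :=
  AddMonoidAlgebra.mapDomainAlgHom k (MvPolynomial (Fin 2) k) (castExp m)

theorem polyToLau_monomial (n : Fin m →₀ ℕ) (b : MvPolynomial (Fin 2) k) :
    polyToLau k m (monomial n b) = AddMonoidAlgebra.single (castExp m n) b :=
  AddMonoidAlgebra.mapDomain_single

theorem polyToLau_injective : Function.Injective (polyToLau k m) :=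
  AddMonoidAlgebra.mapDomain_injective castExp_injective

theorem coeff_polyToLau (p : PolyX k m) (n : Fin m →₀ ℕ) :
    (polyToLau k m p).coeff (castExp m n) = coeff n p :=
  Finsupp.mapDomain_apply castExp_injective _ _

theorem nonneg_of_coeff_polyToLau {p : PolyX k m} {d : Fin m → ℤ}
    (hd : (polyToLau k m p).coeff d ≠ 0) : 0 ≤ d := by
  by_contra h
  refine hd (Finsupp.mapDomain_of_notMem_range (f := castExp m) _ _ ?_)
  rintro ⟨n, rfl⟩
  exact h fun i => by simp [castExp_apply]

theorem single_mem_range_polyToLau {d : Fin m → ℤ} (hd : 0 ≤ d) (b : MvPolynomial (Fin 2) k) :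
    AddMonoidAlgebra.single d b ∈ (polyToLau k m).range := by
  refine ⟨monomial (Finsupp.equivFunOnFinite.symm fun i => (d i).toNat) b, ?_⟩
  change polyToLau k m _ = _
  rw [polyToLau_monomial]
  congr 1
  ext i
  simp [castExp_apply, Int.toNat_of_nonneg (hd i)]

theorem mem_range_polyToLau {p : Lau k m} (hp : ∀ d, p.coeff d ≠ 0 → 0 ≤ d) :
    p ∈ (polyToLau k m).range := by
  have h : p = ∑ d ∈ p.coeff.support, AddMonoidAlgebra.single d (p.coeff d) := by
    apply AddMonoidAlgebra.coeff_injective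
    rw [AddMonoidAlgebra.coeff_sum]
    exact p.coeff.sum_single.symm
  rw [h]
  exact sum_mem fun d hd => single_mem_range_polyToLau (hp d (Finsupp.mem_support_iff.1 hd)) _

theorem exists_prod_X_pow_mul (p : Lau k m) :
    ∃ (N : ℕ) (w : PolyX k m), polyToLau k m ((∏ i, X i) ^ N) * p = polyToLau k m w := by
  induction p using AddMonoidAlgebra.induction_linear with
  | zero => exact ⟨0, 0, by simp⟩
  | add p q hp hq =>
    obtain ⟨N, w, hw⟩ := hp
    obtain ⟨M, z, hz⟩ := hq
    refine ⟨N + M, (∏ i, X i) ^ M * w + (∏ i, X i) ^ N * z, ?_⟩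
    simp only [pow_add, map_add, map_mul, ← hw, ← hz]
    ring
  | single d b =>
    refine ⟨∑ i, (d i).natAbs, ?_⟩
    have h : ((∏ i, X i) ^ (∑ i, (d i).natAbs) : PolyX k m) =
        monomial ((∑ i, (d i).natAbs) • Finsupp.equivFunOnFinite.symm fun _ => 1) 1 := by
      rw [← one_pow (M := MvPolynomial (Fin 2) k) (∑ i, (d i).natAbs), ← monomial_pow]
      congr 1
      rw [monomial_eq, Finsupp.prod_fintype _ _ (by simp)]
      simp
    rw [h, polyToLau_monomial, AddMonoidAlgebra.single_mul_single]
    obtain ⟨w, hw⟩ := single_mem_range_polyToLau (d := castExp m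
      ((∑ i, (d i).natAbs) • Finsupp.equivFunOnFinite.symm fun _ => 1) + d) (fun i => by
        have := Finset.single_le_sum (f := fun i => (d i).natAbs) (fun _ _ => Nat.zero_le _)
          (Finset.mem_univ i)
        simp only [Pi.zero_apply, Pi.add_apply, castExp_apply, Finsupp.smul_apply,
          Finsupp.equivFunOnFinite_symm_apply_apply, smul_eq_mul, mul_one]
        omega) (1 * b)
    exact ⟨w, hw.symm⟩

variable (r f) in
/-- The inclusion of `k[Z,T][x]`. -/
def inclPoly : PolyX k m →ₐ[k] lauRing r f :=
  (polyToLau k m).codRestrict _ fun p d => by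
    by_cases hd : (polyToLau k m p).coeff d = 0
    · rw [hd]; exact zero_mem _
    · exact mem_layer_of_nonneg (nonneg_of_coeff_polyToLau hd) _

theorem coe_inclPoly (p : PolyX k m) : (inclPoly r f p : Lau k m) = polyToLau k m p := rfl

theorem inclPoly_injective : Function.Injective (inclPoly (m := m) r f) := fun _ _ h =>
  polyToLau_injective (congrArg Subtype.val h)

theorem inclPoly_C (b : MvPolynomial (Fin 2) k) : inclPoly r f (C b) = inclLau r f b :=
  Subtype.ext (by
    rw [coe_inclPoly, C_apply, polyToLau_monomial, map_zero]; rfl)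

theorem inclPoly_X (i : Fin m) : inclPoly r f (X i) = xLau r f i :=
  Subtype.ext (by
    rw [coe_inclPoly, X, polyToLau_monomial, coe_xLau]
    congr 1
    ext j
    simp [castExp_apply, Finsupp.single_apply, Pi.single_apply, eq_comm])

end ExpLines

namespace ExpLines

variable {k : Type} [Field k] {m : ℕ} {r s : Fin m → ℕ} {f g : MvPolynomial (Fin 2) k}

theorem IsHD.conj_ker_ne_top {A B : Type*} [CommRing A] [CommRing B] [Algebra k A] [Algebra k B]
    {D : ℕ → A →ₗ[k] A} (hD : IsHD k D) (e : A ≃ₐ[k] B) (h : hD.ker ≠ ⊤) : (hD.conj e).ker ≠ ⊤ :=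
  fun htop => h <| Algebra.eq_top_iff.2 fun b => by
    rw [← hD.conj_mem_ker e, htop]
    exact Algebra.mem_top

theorem inclPoly_mem_range_of_generators (θ : lauRing r f →ₐ[k] lauRing s g)
    (hx : ∀ i, θ (xLau r f i) ∈ (inclPoly s g).range)
    (hc : ∀ c, θ (inclLau r f (X c)) ∈ (inclPoly s g).range) (p : PolyX k m) :
    θ (inclPoly r f p) ∈ (inclPoly s g).range := by
  induction p using MvPolynomial.induction_on with
  | C b =>
    rw [inclPoly_C]
    induction b using MvPolynomial.induction_on with
    | C c =>
      have : θ (inclLau r f (C c)) = algebraMap k _ c := by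
        rw [← algebraMap_eq, AlgHom.commutes, AlgHom.commutes]
      rw [this]
      exact algebraMap_mem _ _
    | add p q hp hq => rw [map_add, map_add]; exact add_mem hp hq
    | mul_X p i hp => rw [map_mul, map_mul]; exact mul_mem hp (hc i)
  | add p q hp hq => rw [map_add, map_add]; exact add_mem hp hq
  | mul_X p i hp => rw [map_mul, map_mul, inclPoly_X]; exact mul_mem hp (hx i)

/-- Every isomorphism maps the ring of polynomials to itself. -/
theorem map_inclPoly_mem_range {τ : MvPolynomial (Fin 2) k →ₐ[k] Polynomial k}
    (h : IsLineMap g τ) (hq : ¬ ∃ q, Algebra.adjoin k {g, q} = ⊤) (hs : ∀ i, 1 < s i)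
    (θ : lauRing r f ≃ₐ[k] lauRing s g) (p : PolyX k m) :
    θ (inclPoly r f p) ∈ (inclPoly s g).range := by
  have key : ∀ (D : ℕ → lauRing r f →ₗ[k] lauRing r f) (hD : IsHD k D), hD.ker ≠ ⊤ →
      ∀ a ∈ hD.ker, θ a ∈ (inclPoly s g).range := by
    intro D hD hnt a ha
    have ha' : θ a ∈ (hD.conj (B := lauRing s g) θ).ker :=
      (hD.conj_mem_ker (B := lauRing s g) θ).2 ha
    obtain ⟨w, hw⟩ := mem_range_polyToLau (p := (θ a : Lau k m)) fun d hd =>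
      nonneg_of_mem_ker h hq hs (hD.conj (B := lauRing s g) θ)
        (hD.conj_ker_ne_top (B := lauRing s g) θ hnt) ha' hd
    exact ⟨w, Subtype.ext hw⟩
  refine inclPoly_mem_range_of_generators (θ : lauRing r f →ₐ[k] lauRing s g)
    (fun i => ?_) (fun c => ?_) p
  · obtain ⟨D, hD, hnt, hx, -⟩ := exists_isHD_lauRing r f 0
    exact key D hD hnt _ (hx i)
  · obtain ⟨D, hD, hnt, -, hc⟩ := exists_isHD_lauRing r f c
    exact key D hD hnt _ hc

theorem exists_algHom_of_mem_range {A B C : Type*} [Semiring A] [Semiring B] [Semiring C]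
    [Algebra k A] [Algebra k B] [Algebra k C] (j : B →ₐ[k] C) (hj : Function.Injective j)
    (θ : A →ₐ[k] C) (h : ∀ a, θ a ∈ j.range) : ∃ φ : A →ₐ[k] B, ∀ a, θ a = j (φ a) := by
  refine ⟨(AlgEquiv.ofInjective j hj).symm.toAlgHom.comp (θ.codRestrict j.range h), fun a => ?_⟩
  exact (congrArg Subtype.val ((AlgEquiv.ofInjective j hj).apply_symm_apply
    (θ.codRestrict j.range h a))).symm

theorem exists_algEquiv_of_mem_range {A B C : Type*} [Semiring A] [Semiring B] [Semiring C]
    [Algebra k A] [Algebra k B] [Algebra k C] (i : B →ₐ[k] A) (hi : Function.Injective i)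
    (j : B →ₐ[k] C) (hj : Function.Injective j) (θ : A ≃ₐ[k] C) (h : ∀ b, θ (i b) ∈ j.range)
    (h' : ∀ b, θ.symm (j b) ∈ i.range) : ∃ φ : B ≃ₐ[k] B, ∀ b, θ (i b) = j (φ b) := by
  obtain ⟨φ, hφ⟩ := exists_algHom_of_mem_range j hj ((θ : A →ₐ[k] C).comp i) h
  obtain ⟨ψ, hψ⟩ := exists_algHom_of_mem_range i hi ((θ.symm : C →ₐ[k] A).comp j) h'
  have hφ' (p) : θ (i p) = j (φ p) := hφ p
  have hψ' (p) : θ.symm (j p) = i (ψ p) := hψ p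
  refine ⟨AlgEquiv.ofAlgHom φ ψ (AlgHom.ext fun p => hj ?_) (AlgHom.ext fun p => hi ?_), hφ'⟩
  · rw [AlgHom.comp_apply, ← hφ', ← hψ', AlgEquiv.apply_symm_apply, AlgHom.id_apply]
  · rw [AlgHom.comp_apply, ← hψ', ← hφ', AlgEquiv.symm_apply_apply, AlgHom.id_apply]

/-- Every isomorphism restricts to an automorphism of the ring of polynomials. -/
theorem exists_polyX_algEquiv {τ τ' : MvPolynomial (Fin 2) k →ₐ[k] Polynomial k}
    (hf : IsLineMap f τ) (hqf : ¬ ∃ q, Algebra.adjoin k {f, q} = ⊤) (hr : ∀ i, 1 < r i)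
    (hg : IsLineMap g τ') (hqg : ¬ ∃ q, Algebra.adjoin k {g, q} = ⊤) (hs : ∀ i, 1 < s i)
    (θ : lauRing r f ≃ₐ[k] lauRing s g) :
    ∃ φ : PolyX k m ≃ₐ[k] PolyX k m, ∀ p, θ (inclPoly r f p) = inclPoly s g (φ p) :=
  exists_algEquiv_of_mem_range (inclPoly r f) inclPoly_injective (inclPoly s g)
    inclPoly_injective θ (map_inclPoly_mem_range hg hqg hs θ)
    (map_inclPoly_mem_range hf hqf hr θ.symm)

variable {θ : lauRing r f ≃ₐ[k] lauRing s g} {φ : PolyX k m ≃ₐ[k] PolyX k m}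

theorem exists_associated_X (hr : ∀ i, 1 < r i) (hf : f ≠ 0)
    (hφ : ∀ p, θ (inclPoly r f p) = inclPoly s g (φ p)) (i : Fin m) :
    ∃ l, Associated (φ (X i)) (X l) := by
  have hu : Prime (φ (X i)) := (MulEquiv.prime_iff φ.toMulEquiv).2 (X_prime (i := i))
  let a : lauRing r f := ⟨AddMonoidAlgebra.single (-Pi.single i 1) f, single_mem_lauRing
    (Or.inr ⟨1, by simp, fun l => by
      have := hr l
      rw [Pi.neg_apply, Pi.single_apply]
      split_ifs <;> push_cast <;> omega⟩)⟩
  have ha : xLau r f i * a = inclLau r f f := Subtype.ext <| by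
    rw [Subalgebra.coe_mul, coe_xLau, AddMonoidAlgebra.single_mul_single, coe_inclLau,
      add_neg_cancel, one_mul]
  have hθa : θ a ∉ (inclPoly s g).range := by
    rintro ⟨w, hw⟩
    have h1 : inclPoly r f (φ.symm w) = a := θ.injective <| by
      rw [hφ, AlgEquiv.apply_symm_apply]; exact hw
    have h2 : (polyToLau k m (φ.symm w)).coeff (-Pi.single i 1) ≠ 0 := by
      rw [← coe_inclPoly (r := r) (f := f), h1, AddMonoidAlgebra.coeff_single,
        Finsupp.single_eq_same]
      exact hf
    have := nonneg_of_coeff_polyToLau h2 i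
    simp at this
  obtain ⟨N, w, hw⟩ := exists_prod_X_pow_mul (θ a : Lau k m)
  have hw' : inclPoly s g ((∏ i, X i) ^ N) * θ a = inclPoly s g w := Subtype.ext hw
  have hv : inclPoly s g (φ (X i)) * θ a = inclPoly s g (φ (C f)) := by
    rw [← hφ, ← hφ, inclPoly_X, inclPoly_C, ← ha, map_mul]
  have hdvd : φ (X i) * w = (∏ i, X i) ^ N * φ (C f) := by
    apply inclPoly_injective (r := s) (f := g)
    rw [map_mul, map_mul, ← hw', ← hv]
    ring
  rcases hu.dvd_or_dvd (Dvd.intro _ hdvd) with h | h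
  · obtain ⟨l, -, hl⟩ := hu.exists_mem_finset_dvd (hu.dvd_of_dvd_pow h)
    exact ⟨l, hu.associated_of_dvd X_prime hl⟩
  · obtain ⟨c, hc⟩ := h
    refine absurd ⟨c, ?_⟩ hθa
    have h0 : inclPoly s g (φ (X i)) ≠ 0 := fun h => hu.ne_zero
      (inclPoly_injective (h.trans (map_zero _).symm))
    apply mul_left_cancel₀ h0
    rw [hv, hc, map_mul]
    rfl

variable (k m) in
/-- Evaluation at `x = 0`. -/
def evalZero : PolyX k m →ₐ[k] MvPolynomial (Fin 2) k :=
  (aeval (R := MvPolynomial (Fin 2) k) 0).restrictScalars k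

@[simp] theorem evalZero_X (i : Fin m) : evalZero k m (X i) = 0 := by simp [evalZero]

@[simp] theorem evalZero_C (b : MvPolynomial (Fin 2) k) : evalZero k m (C b) = b := by
  simp [evalZero]

theorem evalZero_eq_coeff (p : PolyX k m) : evalZero k m p = coeff 0 p := by
  rw [← constantCoeff_eq]
  simp [evalZero, constantCoeff_eq]

theorem evalZero_eq_zero_of_associated {p : PolyX k m} {l : Fin m} (h : Associated p (X l)) :
    evalZero k m p = 0 := by
  have := h.map (evalZero k m)
  rwa [evalZero_X, associated_zero_iff_eq_zero] at this

theorem evalZero_map_C_evalZero {φ : PolyX k m ≃ₐ[k] PolyX k m}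
    (hφ : ∀ i, evalZero k m (φ (X i)) = 0) (p : PolyX k m) :
    evalZero k m (φ (C (evalZero k m p))) = evalZero k m (φ p) := by
  induction p using MvPolynomial.induction_on with
  | C b => rw [evalZero_C]
  | add p q hp hq => simp only [map_add, hp, hq]
  | mul_X p i hp => simp only [map_mul, evalZero_X, map_zero, mul_zero, hφ]

/-- An automorphism compatible with a retraction `ε` induces an automorphism of the retract. -/
theorem exists_algEquiv_of_retraction {A B : Type*} [CommRing A] [CommRing B]
    [Algebra k A] [Algebra k B] (ε : B →ₐ[k] A) (c : A →ₐ[k] B) (hc : ∀ a, ε (c a) = a)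
    (φ : B ≃ₐ[k] B) (h : ∀ b, ε (φ (c (ε b))) = ε (φ b))
    (h' : ∀ b, ε (φ.symm (c (ε b))) = ε (φ.symm b)) : ∃ α : A ≃ₐ[k] A, ∀ a, α a = ε (φ (c a)) :=
  ⟨AlgEquiv.ofAlgHom ((ε.comp (φ : B →ₐ[k] B)).comp c) ((ε.comp (φ.symm : B →ₐ[k] B)).comp c)
    (AlgHom.ext fun a => (h _).trans (by simp [hc]))
    (AlgHom.ext fun a => (h' _).trans (by simp [hc])), fun _ => rfl⟩

theorem exists_pow_dvd_evalZero (hf : evalZero k m (φ (C f)) ≠ 0)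
    (hφ : ∀ p, θ (inclPoly r f p) = inclPoly s g (φ p)) {i l : Fin m}
    (hl : Associated (φ (X i)) (X l)) :
    ∃ j : ℕ, r i ≤ j * s l ∧ g ^ j ∣ evalZero k m (φ (C f)) := by
  obtain ⟨c, hc⟩ := hl
  let a : lauRing r f := ⟨AddMonoidAlgebra.single (-Pi.single i (r i : ℤ)) f, single_mem_lauRing
    (Or.inr ⟨1, by simp, fun l => by
      rw [Pi.neg_apply, Pi.single_apply]
      split_ifs with h
      · simp [h]
      · simp⟩)⟩
  have ha : xLau r f i ^ r i * a = inclLau r f f := Subtype.ext <| by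
    rw [Subalgebra.coe_mul, Subalgebra.coe_pow, coe_xLau, AddMonoidAlgebra.single_pow,
      AddMonoidAlgebra.single_mul_single, coe_inclLau, one_pow, one_mul]
    congr 1
    ext j
    by_cases h : j = i
    · subst h; simp
    · simp [h]
  have hv : xLau s g l ^ r i * θ a = inclPoly s g (c ^ r i * φ (C f)) := by
    rw [← inclPoly_X, ← hc, ← map_pow, mul_pow, map_mul, mul_right_comm, map_mul,
      ← hφ (C f), inclPoly_C, ← ha, map_mul, map_pow, map_pow θ, ← inclPoly_X, hφ]
    ring
  have hcoeff : (θ a : Lau k m).coeff (-Pi.single l (r i : ℤ)) =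
      evalZero k m c ^ r i * evalZero k m (φ (C f)) := by
    rw [← map_pow, ← map_mul, evalZero_eq_coeff, ← coeff_polyToLau,
      ← coe_inclPoly (r := s) (f := g), ← hv, Subalgebra.coe_mul, Subalgebra.coe_pow, coe_xLau,
      AddMonoidAlgebra.single_pow, one_pow, map_zero,
      show (0 : Fin m → ℤ) = r i • Pi.single l 1 + -Pi.single l (r i : ℤ) from ?_,
      AddMonoidAlgebra.coeff_single_mul_add, one_mul]
    ext j
    by_cases h : j = l
    · subst h; simp
    · simp [h]
  have hcu : IsUnit (evalZero k m c ^ r i) := (c.isUnit.map (evalZero k m)).pow _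
  have hmem := (θ a).2 (-Pi.single l (r i : ℤ))
  rw [hcoeff] at hmem
  rcases hmem with h | ⟨j, hj, hd⟩
  · exact absurd h (mul_ne_zero hcu.ne_zero hf)
  · refine ⟨j, ?_, hcu.dvd_mul_left.1 hj⟩
    have := hd l
    rw [Pi.neg_apply, Pi.single_eq_same] at this
    zify
    linarith

end ExpLines

namespace ExpLines

variable {k : Type} [Field k] {m : ℕ} {r s : Fin m → ℕ} {f g : MvPolynomial (Fin 2) k}
  {θ : lauRing r f ≃ₐ[k] lauRing s g} {φ : PolyX k m ≃ₐ[k] PolyX k m}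

theorem map_symm_inclPoly (hφ : ∀ p, θ (inclPoly r f p) = inclPoly s g (φ p)) (p : PolyX k m) :
    θ.symm (inclPoly s g p) = inclPoly r f (φ.symm p) := by
  rw [AlgEquiv.symm_apply_eq, hφ, AlgEquiv.apply_symm_apply]

theorem exists_algEquiv_eq_evalZero (hr : ∀ i, 1 < r i) (hs : ∀ i, 1 < s i) (hf : f ≠ 0)
    (hg : g ≠ 0) (hφ : ∀ p, θ (inclPoly r f p) = inclPoly s g (φ p)) :
    ∃ α : MvPolynomial (Fin 2) k ≃ₐ[k] MvPolynomial (Fin 2) k,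
      ∀ a, α a = evalZero k m (φ (C a)) := by
  refine exists_algEquiv_of_retraction (evalZero k m)
    (IsScalarTower.toAlgHom k (MvPolynomial (Fin 2) k) (PolyX k m)) evalZero_C φ
    (evalZero_map_C_evalZero fun i => ?_) (evalZero_map_C_evalZero fun i => ?_)
  · obtain ⟨l, hl⟩ := exists_associated_X hr hf hφ i
    exact evalZero_eq_zero_of_associated hl
  · obtain ⟨l, hl⟩ := exists_associated_X hs hg (map_symm_inclPoly hφ) i
    exact evalZero_eq_zero_of_associated hl

theorem exists_perm_le (hr : ∀ i, 1 < r i) (hs : ∀ i, 1 < s i) (hf : Prime f)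
    (hg : Prime g) (hφ : ∀ p, θ (inclPoly r f p) = inclPoly s g (φ p)) :
    ∃ σ : Equiv.Perm (Fin m), ∀ i, r i ≤ s (σ i) := by
  choose σ hσ using exists_associated_X hr hf.ne_zero hφ
  have hinj : Function.Injective σ := by
    intro i j hij
    have h1 : Associated (φ (X i)) (φ (X j)) := (hσ i).trans (hij ▸ (hσ j).symm)
    have h2 := h1.map φ.symm
    rw [AlgEquiv.symm_apply_apply, AlgEquiv.symm_apply_apply] at h2
    simpa [X_dvd_X] using h2.dvd
  refine ⟨Equiv.ofBijective σ (Finite.injective_iff_bijective.1 hinj), fun i => ?_⟩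
  obtain ⟨α, hα⟩ := exists_algEquiv_eq_evalZero hr hs hf.ne_zero hg.ne_zero hφ
  have hp : Prime (α f) := (MulEquiv.prime_iff α.toMulEquiv).2 hf
  obtain ⟨j, hj, hdvd⟩ := exists_pow_dvd_evalZero (hα f ▸ hp.ne_zero) hφ (hσ i)
  rw [← hα f] at hdvd
  have hj1 : j ≤ 1 := by
    by_contra! h
    obtain ⟨c, hc⟩ := (pow_dvd_pow g h).trans hdvd
    rw [pow_succ, pow_one, mul_assoc] at hc
    rcases hp.irreducible.isUnit_or_isUnit hc with h | h
    · exact hg.not_isUnit h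
    · exact hg.not_isUnit (isUnit_of_mul_isUnit_left h)
  exact hj.trans ((Nat.mul_le_mul_right _ hj1).trans_eq (one_mul _))

theorem exists_associated_algEquiv (i : Fin m) (hr : ∀ i, 1 < r i) (hs : ∀ i, 1 < s i)
    (hf : Prime f) (hg : Prime g) (hφ : ∀ p, θ (inclPoly r f p) = inclPoly s g (φ p)) :
    ∃ α : MvPolynomial (Fin 2) k ≃ₐ[k] MvPolynomial (Fin 2) k, Associated g (α f) := by
  obtain ⟨α, hα⟩ := exists_algEquiv_eq_evalZero hr hs hf.ne_zero hg.ne_zero hφ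
  have hp : Prime (α f) := (MulEquiv.prime_iff α.toMulEquiv).2 hf
  obtain ⟨l, hl⟩ := exists_associated_X hr hf.ne_zero hφ i
  obtain ⟨j, hj, hdvd⟩ := exists_pow_dvd_evalZero (hα f ▸ hp.ne_zero) hφ hl
  rw [← hα f] at hdvd
  have hj0 : j ≠ 0 := by
    rintro rfl
    have := hr i
    omega
  exact ⟨α, hg.associated_of_dvd hp ((dvd_pow_self g hj0).trans hdvd)⟩

theorem exists_perm_eq {σ σ' : Equiv.Perm (Fin m)} (h : ∀ i, r i ≤ s (σ i))
    (h' : ∀ i, s i ≤ r (σ' i)) (i : Fin m) : r i = s (σ i) := by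
  have h1 : ∑ i, s (σ i) ≤ ∑ i, r i := by
    rw [Equiv.sum_comp σ s, ← Equiv.sum_comp σ' r]
    exact Finset.sum_le_sum fun i _ => h' i
  exact (Finset.sum_eq_sum_iff_of_le fun i _ => h i).1
    ((Finset.sum_le_sum fun i _ => h i).antisymm h1) i (Finset.mem_univ i)

/-- Isomorphic rings have the same exponents and equivalent lines. -/
theorem eq_of_algEquiv (i : Fin m) {τ τ' : MvPolynomial (Fin 2) k →ₐ[k] Polynomial k}
    (hf : IsLineMap f τ) (hqf : ¬ ∃ q, Algebra.adjoin k {f, q} = ⊤) (hr : ∀ i, 1 < r i)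
    (hg : IsLineMap g τ') (hqg : ¬ ∃ q, Algebra.adjoin k {g, q} = ⊤) (hs : ∀ i, 1 < s i)
    (θ : lauRing r f ≃ₐ[k] lauRing s g) :
    (∃ σ : Equiv.Perm (Fin m), ∀ i, r i = s (σ i)) ∧
      ∃ α : MvPolynomial (Fin 2) k ≃ₐ[k] MvPolynomial (Fin 2) k, ∃ μ : k, μ ≠ 0 ∧
        α g = C μ * f := by
  obtain ⟨φ, hφ⟩ := exists_polyX_algEquiv hf hqf hr hg hqg hs θ
  constructor
  · obtain ⟨σ, hσ⟩ := exists_perm_le hr hs hf.prime hg.prime hφ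
    obtain ⟨σ', hσ'⟩ := exists_perm_le hs hr hg.prime hf.prime (map_symm_inclPoly hφ)
    exact ⟨σ, exists_perm_eq hσ hσ'⟩
  · obtain ⟨α, u, hu⟩ := exists_associated_algEquiv i hs hr hg.prime hf.prime
      (map_symm_inclPoly hφ)
    obtain ⟨μ, hμ, hc⟩ := MvPolynomial.isUnit_iff_eq_C_of_isReduced.1 u.isUnit
    exact ⟨α, μ, hμ.ne_zero, by rw [← hu, hc, mul_comm]⟩

end ExpLines

namespace ExpLines

variable {k : Type} [Field k] {m : ℕ} {r s : Fin m → ℕ} {f g : MvPolynomial (Fin 2) k}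

theorem exists_minimal_exponent (hr : ∀ i, 1 < r i) (d : Fin m → ℤ) :
    ∃ j : ℕ, (∀ i, 0 ≤ d i + j * r i) ∧ ∀ l : ℕ, (∀ i, 0 ≤ d i + l * r i) → j ≤ l := by
  classical
  have h : ∃ j : ℕ, ∀ i, 0 ≤ d i + j * r i := by
    refine ⟨∑ i, (d i).natAbs, fun i => ?_⟩
    have h1 := Finset.single_le_sum (f := fun i => (d i).natAbs) (fun _ _ => Nat.zero_le _)
      (Finset.mem_univ i)
    have h2 : (d i).natAbs ≤ (∑ i, (d i).natAbs) * r i :=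
      h1.trans (Nat.le_mul_of_pos_right _ (zero_lt_one.trans (hr i)))
    have h3 : ((d i).natAbs : ℤ) ≤ ((∑ i, (d i).natAbs : ℕ) : ℤ) * r i := by exact_mod_cast h2
    omega
  exact ⟨Nat.find h, Nat.find_spec h, fun l hl => Nat.find_min' h hl⟩

theorem injective_of_relation {A : Type*} [CommRing A] [Algebra k A] (hr : ∀ i, 1 < r i) (hf : f ≠ 0)
    {x : Fin m → A} {y : A} {ι : MvPolynomial (Fin 2) k →ₐ[k] A} (hrel : (∏ i, x i ^ r i) * y = ι f)
    (hspan : ∀ S : AddSubmonoid A, (∀ b j (n : Fin m → ℕ), ι b * y ^ j * ∏ i, x i ^ n i ∈ S) →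
      ∀ a, a ∈ S)
    {π : A →ₐ[k] lauRing r f} (hx : ∀ i, π (x i) = xLau r f i) (hy : π y = yLau r f)
    (hι : ∀ b, π (ι b) = inclLau r f b) : Function.Injective π := by
  choose κ hκ hmin using exists_minimal_exponent hr
  let u (d : Fin m → ℤ) : A := y ^ κ d * ∏ i, x i ^ (d i + κ d * r i).toNat
  let N : ((Fin m → ℤ) →₀ MvPolynomial (Fin 2) k) →+ A :=
    Finsupp.liftAddHom fun d => (AddMonoidHom.mulRight (u d)).comp (ι : _ →+ A)
  have hN (d : Fin m → ℤ) (b) : N (Finsupp.single d b) = ι b * u d := by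
    simp [N]
  have hsurj : ∀ a, a ∈ AddMonoidHom.mrange N := by
    refine hspan _ fun b j n => ?_
    obtain ⟨d, hd⟩ : ∃ d : Fin m → ℤ, ∀ i, d i = n i - j * r i := ⟨_, fun _ => rfl⟩
    obtain ⟨t, ht⟩ := Nat.exists_eq_add_of_le (hmin d j fun i => by simp [hd])
    refine ⟨Finsupp.single d (b * f ^ t), ?_⟩
    rw [hN, map_mul, map_pow, ← hrel, mul_pow, ← Finset.prod_pow]
    have hn (i) : n i = (d i + κ d * r i).toNat + r i * t := by
      zify
      rw [Int.toNat_of_nonneg (hκ d i)]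
      rw [hd, ht]
      push_cast
      ring
    have hprod : ∏ i, x i ^ n i =
        (∏ i, x i ^ (d i + κ d * r i).toNat) * ∏ i, (x i ^ r i) ^ t := by
      rw [← Finset.prod_mul_distrib]
      exact Finset.prod_congr rfl fun i _ => by rw [hn i, pow_add, pow_mul]
    rw [hprod, ht, pow_add]
    ring
  have hπ (b) (d : Fin m → ℤ) : ((π (N b) : lauRing r f) : Lau k m).coeff d = b d * f ^ κ d := by
    induction b using Finsupp.induction_linear with
    | zero => simp
    | add p q hp hq =>
      rw [map_add, map_add, Subalgebra.coe_add, AddMonoidAlgebra.coeff_add, Finsupp.add_apply,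
        Finsupp.add_apply, hp, hq, add_mul]
    | single e b =>
      have h : π (N (Finsupp.single e b)) = inclLau r f b * yLau r f ^ κ e *
          ∏ i, xLau r f i ^ (e i + κ e * r i).toNat := by
        simp only [hN, u, map_mul, map_pow, map_prod, hx, hy, hι, mul_assoc]
      have he : (fun i => ((e i + κ e * r i).toNat : ℤ) - κ e * r i) = e := by
        ext i
        rw [Int.toNat_of_nonneg (hκ e i)]
        ring
      rw [h, coe_monomial, he, AddMonoidAlgebra.coeff_single]
      by_cases hed : e = d
      · subst hed; simp
      · simp [hed]
  rw [injective_iff_map_eq_zero]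
  intro a ha
  obtain ⟨b, rfl⟩ := hsurj a
  have : b = 0 := by
    ext1 d
    have := hπ b d
    rw [ha] at this
    simpa [hf] using this.symm
  rw [this, map_zero]

end ExpLines

namespace ExpLines

variable {k : Type} [Field k] {m : ℕ} {r s : Fin m → ℕ} {f g : MvPolynomial (Fin 2) k}

variable (k m r f) in
/-- The map from `k[Z,T]`. -/
def inclA : MvPolynomial (Fin 2) k →ₐ[k] RingA k m r (rename Sum.inr f) :=
  (Ideal.Quotient.mkₐ k _).comp (rename (Sum.inr ∘ Fin.succ))

theorem relation_ringA : (∏ i, xA k m r (rename Sum.inr f) i ^ r i) * yA k m r (rename Sum.inr f) =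
    inclA k m r f f := by
  have h : incl k m (rename Sum.inr f) = rename (Sum.inr ∘ Fin.succ) f := by
    rw [incl, rename_rename]; rfl
  simp only [xA, yA, inclA, AlgHom.comp_apply, Ideal.Quotient.mkₐ_eq_mk, ← map_pow, ← map_prod,
    ← map_mul]
  rw [Ideal.Quotient.mk_eq_mk_iff_sub_mem, ← h]
  exact Ideal.mem_span_singleton_self _

/-- The homomorphisms given by elements satisfying the defining relation. -/
theorem exists_algHom_ringA {A : Type*} [CommRing A] [Algebra k A] (x : Fin m → A) (y : A)
    (ι : MvPolynomial (Fin 2) k →ₐ[k] A) (hrel : (∏ i, x i ^ r i) * y = ι f) :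
    ∃ π : RingA k m r (rename Sum.inr f) →ₐ[k] A, (∀ i, π (xA k m r _ i) = x i) ∧
      π (yA k m r _) = y ∧ ∀ b, π (inclA k m r f b) = ι b := by
  let v : Fin m ⊕ Fin 3 → A := Sum.elim x (Fin.cases y fun c => ι (X c))
  have hι (b) : aeval v (rename (Sum.inr ∘ Fin.succ) b) = ι b := by
    rw [aeval_rename]
    exact DFunLike.congr_fun (algHom_ext (f := aeval _) (g := ι) fun c => by simp [v]) b
  have h0 : aeval v (relG k m r (rename Sum.inr f)) = 0 := by
    have h : incl k m (rename Sum.inr f) = rename (Sum.inr ∘ Fin.succ) f := by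
      rw [incl, rename_rename]; rfl
    rw [relG, h, map_sub, hι, ← hrel]
    simp [v]
  refine ⟨Ideal.Quotient.liftₐ _ (aeval v) fun a ha => ?_, fun i => ?_, ?_, fun b => ?_⟩
  · obtain ⟨c, rfl⟩ := Ideal.mem_span_singleton'.1 ha
    rw [map_mul, h0, mul_zero]
  · exact aeval_X v (Sum.inl i)
  · exact aeval_X v (Sum.inr 0)
  · exact hι b

theorem ringA_mem_of_monomial_mem (S : AddSubmonoid (RingA k m r (rename Sum.inr f)))
    (hS : ∀ b j (n : Fin m → ℕ),
      inclA k m r f b * yA k m r _ ^ j * ∏ i, xA k m r _ i ^ n i ∈ S) (a) : a ∈ S := by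
  obtain ⟨p, rfl⟩ := Ideal.Quotient.mk_surjective a
  induction p using MvPolynomial.induction_on' with
  | monomial n c =>
    convert hS (C c * (X 0 ^ n (Sum.inr 1) * X 1 ^ n (Sum.inr 2))) (n (Sum.inr 0))
      fun i => n (Sum.inl i) using 1
    simp only [xA, yA, inclA, AlgHom.comp_apply, Ideal.Quotient.mkₐ_eq_mk, ← map_pow, ← map_prod,
      ← map_mul]
    congr 1
    rw [monomial_eq, Finsupp.prod_fintype _ _ (by simp), Fintype.prod_sum_type,
      Fin.prod_univ_three]
    simp only [map_mul, map_pow, rename_C, rename_X, Function.comp_apply]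
    change _ = C c * (X (Sum.inr 1) ^ _ * X (Sum.inr 2) ^ _) * _ * _
    ring
  | add p q hp hq => rw [map_add]; exact add_mem hp hq

theorem ringA_algHom_ext {A : Type*} [CommRing A] [Algebra k A]
    {φ ψ : RingA k m r (rename Sum.inr f) →ₐ[k] A} (hx : ∀ i, φ (xA k m r _ i) = ψ (xA k m r _ i))
    (hy : φ (yA k m r _) = ψ (yA k m r _)) (hι : ∀ b, φ (inclA k m r f b) = ψ (inclA k m r f b)) :
    φ = ψ := by
  ext a
  refine ringA_mem_of_monomial_mem (AddMonoidHom.eqLocusM (φ : _ →+ A) (ψ : _ →+ A))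
    (fun b j n => ?_) a
  change φ _ = ψ _
  simp only [map_mul, map_pow, map_prod, hx, hy, hι]

theorem nonempty_ringA_algEquiv_lauRing (hr : ∀ i, 1 < r i) (hf : f ≠ 0) :
    Nonempty (RingA k m r (rename Sum.inr f) ≃ₐ[k] lauRing r f) := by
  obtain ⟨π, hx, hy, hι⟩ : ∃ π : RingA k m r (rename Sum.inr f) →ₐ[k] lauRing r f,
      (∀ i, π (xA k m r _ i) = xLau r f i) ∧ π (yA k m r _) = yLau r f ∧
      ∀ b, π (inclA k m r f b) = inclLau r f b :=
    exists_algHom_ringA (A := lauRing r f) (xLau r f) (yLau r f) (inclLau r f) prod_xLau_mul_yLau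
  have hinj : Function.Injective π :=
    injective_of_relation hr hf relation_ringA ringA_mem_of_monomial_mem hx hy hι
  have hsurj : π.range = ⊤ := adjoin_eq_top_of_generators (fun i => ⟨_, hx i⟩) ⟨_, hy⟩
    ⟨_, hι _⟩ ⟨_, hι _⟩
  exact ⟨AlgEquiv.ofBijective π ⟨hinj, (AlgHom.range_eq_top π).1 hsurj⟩⟩

theorem exists_algHom_of_perm {σ : Equiv.Perm (Fin m)} (hσ : ∀ i, r i = s (σ i))
    (β : MvPolynomial (Fin 2) k →ₐ[k] MvPolynomial (Fin 2) k) {ν : k} (hβ : β f = C ν * g) :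
    ∃ π : RingA k m r (rename Sum.inr f) →ₐ[k] RingA k m s (rename Sum.inr g),
      (∀ i, π (xA k m r _ i) = xA k m s _ (σ i)) ∧ π (yA k m r _) = ν • yA k m s _ ∧
      ∀ b, π (inclA k m r f b) = inclA k m s g (β b) := by
  refine exists_algHom_ringA (fun i => xA k m s _ (σ i)) (ν • yA k m s _)
    ((inclA k m s g).comp β) ?_
  rw [AlgHom.comp_apply, hβ, ← smul_eq_C_mul, map_smul, ← relation_ringA, mul_smul_comm,
    ← Equiv.prod_comp σ fun i => xA k m s (rename Sum.inr g) i ^ s i]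
  simp only [hσ]

theorem nonempty_algEquiv_of_perm {σ : Equiv.Perm (Fin m)} (hσ : ∀ i, r i = s (σ i))
    (α : MvPolynomial (Fin 2) k ≃ₐ[k] MvPolynomial (Fin 2) k) {μ : k} (hμ : μ ≠ 0)
    (hα : α g = C μ * f) :
    Nonempty (RingA k m r (rename Sum.inr f) ≃ₐ[k] RingA k m s (rename Sum.inr g)) := by
  have hα' : α.symm f = C μ⁻¹ * g := by
    rw [AlgEquiv.symm_apply_eq, map_mul, hα, ← mul_assoc, ← algebraMap_eq, AlgEquiv.commutes,
      ← map_mul, inv_mul_cancel₀ hμ, map_one, one_mul]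
  obtain ⟨π, hπx, hπy, hπι⟩ := exists_algHom_of_perm hσ (α.symm : _ →ₐ[k] _) hα'
  obtain ⟨ρ, hρx, hρy, hρι⟩ := exists_algHom_of_perm (r := s) (s := r) (σ := σ.symm)
    (fun i => by rw [hσ, Equiv.apply_symm_apply]) (α : _ →ₐ[k] _) hα
  refine ⟨AlgEquiv.ofAlgHom π ρ (ringA_algHom_ext (fun i => ?_) ?_ fun b => ?_)
    (ringA_algHom_ext (fun i => ?_) ?_ fun b => ?_)⟩
  · simp [hπx, hρx]
  · simp [hπy, hρy, smul_smul, hμ]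
  · simp [hπι, hρι]
  · simp [hπx, hρx]
  · simp [hπy, hρy, smul_smul, hμ]
  · simp [hπι, hρι]

end ExpLines

theorem statement17 (k : Type) [Field k] (m : ℕ) (hm : 1 ≤ m)
    (r s : Fin m → ℕ) (hr : ∀ i, 1 < r i) (hs : ∀ i, 1 < s i)
    (f g : MvPolynomial (Fin 2) k)
    (hf : IsNontrivialLine k f) (hg : IsNontrivialLine k g) :
    Nonempty (RingA k m r (rename Sum.inr f) ≃ₐ[k] RingA k m s (rename Sum.inr g)) ↔
      ((∃ σ : Equiv.Perm (Fin m), ∀ i, r i = s (σ i)) ∧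
       (∃ α : MvPolynomial (Fin 2) k ≃ₐ[k] MvPolynomial (Fin 2) k, ∃ μ : k, μ ≠ 0 ∧
         α g = C μ * f)) := by
  constructor
  · rintro ⟨e⟩
    obtain ⟨τ, hτ⟩ := ExpLines.exists_isLineMap hf.1
    obtain ⟨τ', hτ'⟩ := ExpLines.exists_isLineMap hg.1
    obtain ⟨e₁⟩ := ExpLines.nonempty_ringA_algEquiv_lauRing hr hτ.ne_zero
    obtain ⟨e₂⟩ := ExpLines.nonempty_ringA_algEquiv_lauRing hs hτ'.ne_zero
    exact ExpLines.eq_of_algEquiv ⟨0, hm⟩ hτ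
      (fun ⟨q, hq⟩ => hf.2 (ExpLines.nonempty_equiv_of_adjoin_eq_top hq)) hr hτ'
      (fun ⟨q, hq⟩ => hg.2 (ExpLines.nonempty_equiv_of_adjoin_eq_top hq)) hs
      ((e₁.symm.trans e).trans e₂)
  · rintro ⟨⟨σ, hσ⟩, α, μ, hμ, hα⟩
    exact ExpLines.nonempty_algEquiv_of_perm hσ α hμ hα
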